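/- Let Ω be a Runge domain in ℂ², h : Ω → ℂ a holomorphic function, and M := { z ∈ Ω : |h(z)| = 1 }. Let G := Ω ∖ { z ∈ Ω : |h(z)| = 1, dh(z) = 0 }, let M* := { z ∈ G : |h(z)| = 1 } be the regular part of M, and let M_sing := M ∖ M* be the singular part. Let K be a totally real C²-smooth disc contained in M*. Then K is polynomially convex if and only if K̂ ∩ M_sing = ∅. -/

import Mathlib

noncomputable section

/-- The polynomial (convex) hull of a set `K ⊆ ℂⁿ`:
`K̂ = { z : |p(z)| ≤ sup_K |p| for every holomorphic polynomial p }`. -/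
def polyHull (n : ℕ) (K : Set (Fin n → ℂ)) : Set (Fin n → ℂ) :=
  {z | ∀ p : MvPolynomial (Fin n) ℂ,
    ‖MvPolynomial.eval z p‖ ≤ sSup ((fun w => ‖MvPolynomial.eval w p‖) '' K)}

/-- A set `K ⊆ ℂⁿ` is polynomially convex if it equals its polynomial hull. -/
def PolyConvex (n : ℕ) (K : Set (Fin n → ℂ)) : Prop := polyHull n K = K

/-- A Runge domain in `ℂⁿ`: a domain on which every holomorphic function can be
approximated uniformly on compact subsets by holomorphic polynomials. -/
def RungeDomain (n : ℕ) (Ω : Set (Fin n → ℂ)) : Prop :=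
  IsOpen Ω ∧ IsConnected Ω ∧
  ∀ f : (Fin n → ℂ) → ℂ, DifferentiableOn ℂ f Ω →
    ∀ K : Set (Fin n → ℂ), K ⊆ Ω → IsCompact K → ∀ ε : ℝ, 0 < ε →
      ∃ p : MvPolynomial (Fin n) ℂ, ∀ z ∈ K, ‖f z - MvPolynomial.eval z p‖ ≤ ε

/-- `K ⊆ ℂⁿ` is a totally real `C²`-smooth disc: the image of the closed unit
disc in `ℝ²` under a `C²` embedding `φ` (defined on an open neighborhood `U` of
the closed disc) whose image is a totally real submanifold, i.e. at each point
the tangent plane `W = range (dφ)` satisfies `W ∩ i·W = {0}`. -/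
def TotallyRealDisc (n : ℕ) (K : Set (Fin n → ℂ)) : Prop :=
  ∃ (U : Set (ℝ × ℝ)) (φ : ℝ × ℝ → (Fin n → ℂ)),
    IsOpen U ∧ Metric.closedBall (0 : ℝ × ℝ) 1 ⊆ U ∧
    ContDiffOn ℝ 2 φ U ∧ Set.InjOn φ U ∧
    (∀ x ∈ U, Function.Injective (fderiv ℝ φ x)) ∧
    (∀ x ∈ U, ∀ v w : ℝ × ℝ,
      fderiv ℝ φ x v = Complex.I • fderiv ℝ φ x w → fderiv ℝ φ x v = 0) ∧
    K = φ '' Metric.closedBall (0 : ℝ × ℝ) 1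

section

/-- The resolvent set of `f` relative to a function algebra `B`. -/
def funResolvent {X : Type*} [TopologicalSpace X] (B : Subalgebra ℂ C(X, ℂ)) (f : C(X, ℂ)) : Set ℂ :=
  {l | ∃ g ∈ B, ∀ x, (f x - l) * g x = 1}

section FunAlg

variable {X : Type*} [TopologicalSpace X] [CompactSpace X] {B : Subalgebra ℂ C(X, ℂ)}
  {f : C(X, ℂ)}

theorem mem_funResolvent_iff (hf : f ∈ B) {l : ℂ} :
    l ∈ funResolvent B f ↔ l ∈ resolventSet ℂ (⟨f, hf⟩ : B) := by
  rw [spectrum.mem_resolventSet_iff]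
  constructor
  · rintro ⟨g, hg, h⟩
    refine IsUnit.of_mul_eq_one (⟨-g, B.neg_mem hg⟩ : B) ?_
    ext x
    have := h x
    simp [Algebra.algebraMap_eq_smul_one]
    linear_combination this
  · rintro ⟨u, hu⟩
    refine ⟨-((u⁻¹ : Bˣ) : B).1, B.neg_mem (Subtype.property _), fun x => ?_⟩
    have h1 : (u : B) * ((u⁻¹ : Bˣ) : B) = 1 := by simp
    rw [hu] at h1
    have h2 := congrArg (fun b : B => b.1 x) h1
    simp [Algebra.algebraMap_eq_smul_one] at h2 ⊢
    linear_combination h2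

theorem isOpen_funResolvent (hB : IsClosed (B : Set C(X, ℂ))) (hf : f ∈ B) :
    IsOpen (funResolvent B f) := by
  have : CompleteSpace B := hB.completeSpace_coe
  have : funResolvent B f = resolventSet ℂ (⟨f, hf⟩ : B) := by
    ext l; exact mem_funResolvent_iff hf
  rw [this]
  exact spectrum.isOpen_resolventSet _

theorem mem_funResolvent_of_norm_lt (hB : IsClosed (B : Set C(X, ℂ))) (hf : f ∈ B) {l : ℂ}
    (hl : ‖f‖ < ‖l‖) : l ∈ funResolvent B f := by
  have : CompleteSpace B := hB.completeSpace_coe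
  rw [mem_funResolvent_iff hf]
  cases isEmpty_or_nonempty X
  · have : Subsingleton B := ⟨fun a b => by ext x; exact isEmptyElim x⟩
    exact isUnit_of_subsingleton _
  · have : NormOneClass B := ⟨by
      change ‖(1 : C(X, ℂ))‖ = 1
      exact norm_one⟩
    exact spectrum.mem_resolventSet_of_norm_lt hl

theorem isClosed_funResolvent_within (hB : IsClosed (B : Set C(X, ℂ))) {l : ℂ}
    (hl : ∀ x, f x ≠ l) (hcl : l ∈ closure (funResolvent B f)) : l ∈ funResolvent B f := by
  have hinv : ∀ x, f x - l ≠ 0 := fun x => sub_ne_zero.2 (hl x)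
  let g : C(X, ℂ) := ⟨fun x => (f x - l)⁻¹, by
    exact Continuous.inv₀ (by fun_prop) hinv⟩
  refine ⟨g, ?_, fun x => mul_inv_cancel₀ (hinv x)⟩
  rw [← SetLike.mem_coe, ← hB.closure_eq, Metric.mem_closure_iff]
  intro ε hε
  rw [Metric.mem_closure_iff] at hcl
  -- choose a nearby resolvent point
  set N := ‖g‖ + 1 with hN
  have hNpos : 0 < N := by positivity
  obtain ⟨m, ⟨k, hk, hkm⟩, hm⟩ := hcl (min (1 / (2 * N)) (ε / (4 * N ^ 2))) (by positivity)
  refine ⟨k, hk, ?_⟩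
  rw [dist_comm, dist_eq_norm] at hm
  rw [dist_eq_norm]
  refine lt_of_le_of_lt ((ContinuousMap.norm_le _ (C := ε / 2) (by positivity)).2 fun x => ?_)
    (by linarith)
  have hg1 : ‖g x‖ ≤ N := (g.norm_coe_le_norm x).trans (by simp [hN])
  have hgx : (f x - l) * g x = 1 := mul_inv_cancel₀ (hinv x)
  have h2 : g x - k x = -(m - l) * (g x * k x) := by
    linear_combination k x * hgx - g x * hkm x
  have hml : ‖m - l‖ ≤ 1 / (2 * N) := hm.le.trans (min_le_left _ _)
  have hml' : ‖m - l‖ ≤ ε / (4 * N ^ 2) := hm.le.trans (min_le_right _ _)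
  have hk1 : ‖k x‖ ≤ 2 * N := by
    have : k x = g x + (m - l) * (g x * k x) := by linear_combination -h2
    have h3 : ‖k x‖ ≤ N + 1 / (2 * N) * (N * ‖k x‖) := by
      calc ‖k x‖ = ‖g x + (m - l) * (g x * k x)‖ := by rw [← this]
        _ ≤ ‖g x‖ + ‖m - l‖ * (‖g x‖ * ‖k x‖) := by
            refine (norm_add_le _ _).trans ?_
            rw [norm_mul, norm_mul]
        _ ≤ _ := by gcongr
    have h4 : 1 / (2 * N) * (N * ‖k x‖) = ‖k x‖ / 2 := by field_simp
    linarith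
  calc ‖(g - k) x‖ = ‖g x - k x‖ := rfl
    _ = ‖m - l‖ * (‖g x‖ * ‖k x‖) := by rw [h2, norm_mul, norm_neg, norm_mul]
    _ ≤ ε / (4 * N ^ 2) * (N * (2 * N)) := by gcongr
    _ = ε / 2 := by field_simp; norm_num

theorem funResolvent_of_isPreconnected (hB : IsClosed (B : Set C(X, ℂ))) (hf : f ∈ B) {V : Set ℂ}
    (hV : IsPreconnected V) (hVf : ∀ x, f x ∉ V) (hne : (V ∩ funResolvent B f).Nonempty) :
    V ⊆ funResolvent B f := by
  refine hV.subset_of_closure_inter_subset (isOpen_funResolvent hB hf) hne ?_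
  rintro l ⟨hl, hlV⟩
  exact isClosed_funResolvent_within hB (fun x hx => hVf x (hx ▸ hlV)) hl

/-- A ray missing the range of `f` consists of resolvent points. -/
theorem mem_funResolvent_of_ray (hB : IsClosed (B : Set C(X, ℂ))) (hf : f ∈ B) {l : ℂ}
    (hl : ∀ t : ℝ, 0 ≤ t → ∀ x, f x ≠ l + t) : l ∈ funResolvent B f := by
  let V : Set ℂ := (fun t : ℝ => l + (t : ℂ)) '' Set.Ici 0
  have hV : IsPreconnected V := isPreconnected_Ici.image _ (by fun_prop)
  refine funResolvent_of_isPreconnected hB hf hV ?_ ?_ ⟨0, by simp, by simp⟩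
  · rintro x ⟨t, ht, h⟩
    exact hl t ht x h.symm
  · have ht : (0 : ℝ) ≤ ‖f‖ + ‖l‖ + 1 := by positivity
    refine ⟨l + ((‖f‖ + ‖l‖ + 1 : ℝ) : ℂ), ⟨_, ht, rfl⟩, mem_funResolvent_of_norm_lt hB hf ?_⟩
    have := norm_sub_le_norm_add l ((‖f‖ + ‖l‖ + 1 : ℝ) : ℂ)
    have h2 : ‖((‖f‖ + ‖l‖ + 1 : ℝ) : ℂ)‖ = ‖f‖ + ‖l‖ + 1 := by
      rw [Complex.norm_real, Real.norm_of_nonneg ht]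
    have h3 := norm_sub_norm_le ((‖f‖ + ‖l‖ + 1 : ℝ) : ℂ) (-l)
    rw [norm_neg, sub_neg_eq_add, h2, add_comm ((‖f‖ + ‖l‖ + 1 : ℝ) : ℂ)] at h3
    linarith

theorem exists_character_of_notMem_funResolvent (hB : IsClosed (B : Set C(X, ℂ))) (hf : f ∈ B)
    {l : ℂ} (hl : l ∉ funResolvent B f) :
    ∃ χ : B →ₐ[ℂ] ℂ, χ ⟨f, hf⟩ = l := by
  have : CompleteSpace B := hB.completeSpace_coe
  rw [mem_funResolvent_iff hf, ← Set.mem_compl_iff] at hl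
  obtain ⟨χ, hχ⟩ := WeakDual.CharacterSpace.mem_spectrum_iff_exists.1 hl
  exact ⟨WeakDual.CharacterSpace.toAlgHom χ, hχ⟩

theorem norm_character_le (hB : IsClosed (B : Set C(X, ℂ))) (χ : B →ₐ[ℂ] ℂ) (b : B) :
    ‖χ b‖ ≤ ‖b‖ := by
  have : CompleteSpace B := hB.completeSpace_coe
  cases isEmpty_or_nonempty X
  · have : b = 0 := by ext x; exact isEmptyElim x
    simp [this]
  · have : NormOneClass B := ⟨by
      change ‖(1 : C(X, ℂ))‖ = 1
      exact norm_one⟩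
    exact AlgHom.norm_apply_le_self χ b

theorem notMem_funResolvent_of_character (hf : f ∈ B) (χ : B →ₐ[ℂ] ℂ) :
    χ ⟨f, hf⟩ ∉ funResolvent B f := by
  rw [mem_funResolvent_iff hf]
  exact AlgHom.apply_mem_spectrum χ _

/-- A character is carried by the set where a peaking function has modulus one. -/
theorem norm_character_le_of_peak (hB : IsClosed (B : Set C(X, ℂ))) (χ : B →ₐ[ℂ] ℂ) {v : B}
    (hv : ∀ x, ‖v.1 x‖ ≤ 1) (hχ : ‖χ v‖ = 1) (a : B) {s : ℝ}
    (hs : ∀ x, ‖v.1 x‖ = 1 → ‖a.1 x‖ < s) (hs0 : 0 < s) : ‖χ a‖ ≤ s := by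
  -- on the set where `|a| ≥ s`, `|v|` is at most some `ρ < 1`
  have hK : IsCompact {x | s ≤ ‖a.1 x‖} :=
    (isClosed_le continuous_const (by fun_prop)).isCompact
  obtain ⟨ρ, hρ0, hρ1, hρ⟩ : ∃ ρ : ℝ, 0 ≤ ρ ∧ ρ < 1 ∧ ∀ x, s ≤ ‖a.1 x‖ → ‖v.1 x‖ ≤ ρ := by
    rcases Set.eq_empty_or_nonempty {x | s ≤ ‖a.1 x‖} with h | h
    · exact ⟨0, le_rfl, zero_lt_one, fun x hx => (h.le hx).elim⟩
    · obtain ⟨x0, hx0, hmax⟩ := hK.exists_isMaxOn h (f := fun x => ‖v.1 x‖) (by fun_prop)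
      refine ⟨‖v.1 x0‖, norm_nonneg _, lt_of_le_of_ne (hv x0) fun h1 => ?_, fun x hx => hmax hx⟩
      exact absurd (hs x0 h1) (not_lt.2 hx0)
  obtain ⟨m, hm⟩ : ∃ m : ℕ, ‖a‖ * ρ ^ m ≤ s := by
    have : Filter.Tendsto (fun m : ℕ => ‖a‖ * ρ ^ m) Filter.atTop (nhds (‖a‖ * 0)) :=
      (tendsto_pow_atTop_nhds_zero_of_lt_one hρ0 hρ1).const_mul _
    rw [mul_zero] at this
    obtain ⟨m, hm⟩ := (this.eventually (gt_mem_nhds hs0)).exists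
    exact ⟨m, hm.le⟩
  have h1 : ‖χ (a * v ^ m)‖ = ‖χ a‖ := by
    rw [map_mul, map_pow, norm_mul, norm_pow, hχ, one_pow, mul_one]
  rw [← h1]
  refine (norm_character_le hB χ _).trans ?_
  change ‖(a * v ^ m).1‖ ≤ s
  refine (ContinuousMap.norm_le _ hs0.le).2 fun x => ?_
  change ‖a.1 x * (v.1 x) ^ m‖ ≤ s
  rw [norm_mul, norm_pow]
  rcases lt_or_ge ‖a.1 x‖ s with h | h
  · calc _ ≤ ‖a.1 x‖ * 1 := by gcongr; exact pow_le_one₀ (norm_nonneg _) (hv x)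
      _ ≤ s := by linarith
  · calc _ ≤ ‖a‖ * ρ ^ m := by
          gcongr
          · exact a.1.norm_coe_le_norm x
          · exact hρ x h
      _ ≤ s := hm

end FunAlg

end

section

open MeasureTheory Real

theorem lintegral_ball_inv_norm_le {η : ℝ} (hη : 0 < η) (w : ℂ) :
    ∫⁻ z in Metric.ball w η, ENNReal.ofReal (‖z - w‖⁻¹) ≤ ENNReal.ofReal (2 * π * η) := by
  have h1 : ∫⁻ z in Metric.ball w η, ENNReal.ofReal (‖z - w‖⁻¹)
      = ∫⁻ z, (Metric.ball (0 : ℂ) η).indicator (fun z => ENNReal.ofReal (‖z‖⁻¹)) (z - w) := by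
    rw [← lintegral_indicator Metric.isOpen_ball.measurableSet]
    refine lintegral_congr fun z => ?_
    simp [Set.indicator, dist_eq_norm]
  rw [h1, lintegral_sub_right_eq_self, ← Complex.lintegral_comp_polarCoord_symm]
  calc ∫⁻ p in polarCoord.target, ENNReal.ofReal p.1 •
        (Metric.ball (0 : ℂ) η).indicator (fun z => ENNReal.ofReal (‖z‖⁻¹))
          (Complex.polarCoord.symm p)
      ≤ ∫⁻ p in polarCoord.target,
          (Set.Ioo (0 : ℝ) η ×ˢ Set.Ioo (-π) π).indicator (fun _ => 1) p := by
        refine setLIntegral_mono' polarCoord.open_target.measurableSet fun p hp => ?_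
        rw [polarCoord_target] at hp
        have hp1 : 0 < p.1 := hp.1
        have hn : ‖Complex.polarCoord.symm p‖ = p.1 := by
          rw [Complex.norm_polarCoord_symm, abs_of_pos hp1]
        by_cases h : p.1 < η
        · rw [Set.indicator_of_mem (by rwa [mem_ball_zero_iff, hn]),
            Set.indicator_of_mem (show p ∈ Set.Ioo (0 : ℝ) η ×ˢ Set.Ioo (-π) π from
              ⟨⟨hp1, h⟩, hp.2⟩), hn, smul_eq_mul,
            ← ENNReal.ofReal_mul hp1.le, mul_inv_cancel₀ hp1.ne']
          simp
        · rw [Set.indicator_of_notMem (by rwa [mem_ball_zero_iff, hn])]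
          simp
    _ ≤ ∫⁻ p, (Set.Ioo (0 : ℝ) η ×ˢ Set.Ioo (-π) π).indicator (fun _ => 1) p :=
        setLIntegral_le_lintegral _ _
    _ = ENNReal.ofReal (2 * π * η) := by
        rw [lintegral_indicator (measurableSet_Ioo.prod measurableSet_Ioo)]
        simp only [lintegral_const, one_mul, Measure.restrict_apply MeasurableSet.univ,
          Set.univ_inter]
        rw [Measure.volume_eq_prod, Measure.prod_prod, Real.volume_Ioo, Real.volume_Ioo,
          ← ENNReal.ofReal_mul (by linarith)]
        congr 1; ring

theorem setLIntegral_inv_norm_le {η : ℝ} (hη : 0 < η) (w : ℂ) (U : Set ℂ)  :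
    ∫⁻ z in U, ENNReal.ofReal (‖z - w‖⁻¹) ≤
      ENNReal.ofReal (2 * π * η) + ENNReal.ofReal (η⁻¹) * volume U := by
  calc ∫⁻ z in U, ENNReal.ofReal (‖z - w‖⁻¹)
      ≤ ∫⁻ z in U, ((Metric.ball w η).indicator (fun z => ENNReal.ofReal (‖z - w‖⁻¹)) z +
          ENNReal.ofReal (η⁻¹)) := by
        refine lintegral_mono fun z => ?_
        by_cases h : z ∈ Metric.ball w η
        · rw [Set.indicator_of_mem h]
          exact le_self_add
        · rw [Set.indicator_of_notMem h, zero_add]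
          rw [Metric.mem_ball, dist_eq_norm, not_lt] at h
          gcongr
    _ = (∫⁻ z in U, (Metric.ball w η).indicator (fun z => ENNReal.ofReal (‖z - w‖⁻¹)) z) +
          ENNReal.ofReal (η⁻¹) * volume U := by
        rw [lintegral_add_right _ measurable_const]
        simp
    _ ≤ _ := by
        gcongr
        refine (setLIntegral_le_lintegral _ _).trans ?_
        rw [lintegral_indicator Metric.isOpen_ball.measurableSet]
        exact lintegral_ball_inv_norm_le hη w

theorem circle_kernel_integral {ρ : ℝ} (hρ : 0 < ρ) {w : ℂ} (hw : ‖w‖ ≠ ρ) :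
    ∫ θ in (-π)..π, (circleMap 0 ρ θ) / (circleMap 0 ρ θ - w) =
      if ‖w‖ < ρ then 2 * (π : ℂ) else 0 := by
  have hper : Function.Periodic (fun θ => (circleMap 0 ρ θ) / (circleMap 0 ρ θ - w)) (2 * π) := by
    intro θ; simp only [(periodic_circleMap 0 ρ) θ]
  have h1 : ∫ θ in (-π)..π, (circleMap 0 ρ θ) / (circleMap 0 ρ θ - w) =
      ∫ θ in (0 : ℝ)..(2 * π), (circleMap 0 ρ θ) / (circleMap 0 ρ θ - w) := by
    have := hper.intervalIntegral_add_eq (-π) 0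
    rw [show -π + 2 * π = π by ring, zero_add] at this
    exact this
  have h2 : (∮ z in C(0, ρ), (z - w)⁻¹) =
      Complex.I * ∫ θ in (0 : ℝ)..(2 * π), (circleMap 0 ρ θ) / (circleMap 0 ρ θ - w) := by
    rw [circleIntegral, ← intervalIntegral.integral_const_mul]
    refine intervalIntegral.integral_congr fun θ _ => ?_
    simp only [deriv_circleMap, smul_eq_mul]
    ring
  rw [h1]
  split_ifs with h
  · rw [circleIntegral.integral_sub_inv_of_mem_ball (by simpa using h)] at h2
    apply mul_left_cancel₀ Complex.I_ne_zero
    rw [← h2]; ring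
  · have h3 : (∮ z in C(0, ρ), (z - w)⁻¹) = 0 := by
      refine DiffContOnCl.circleIntegral_eq_zero hρ.le ?_
      refine DifferentiableOn.diffContOnCl ?_
      intro z hz
      refine (DifferentiableAt.inv (by fun_prop) ?_).differentiableWithinAt
      rw [closure_ball _ hρ.ne', mem_closedBall_zero_iff] at hz
      intro h4
      rw [sub_eq_zero] at h4
      subst h4
      exact h (lt_of_le_of_ne hz hw)
    rw [h3] at h2
    simpa using h2.symm

/-- The area integral `∫_{|z| < r} z / (z - w)` equals `π (r² - |w|²)₊`. -/
theorem integral_ball_kernel {r : ℝ} (hr : 0 < r) (w : ℂ) :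
    IntegrableOn (fun z : ℂ => z / (z - w)) (Metric.ball 0 r) ∧
    ∫ z in Metric.ball (0 : ℂ) r, z / (z - w) = ((π * max 0 (r ^ 2 - ‖w‖ ^ 2) : ℝ) : ℂ) := by
  have hmeas : Measurable (fun z : ℂ => z / (z - w)) := by fun_prop
  have hInt : IntegrableOn (fun z : ℂ => z / (z - w)) (Metric.ball 0 r) := by
    refine ⟨hmeas.aestronglyMeasurable, ?_⟩
    rw [hasFiniteIntegral_iff_norm]
    calc ∫⁻ z in Metric.ball (0 : ℂ) r, ENNReal.ofReal ‖z / (z - w)‖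
        ≤ ∫⁻ z in Metric.ball (0 : ℂ) r, ENNReal.ofReal r * ENNReal.ofReal (‖z - w‖⁻¹) := by
          refine setLIntegral_mono' Metric.isOpen_ball.measurableSet fun z hz => ?_
          rw [norm_div, div_eq_mul_inv, ← ENNReal.ofReal_mul hr.le]
          rw [mem_ball_zero_iff] at hz
          gcongr
      _ = ENNReal.ofReal r * ∫⁻ z in Metric.ball (0 : ℂ) r, ENNReal.ofReal (‖z - w‖⁻¹) := by
          rw [lintegral_const_mul]; fun_prop
      _ < ⊤ := by
          refine ENNReal.mul_lt_top ENNReal.ofReal_lt_top ?_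
          refine (setLIntegral_inv_norm_le one_pos w _).trans_lt ?_
          refine ENNReal.add_lt_top.2 ⟨ENNReal.ofReal_lt_top,
            ENNReal.mul_lt_top ENNReal.ofReal_lt_top ?_⟩
          exact measure_ball_lt_top
  refine ⟨hInt, ?_⟩
  set g : ℂ → ℂ := (Metric.ball (0 : ℂ) r).indicator (fun z => z / (z - w)) with hg
  have hgm : Measurable g := hmeas.indicator Metric.isOpen_ball.measurableSet
  have hgint : Integrable g := (integrable_indicator_iff Metric.isOpen_ball.measurableSet).2 hInt
  rw [← integral_indicator Metric.isOpen_ball.measurableSet, ← hg,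
    ← Complex.integral_comp_polarCoord_symm]
  have hpint : IntegrableOn (fun p : ℝ × ℝ => p.1 • g (Complex.polarCoord.symm p))
      polarCoord.target := by
    refine ⟨?_, ?_⟩
    · refine Measurable.aestronglyMeasurable ?_
      refine measurable_fst.smul (hgm.comp ?_)
      exact Complex.measurableEquivRealProd.symm.measurable.comp
        continuous_polarCoord_symm.measurable
    · rw [hasFiniteIntegral_iff_norm]
      have h1 : ∫⁻ p in polarCoord.target,
          ENNReal.ofReal ‖p.1 • g (Complex.polarCoord.symm p)‖ =
          ∫⁻ p in polarCoord.target, ENNReal.ofReal p.1 •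
            (fun z => ENNReal.ofReal ‖g z‖) (Complex.polarCoord.symm p) := by
        refine setLIntegral_congr_fun polarCoord.open_target.measurableSet fun p hp => ?_
        rw [polarCoord_target] at hp
        have hp1 : 0 < p.1 := hp.1
        simp only [norm_smul, Real.norm_of_nonneg hp1.le, smul_eq_mul]
        rw [ENNReal.ofReal_mul hp1.le]
      rw [h1]
      refine (Complex.lintegral_comp_polarCoord_symm (fun z => ENNReal.ofReal ‖g z‖)).trans_lt ?_
      exact (hasFiniteIntegral_iff_norm _).1 hgint.2
  rw [polarCoord_target] at hpint ⊢
  rw [Measure.volume_eq_prod] at hpint ⊢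
  rw [setIntegral_prod _ hpint]
  have hstep : ∀ ρ ∈ Set.Ioi (0 : ℝ), ρ ≠ ‖w‖ →
      ∫ θ in Set.Ioo (-π) π, ρ • g (Complex.polarCoord.symm (ρ, θ)) =
        (Set.Ioo ‖w‖ r).indicator (fun ρ : ℝ => ((2 * π * ρ : ℝ) : ℂ)) ρ := by
    intro ρ hρ hρw
    have hρ0 : 0 < ρ := hρ
    have h0 : ∀ θ : ℝ, Complex.polarCoord.symm (ρ, θ) = circleMap 0 ρ θ := by
      intro θ
      rw [Complex.polarCoord_symm_apply, circleMap, Complex.exp_mul_I]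
      simp
    simp_rw [h0]
    by_cases hρr : ρ < r
    · have hgc : ∀ θ, g (circleMap 0 ρ θ) = circleMap 0 ρ θ / (circleMap 0 ρ θ - w) := by
        intro θ
        rw [hg, Set.indicator_of_mem]
        rw [mem_ball_zero_iff, norm_circleMap_zero, abs_of_pos hρ0]; exact hρr
      simp_rw [hgc]
      rw [integral_smul, ← integral_Ioc_eq_integral_Ioo,
        ← intervalIntegral.integral_of_le (by linarith [pi_pos]),
        circle_kernel_integral hρ0 hρw.symm]
      by_cases hwρ : ‖w‖ < ρ
      · rw [if_pos hwρ, Set.indicator_of_mem (show ρ ∈ Set.Ioo ‖w‖ r from ⟨hwρ, hρr⟩)]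
        rw [Complex.real_smul]; push_cast; ring
      · rw [if_neg hwρ, Set.indicator_of_notMem (fun h => hwρ h.1), smul_zero]
    · have hgc : ∀ θ, g (circleMap 0 ρ θ) = 0 := by
        intro θ
        rw [hg, Set.indicator_of_notMem]
        rw [mem_ball_zero_iff, norm_circleMap_zero, abs_of_pos hρ0]; exact hρr
      rw [Set.indicator_of_notMem (fun h => hρr h.2)]
      simp [hgc]
  have hae : ∀ᵐ ρ ∂(volume.restrict (Set.Ioi (0 : ℝ))),
      ∫ θ in Set.Ioo (-π) π, ρ • g (Complex.polarCoord.symm (ρ, θ)) =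
        (Set.Ioo ‖w‖ r).indicator (fun ρ : ℝ => ((2 * π * ρ : ℝ) : ℂ)) ρ := by
    rw [ae_restrict_iff' measurableSet_Ioi]
    have : ∀ᵐ ρ : ℝ, ρ ≠ ‖w‖ := by
      rw [ae_iff]; simp
    filter_upwards [this] with ρ h1 h2 using hstep ρ h2 h1
  rw [integral_congr_ae hae, setIntegral_indicator measurableSet_Ioo]
  have hset : Set.Ioi (0 : ℝ) ∩ Set.Ioo ‖w‖ r = Set.Ioo ‖w‖ r := by
    refine Set.inter_eq_right.2 fun ρ h => ?_
    exact (norm_nonneg w).trans_lt h.1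
  rw [hset, integral_complex_ofReal]
  congr 1
  rcases le_or_gt r ‖w‖ with h | h
  · rw [Set.Ioo_eq_empty (not_lt.2 h), setIntegral_empty, max_eq_left, mul_zero]
    nlinarith
  · rw [← integral_Ioc_eq_integral_Ioo, ← intervalIntegral.integral_of_le h.le,
      intervalIntegral.integral_const_mul, integral_id, max_eq_right]
    · ring
    · nlinarith [norm_nonneg w]

end

section

open MeasureTheory Real

theorem Submodule.mem_of_forall_dual_eq_zero {F : Type*} [NormedAddCommGroup F] [NormedSpace ℂ F]
    (S : Submodule ℂ F) (hS : IsClosed (S : Set F)) {x : F}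
    (h : ∀ L : F →L[ℂ] ℂ, (∀ y ∈ S, L y = 0) → L x = 0) : x ∈ S := by
  have : IsClosed (S : Set F) := hS
  by_contra hx
  have h0 : ‖S.mkQL x‖ ≠ 0 := by
    rw [norm_ne_zero_iff]
    simpa [Submodule.mkQL_apply] using hx
  obtain ⟨g, -, hg⟩ := exists_dual_vector ℂ (S.mkQL x) h0
  have := h (g.comp S.mkQL) (fun y hy => by
    have : S.mkQL y = 0 := by simpa [Submodule.mkQL_apply] using hy
    simp [this])
  rw [ContinuousLinearMap.comp_apply, hg] at this
  exact h0 (by simpa using this)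

theorem Submodule.integral_mem_of_isClosed {F α : Type*} [NormedAddCommGroup F] [NormedSpace ℂ F]
    [CompleteSpace F] [MeasurableSpace α] {μ : Measure α}
    (S : Submodule ℂ F) (hS : IsClosed (S : Set F)) {G : α → F} (hG : ∀ᵐ a ∂μ, G a ∈ S) :
    ∫ a, G a ∂μ ∈ S := by
  by_cases hi : Integrable G μ
  · refine S.mem_of_forall_dual_eq_zero hS fun L hL => ?_
    rw [← L.integral_comp_comm hi, integral_eq_zero_of_ae]
    filter_upwards [hG] with a ha using hL _ ha
  · rw [integral_undef hi]; exact S.zero_mem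

section FunAlg
variable {X : Type*} [TopologicalSpace X] [CompactSpace X] {B : Subalgebra ℂ C(X, ℂ)}
  {f : C(X, ℂ)}

/-- The bump function `(r² - |f|²)₊`. -/
def bumpComp (f : C(X, ℂ)) (r : ℝ) : C(X, ℂ) :=
  ⟨fun x => ((max 0 (r ^ 2 - ‖f x‖ ^ 2) : ℝ) : ℂ), by fun_prop⟩

/-- A localized form of the Hartogs--Rosenthal theorem. -/
theorem bumpComp_mem (hB : IsClosed (B : Set C(X, ℂ))) {r : ℝ} (hr : 0 < r)
    (hnull : volume (Set.range f ∩ Metric.closedBall 0 r) = 0)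
    (hres : ∀ l ∈ Metric.closedBall (0 : ℂ) r, (∀ x, f x ≠ l) → l ∈ funResolvent B f) :
    bumpComp f r ∈ B := by
  rw [← SetLike.mem_coe, ← hB.closure_eq, Metric.mem_closure_iff]
  intro ε hε
  obtain ⟨η, hη, hη2⟩ : ∃ η : ℝ, 0 < η ∧ r / π * (2 * π * η) = ε / 4 :=
    ⟨ε / (8 * r), by positivity, by field_simp; norm_num⟩
  obtain ⟨δ, hδ, hδ2⟩ : ∃ δ : ℝ, 0 < δ ∧ r / π * (η⁻¹ * δ) = ε / 4 :=
    ⟨ε * π * η / (4 * r), by positivity, by field_simp⟩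
  obtain ⟨U, hUsub, hUo, hUv⟩ := Set.exists_isOpen_lt_of_lt
    (Set.range f ∩ Metric.closedBall 0 r) (ENNReal.ofReal δ) (by rw [hnull]; simpa using hδ)
  set N : Set ℂ := Metric.closedBall 0 r \ U with hN
  have hNc : IsCompact N := (isCompact_closedBall 0 r).diff hUo
  have hNf : ∀ l ∈ N, ∀ x, f x ≠ l := by
    rintro l ⟨hl, hlU⟩ x rfl
    exact hlU (hUsub ⟨⟨x, rfl⟩, hl⟩)
  let G : ℂ → C(X, ℂ) := fun l => l • Ring.inverse (algebraMap ℂ C(X, ℂ) l - f)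
  have hunit : ∀ l ∈ N, IsUnit (algebraMap ℂ C(X, ℂ) l - f) := by
    intro l hl
    rw [ContinuousMap.isUnit_iff_forall_ne_zero]
    intro x hx
    have : l - f x = 0 := by simpa [Algebra.algebraMap_eq_smul_one] using hx
    exact hNf l hl x (sub_eq_zero.1 this).symm
  have hGval : ∀ l ∈ N, ∀ x, G l x = l / (l - f x) := by
    intro l hl x
    have h1 := congrArg (fun c : C(X, ℂ) => c x) (Ring.mul_inverse_cancel _ (hunit l hl))
    simp only [ContinuousMap.mul_apply, ContinuousMap.sub_apply, ContinuousMap.one_apply] at h1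
    have h2 : (algebraMap ℂ C(X, ℂ) l) x = l := by simp [Algebra.algebraMap_eq_smul_one]
    rw [h2] at h1
    have h3 : l - f x ≠ 0 := left_ne_zero_of_mul_eq_one h1
    change l * _ = _
    rw [eq_div_iff h3, mul_assoc, mul_comm _ (l - f x), h1, mul_one]
  have hGcont : ContinuousOn G N := by
    intro l hl
    refine ContinuousAt.continuousWithinAt ?_
    obtain ⟨u, hu⟩ := hunit l hl
    refine continuousAt_id.smul ?_
    refine ContinuousAt.comp (g := Ring.inverse) (f := fun l => algebraMap ℂ C(X, ℂ) l - f) ?_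
      (by fun_prop)
    rw [← hu]
    exact NormedRing.inverse_continuousAt u
  have hGmem : ∀ l ∈ N, G l ∈ B := by
    intro l hl
    obtain ⟨g, hg, hg2⟩ := hres l hl.1 (hNf l hl)
    have : G l = -(l • g) := by
      ext x
      rw [hGval l hl x]
      have h3 : l - f x ≠ 0 := sub_ne_zero.2 (hNf l hl x).symm
      rw [div_eq_iff h3]
      change l = -(l * g x) * (l - f x)
      linear_combination (-l) * hg2 x
    rw [this]
    exact B.neg_mem (B.smul_mem hg _)
  have hGint : IntegrableOn G N := hGcont.integrableOn_compact hNc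
  set I : C(X, ℂ) := ∫ l in N, G l with hI
  have hImem : I ∈ B := by
    refine Submodule.integral_mem_of_isClosed (Subalgebra.toSubmodule B) hB ?_
    rw [ae_restrict_iff' hNc.measurableSet]
    exact Filter.Eventually.of_forall hGmem
  refine ⟨((π⁻¹ : ℝ) : ℂ) • I, B.smul_mem hImem _, ?_⟩
  rw [dist_eq_norm]
  refine lt_of_le_of_lt ((ContinuousMap.norm_le _ (C := ε / 2) (by positivity)).2 fun x => ?_)
    (by linarith)
  have hIx : I x = ∫ l in N, l / (l - f x) := by
    have := (ContinuousMap.evalCLM ℂ x).integral_comp_comm hGint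
    change I x = _
    rw [hI, ← ContinuousMap.evalCLM_apply (R := ℂ) x, ← this]
    exact setIntegral_congr_fun hNc.measurableSet fun l hl => hGval l hl x
  obtain ⟨hk, hk2⟩ := integral_ball_kernel hr (f x)
  have hae : (Metric.ball (0 : ℂ) r : Set ℂ) =ᵐ[volume] Metric.closedBall 0 r := by
    refine (ae_eq_of_subset_of_measure_ge Metric.ball_subset_closedBall ?_
      Metric.isOpen_ball.measurableSet.nullMeasurableSet ?_)
    · rw [Measure.addHaar_closedBall_eq_addHaar_ball]
    · exact measure_closedBall_lt_top.ne
  have hk' : IntegrableOn (fun z : ℂ => z / (z - f x)) (Metric.closedBall 0 r) :=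
    hk.congr_set_ae hae.symm
  rw [setIntegral_congr_set hae] at hk2
  have hsplit : ∫ z in Metric.closedBall (0 : ℂ) r, z / (z - f x) =
      (∫ z in N, z / (z - f x)) + ∫ z in Metric.closedBall (0 : ℂ) r ∩ U, z / (z - f x) := by
    rw [add_comm, hN, integral_inter_add_sdiff hUo.measurableSet hk']
  have hdiff : (bumpComp f r - ((π⁻¹ : ℝ) : ℂ) • I) x =
      ((π⁻¹ : ℝ) : ℂ) * ∫ z in Metric.closedBall (0 : ℂ) r ∩ U, z / (z - f x) := by
    change ((max 0 (r ^ 2 - ‖f x‖ ^ 2) : ℝ) : ℂ) - ((π⁻¹ : ℝ) : ℂ) * I x = _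
    rw [hIx, ← sub_eq_iff_eq_add'.2 hsplit, hk2]
    have hpi : (π : ℂ) ≠ 0 := by exact_mod_cast pi_ne_zero
    push_cast
    field_simp
  rw [hdiff, norm_mul, Complex.norm_real, Real.norm_of_nonneg (by positivity)]
  have hest : ‖∫ z in Metric.closedBall (0 : ℂ) r ∩ U, z / (z - f x)‖ ≤
      r * (2 * π * η + η⁻¹ * δ) := by
    refine (norm_integral_le_lintegral_norm _).trans ?_
    refine ENNReal.toReal_le_of_le_ofReal (by positivity) ?_
    have hm : MeasurableSet (Metric.closedBall (0 : ℂ) r ∩ U) :=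
      Metric.isClosed_closedBall.measurableSet.inter hUo.measurableSet
    calc ∫⁻ z in Metric.closedBall (0 : ℂ) r ∩ U, ENNReal.ofReal ‖z / (z - f x)‖
        ≤ ∫⁻ z in Metric.closedBall (0 : ℂ) r ∩ U,
            ENNReal.ofReal r * ENNReal.ofReal ‖z - f x‖⁻¹ := by
          refine setLIntegral_mono' hm fun z hz => ?_
          rw [← ENNReal.ofReal_mul hr.le, norm_div, div_eq_mul_inv]
          have : ‖z‖ ≤ r := by simpa using hz.1
          gcongr
      _ = ENNReal.ofReal r * ∫⁻ z in Metric.closedBall (0 : ℂ) r ∩ U,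
            ENNReal.ofReal ‖z - f x‖⁻¹ := by
          rw [lintegral_const_mul' _ _ ENNReal.ofReal_ne_top]
      _ ≤ ENNReal.ofReal r * (ENNReal.ofReal (2 * π * η) +
            ENNReal.ofReal η⁻¹ * ENNReal.ofReal δ) := by
          gcongr
          refine (setLIntegral_inv_norm_le hη _ _).trans ?_
          gcongr
          exact (measure_mono Set.inter_subset_right).trans hUv.le
      _ = ENNReal.ofReal (r * (2 * π * η + η⁻¹ * δ)) := by
          rw [← ENNReal.ofReal_mul (by positivity), ← ENNReal.ofReal_add (by positivity)
            (by positivity), ← ENNReal.ofReal_mul hr.le]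
  calc π⁻¹ * ‖∫ z in Metric.closedBall (0 : ℂ) r ∩ U, z / (z - f x)‖
      ≤ π⁻¹ * (r * (2 * π * η + η⁻¹ * δ)) := by gcongr
    _ = r / π * (2 * π * η) + r / π * (η⁻¹ * δ) := by ring
    _ = ε / 2 := by rw [hη2, hδ2]; ring

end FunAlg

end

section

open MeasureTheory Real

section FunAlg
variable {X : Type*} [TopologicalSpace X] [CompactSpace X] {B : Subalgebra ℂ C(X, ℂ)}
  {f : C(X, ℂ)}

/-- A form of the Hartogs--Rosenthal theorem. -/
theorem star_mem_of_volume_range_eq_zero (hB : IsClosed (B : Set C(X, ℂ))) (hf : f ∈ B)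
    (hnull : volume (Set.range f) = 0)
    (hres : ∀ l, (∀ x, f x ≠ l) → l ∈ funResolvent B f) : star f ∈ B := by
  set r : ℝ := ‖f‖ + 2 with hr
  have hr0 : 0 < r := by positivity
  have h1 : bumpComp f r ∈ B :=
    bumpComp_mem hB hr0 (measure_mono_null Set.inter_subset_left hnull) fun l _ hl => hres l hl
  have h2 : bumpComp (f - 1) r ∈ B := by
    refine bumpComp_mem hB hr0 (measure_mono_null Set.inter_subset_left ?_) fun l _ hl => ?_
    · have : Set.range (f - 1 : C(X, ℂ)) = (fun z : ℂ => z + -1) '' Set.range f := by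
        rw [← Set.range_comp]
        congr 1
      rw [this, Set.image_add_right, measure_preimage_add_right, hnull]
    · obtain ⟨g, hg, hg2⟩ := hres (l + 1) fun x hx => hl x (by simp [hx])
      refine ⟨g, hg, fun x => ?_⟩
      rw [← hg2 x]
      simp only [ContinuousMap.sub_apply, ContinuousMap.one_apply]
      ring
  have : star f = bumpComp (f - 1) r - bumpComp f r + 1 - f := by
    ext x
    have hx : ‖f x‖ ≤ ‖f‖ := f.norm_coe_le_norm x
    have hx2 : ‖f x - 1‖ ≤ ‖f‖ + 1 := (norm_sub_le _ _).trans (by simpa using hx)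
    have e1 : max 0 (r ^ 2 - ‖f x‖ ^ 2) = r ^ 2 - ‖f x‖ ^ 2 :=
      max_eq_right (by nlinarith [norm_nonneg (f x)])
    have e2 : max 0 (r ^ 2 - ‖f x - 1‖ ^ 2) = r ^ 2 - ‖f x - 1‖ ^ 2 :=
      max_eq_right (by nlinarith [norm_nonneg (f x - 1), norm_nonneg f])
    change star (f x) = ((max 0 (r ^ 2 - ‖f x - 1‖ ^ 2) : ℝ) : ℂ) -
      ((max 0 (r ^ 2 - ‖f x‖ ^ 2) : ℝ) : ℂ) + 1 - f x
    rw [e1, e2, ← Complex.normSq_eq_norm_sq, ← Complex.normSq_eq_norm_sq]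
    push_cast
    rw [Complex.normSq_eq_conj_mul_self, Complex.normSq_eq_conj_mul_self]
    simp only [map_sub, map_one, RCLike.star_def]
    ring
  rw [this]
  exact B.sub_mem (B.add_mem (B.sub_mem h2 h1) B.one_mem) hf

theorem Subalgebra.eq_top_of_separates (hB : IsClosed (B : Set C(X, ℂ))) (F : Set C(X, ℂ))
    (hF : ∀ f ∈ F, f ∈ B) (hF' : ∀ f ∈ F, star f ∈ B)
    (hsep : ∀ x y, x ≠ y → ∃ f ∈ F, f x ≠ f y) : B = ⊤ := by
  have hle : (StarAlgebra.adjoin ℂ F).toSubalgebra ≤ B := by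
    rw [StarAlgebra.adjoin_toSubalgebra, Algebra.adjoin_le_iff]
    rintro g (hg | hg)
    · exact hF g hg
    · simpa using hF' _ hg
  have htop := ContinuousMap.starSubalgebra_topologicalClosure_eq_top_of_separatesPoints
    (StarAlgebra.adjoin ℂ F) (by
      intro x y hxy
      obtain ⟨f, hf, hne⟩ := hsep x y hxy
      exact ⟨f, ⟨f, StarAlgebra.subset_adjoin ℂ F hf, rfl⟩, hne⟩)
  rw [eq_top_iff]
  intro g _
  have hg : g ∈ (StarAlgebra.adjoin ℂ F).topologicalClosure := by rw [htop]; trivial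
  rw [← SetLike.mem_coe, StarSubalgebra.topologicalClosure_coe] at hg
  rw [← SetLike.mem_coe, ← hB.closure_eq]
  exact closure_mono hle hg

theorem comp_mem_of_star_mem (hB : IsClosed (B : Set C(X, ℂ))) (hf : f ∈ B) (hf' : star f ∈ B)
    (g : C(Set.range f, ℂ)) : g.comp ⟨Set.rangeFactorization f, by fun_prop⟩ ∈ B := by
  have : CompactSpace (Set.range f) := isCompact_iff_compactSpace.1 (isCompact_range f.continuous)
  let p : C(X, Set.range f) := ⟨Set.rangeFactorization f, by fun_prop⟩
  let B' : Subalgebra ℂ C(Set.range f, ℂ) := B.comap (ContinuousMap.compRightAlgHom ℂ ℂ p)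
  have hB' : IsClosed (B' : Set C(Set.range f, ℂ)) :=
    hB.preimage (ContinuousMap.continuous_precomp p)
  have htop : B' = ⊤ := by
    let i : C(Set.range f, ℂ) := ⟨Subtype.val, continuous_subtype_val⟩
    have h1 : ContinuousMap.compRightAlgHom ℂ ℂ p i = f := by ext x; rfl
    have h2 : ContinuousMap.compRightAlgHom ℂ ℂ p (star i) = star f := by ext x; rfl
    refine Subalgebra.eq_top_of_separates hB' {i} ?_ ?_ ?_
    · rintro _ rfl
      change ContinuousMap.compRightAlgHom ℂ ℂ p i ∈ B
      rwa [h1]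
    · rintro _ rfl
      change ContinuousMap.compRightAlgHom ℂ ℂ p (star i) ∈ B
      rwa [h2]
    · intro x y hxy
      exact ⟨i, rfl, fun h => hxy (Subtype.ext h)⟩
  have hg : g ∈ B' := by rw [htop]; trivial
  exact hg

/-- A closed algebra containing a real-and-imaginary-part-closed function and dense on the level
sets of that function is everything. -/
theorem Subalgebra.eq_top_of_dense_on_fibers (hB : IsClosed (B : Set C(X, ℂ))) (hf : f ∈ B)
    (hf' : star f ∈ B)
    (hd : ∀ (s : ℂ) (φ : C(X, ℂ)) (ε : ℝ), 0 < ε → ∃ a ∈ B, ∀ x, f x = s → ‖a x - φ x‖ < ε) :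
    B = ⊤ := by
  rw [eq_top_iff]
  intro φ _
  rw [← SetLike.mem_coe, ← hB.closure_eq, Metric.mem_closure_iff]
  intro ε hε
  choose a ha hae using fun s => hd s φ (ε / 2) (half_pos hε)
  have : CompactSpace (Set.range f) := isCompact_iff_compactSpace.1 (isCompact_range f.continuous)
  let p : C(X, Set.range f) := ⟨Set.rangeFactorization f, by fun_prop⟩
  let V : ℂ → Set (Set.range f) := fun s => (p '' {x | ε / 2 ≤ ‖a s x - φ x‖})ᶜ
  have hVo : ∀ s, IsOpen (V s) := fun s => by
    refine IsClosed.isOpen_compl (self := ?_)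
    exact ((isClosed_le continuous_const (by fun_prop)).isCompact.image p.continuous).isClosed
  have hVc : (Set.univ : Set (Set.range f)) ⊆ ⋃ s, V s := by
    rintro ⟨s, hs⟩ -
    refine Set.mem_iUnion.2 ⟨s, ?_⟩
    rintro ⟨x, hx, hxs⟩
    exact absurd (hae s x (congrArg Subtype.val hxs)) (not_lt.2 hx)
  obtain ⟨t, ht⟩ := isCompact_univ.elim_finite_subcover V hVo hVc
  obtain ⟨ρ, hρ⟩ := PartitionOfUnity.exists_isSubordinate (isClosed_univ)
    (fun s : t => V s) (fun s => hVo s) (by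
      intro y hy
      have := ht hy
      simp only [Set.mem_iUnion] at this ⊢
      obtain ⟨s, hs, hys⟩ := this
      exact ⟨⟨s, hs⟩, hys⟩)
  let σ : t → C(Set.range f, ℂ) := fun s => ⟨fun y => ((ρ s y : ℝ) : ℂ), by fun_prop⟩
  refine ⟨∑ s : t, (σ s).comp p * a s, B.sum_mem fun s _ =>
    B.mul_mem (comp_mem_of_star_mem hB hf hf' _) (ha s), ?_⟩
  rw [dist_eq_norm]
  refine lt_of_le_of_lt ((ContinuousMap.norm_le _ (C := ε / 2) (by positivity)).2 fun x => ?_)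
    (by linarith)
  have hsum : ∑ s : t, ρ s (p x) = 1 := by
    rw [← finsum_eq_sum_of_fintype]
    exact ρ.sum_eq_one (Set.mem_univ _)
  have : (φ - ∑ s : t, (σ s).comp p * a s) x = ∑ s : t, ((ρ s (p x) : ℝ) : ℂ) * (φ x - a s x) := by
    simp only [mul_sub, Finset.sum_sub_distrib, ← Finset.sum_mul, ContinuousMap.sub_apply,
      ContinuousMap.sum_apply, ContinuousMap.mul_apply]
    rw [← Complex.ofReal_sum, hsum]
    simp [σ]
  rw [this]
  calc ‖∑ s : t, ((ρ s (p x) : ℝ) : ℂ) * (φ x - a s x)‖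
      ≤ ∑ s : t, ρ s (p x) * (ε / 2) := by
        refine norm_sum_le_of_le _ fun s _ => ?_
        rw [norm_mul, Complex.norm_real, Real.norm_of_nonneg (ρ.nonneg s _)]
        by_cases h0 : ρ s (p x) = 0
        · simp [h0]
        · refine mul_le_mul_of_nonneg_left ?_ (ρ.nonneg s _)
          have hm : p x ∈ V s := hρ s (subset_closure h0)
          by_contra hlt
          refine hm ⟨x, ?_, rfl⟩
          change ε / 2 ≤ _
          rw [norm_sub_rev]
          exact (not_le.1 hlt).le
    _ = ε / 2 := by rw [← Finset.sum_mul, hsum, one_mul]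

/-- Holomorphic functional calculus on a disc. -/
theorem exists_mem_comp_of_differentiableOn (hB : IsClosed (B : Set C(X, ℂ))) (hf : f ∈ B)
    {p : ℂ} {r R : ℝ} (hr : 0 ≤ r) (hrR : r < R) (hfr : ∀ x, ‖f x - p‖ ≤ r) {g : ℂ → ℂ}
    (hg : DifferentiableOn ℂ g (Metric.ball p R)) : ∃ b ∈ B, ∀ x, b x = g (f x) := by
  have hmem : ∀ x, f x ∈ Metric.ball p R := fun x => by
    rw [mem_ball_iff_norm]; exact (hfr x).trans_lt hrR
  let b : C(X, ℂ) := ⟨fun x => g (f x), hg.continuousOn.comp_continuous f.continuous hmem⟩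
  refine ⟨b, ?_, fun x => rfl⟩
  obtain ⟨r2, hr2, hr2R⟩ := exists_between hrR
  obtain ⟨r1, hr1, hr12⟩ := exists_between hr2
  have h0 : 0 < r2 := hr.trans_lt hr2
  lift r2 to NNReal using h0.le
  lift r1 to NNReal using hr.trans hr1.le
  have hps := (hg.mono (Metric.closedBall_subset_ball hr2R)).hasFPowerSeriesOnBall
    (by exact_mod_cast h0)
  have hu := hps.tendstoUniformlyOn' (r' := r1) (by exact_mod_cast hr12)
  rw [← SetLike.mem_coe, ← hB.closure_eq, Metric.mem_closure_iff]
  intro ε hε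
  obtain ⟨n, hn⟩ := (Metric.tendstoUniformlyOn_iff.1 hu (ε / 2) (half_pos hε)).exists
  set P := cauchyPowerSeries g p r2
  refine ⟨∑ k ∈ Finset.range n, P.coeff k • (f - algebraMap ℂ C(X, ℂ) p) ^ k,
    B.sum_mem fun k _ => B.smul_mem (B.pow_mem (B.sub_mem hf (B.algebraMap_mem p)) k) _, ?_⟩
  rw [dist_eq_norm]
  refine lt_of_le_of_lt ((ContinuousMap.norm_le _ (C := ε / 2) (by positivity)).2 fun x => ?_)
    (by linarith)
  have := hn (f x) (by rw [mem_ball_iff_norm]; exact (hfr x).trans_lt hr1)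
  rw [dist_eq_norm] at this
  refine le_trans (le_of_eq ?_) this.le
  congr 1
  simp only [ContinuousMap.sub_apply, FormalMultilinearSeries.partialSum,
    ContinuousMap.sum_apply]
  congr 1
  refine Finset.sum_congr rfl fun k _ => ?_
  simp [Algebra.algebraMap_eq_smul_one, mul_comm]

end FunAlg

end

section

open MeasureTheory Real

theorem exists_character_of_isProper {X : Type*} [TopologicalSpace X] [CompactSpace X]
    {B : Subalgebra ℂ C(X, ℂ)} (hB : IsClosed (B : Set C(X, ℂ))) (I : Ideal B) (hI : I ≠ ⊤) :
    ∃ χ : B →ₐ[ℂ] ℂ, ∀ a ∈ I, χ a = 0 := by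
  have : CompleteSpace B := hB.completeSpace_coe
  obtain ⟨M, hM, hIM⟩ := Ideal.exists_le_maximal I hI
  exact ⟨WeakDual.CharacterSpace.toAlgHom M.toCharacterSpace,
    fun a ha => M.toCharacterSpace_apply_eq_zero_of_mem (hIM ha)⟩

section Hull
variable {n : ℕ} {E : Set (Fin n → ℂ)}

/-- The polynomial hull of a compact set, expressed without suprema. -/
def hullOf (E : Set (Fin n → ℂ)) : Set (Fin n → ℂ) :=
  {x | ∀ p : MvPolynomial (Fin n) ℂ, ∃ z ∈ E,
    ‖MvPolynomial.eval x p‖ ≤ ‖MvPolynomial.eval z p‖}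

theorem subset_hullOf : E ⊆ hullOf E := fun x hx _ => ⟨x, hx, le_rfl⟩

theorem hullOf_mono {E' : Set (Fin n → ℂ)} (h : E ⊆ E') : hullOf E ⊆ hullOf E' := fun _ hx p =>
  let ⟨z, hz, hz2⟩ := hx p
  ⟨z, h hz, hz2⟩

theorem continuous_eval_norm (p : MvPolynomial (Fin n) ℂ) :
    Continuous fun z : Fin n → ℂ => ‖MvPolynomial.eval z p‖ :=
  (MvPolynomial.continuous_eval p).norm

theorem isClosed_hullOf (hE : IsCompact E) : IsClosed (hullOf E) := by
  rcases E.eq_empty_or_nonempty with rfl | hne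
  · have : hullOf (∅ : Set (Fin n → ℂ)) = ∅ := by
      ext x; simp [hullOf]
    rw [this]; exact isClosed_empty
  · simp only [hullOf, Set.ofPred_forall]
    refine isClosed_iInter fun p => ?_
    obtain ⟨z, hz, hmax⟩ := hE.exists_isMaxOn hne (continuous_eval_norm p).continuousOn
    have : {x | ∃ z ∈ E, ‖MvPolynomial.eval x p‖ ≤ ‖MvPolynomial.eval z p‖} =
        {x | ‖MvPolynomial.eval x p‖ ≤ ‖MvPolynomial.eval z p‖} := by
      ext x
      exact ⟨fun ⟨w, hw, h⟩ => h.trans (hmax hw), fun h => ⟨z, hz, h⟩⟩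
    rw [this]
    exact isClosed_le (continuous_eval_norm p) continuous_const

theorem isCompact_hullOf (hE : IsCompact E) : IsCompact (hullOf E) := by
  obtain ⟨R, hR⟩ := hE.isBounded.exists_norm_le
  refine (isCompact_closedBall (0 : Fin n → ℂ) (max R 0)).of_isClosed_subset
    (isClosed_hullOf hE) fun x hx => ?_
  rw [mem_closedBall_zero_iff, pi_norm_le_iff_of_nonneg (le_max_right _ _)]
  intro i
  obtain ⟨z, hz, h⟩ := hx (MvPolynomial.X i)
  simp only [MvPolynomial.eval_X] at h
  exact h.trans ((norm_le_pi_norm z i).trans ((hR z hz).trans (le_max_left _ _)))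

theorem polyHull_eq_hullOf (hE : IsCompact E) : polyHull n E = hullOf E := by
  ext x
  rcases E.eq_empty_or_nonempty with rfl | hne
  · constructor
    · intro h
      have := h 1
      norm_num at this
    · intro h
      obtain ⟨z, hz, -⟩ := h 1
      exact hz.elim
  refine forall_congr' fun p => ?_
  constructor
  · intro h
    obtain ⟨z, hz, hmax⟩ := hE.exists_isMaxOn hne (continuous_eval_norm p).continuousOn
    refine ⟨z, hz, h.trans (csSup_le (hne.image _) ?_)⟩
    rintro _ ⟨w, hw, rfl⟩
    exact hmax hw
  · rintro ⟨z, hz, h⟩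
    exact h.trans (le_csSup (hE.image (continuous_eval_norm p)).bddAbove ⟨z, hz, rfl⟩)

/-- Restriction of polynomials to a set. -/
def polyOn (E : Set (Fin n → ℂ)) : MvPolynomial (Fin n) ℂ →ₐ[ℂ] C(E, ℂ) :=
  MvPolynomial.aeval fun i => ⟨fun z => z.1 i, (continuous_apply i).comp continuous_subtype_val⟩

@[simp] theorem polyOn_apply (p : MvPolynomial (Fin n) ℂ) (z : E) :
    polyOn E p z = MvPolynomial.eval z.1 p := by
  induction p using MvPolynomial.induction_on with
  | C a => simp [polyOn, Algebra.algebraMap_eq_smul_one]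
  | add p q hp hq => simp [hp, hq]
  | mul_X p i hp => rw [map_mul, ContinuousMap.mul_apply, hp]; simp [polyOn]

section
variable [CompactSpace E]

/-- The uniform closure of the polynomials in `C(E, ℂ)`. -/
def polyAlg (E : Set (Fin n → ℂ)) [CompactSpace E] : Subalgebra ℂ C(E, ℂ) := (polyOn E).range.topologicalClosure

theorem isClosed_polyAlg : IsClosed (polyAlg E : Set C(E, ℂ)) :=
  Subalgebra.isClosed_topologicalClosure _

theorem polyOn_mem (p : MvPolynomial (Fin n) ℂ) : polyOn E p ∈ polyAlg E :=
  Subalgebra.le_topologicalClosure _ ⟨p, rfl⟩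

theorem exists_poly_of_mem {g : C(E, ℂ)} (hg : g ∈ polyAlg E) {ε : ℝ}
    (hε : 0 < ε) : ∃ p, ‖g - polyOn E p‖ < ε := by
  rw [← SetLike.mem_coe, polyAlg, Subalgebra.topologicalClosure_coe, Metric.mem_closure_iff] at hg
  obtain ⟨_, ⟨p, rfl⟩, h⟩ := hg ε hε
  exact ⟨p, by rwa [dist_eq_norm] at h⟩

theorem mem_polyAlg_of_forall_exists {g : C(E, ℂ)}
    (hg : ∀ ε > 0, ∃ p : MvPolynomial (Fin n) ℂ, ∀ z : E, ‖g z - MvPolynomial.eval z.1 p‖ ≤ ε) :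
    g ∈ polyAlg E := by
  rw [← SetLike.mem_coe, polyAlg, Subalgebra.topologicalClosure_coe, Metric.mem_closure_iff]
  intro ε hε
  obtain ⟨p, hp⟩ := hg (ε / 2) (half_pos hε)
  refine ⟨_, ⟨p, rfl⟩, ?_⟩
  rw [dist_eq_norm]
  refine lt_of_le_of_lt ((ContinuousMap.norm_le _ (C := ε / 2) (by positivity)).2 fun x => ?_)
    (by linarith)
  simpa using hp x

theorem polyAlg_le {B : Subalgebra ℂ C(E, ℂ)} (hB : IsClosed (B : Set C(E, ℂ)))
    (h : ∀ i, polyOn E (MvPolynomial.X i) ∈ B) : polyAlg E ≤ B := by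
  refine Subalgebra.topologicalClosure_minimal ?_ hB
  rintro _ ⟨p, rfl⟩
  change polyOn E p ∈ B
  induction p using MvPolynomial.induction_on with
  | C a => rw [← MvPolynomial.algebraMap_eq, AlgHom.commutes]; exact B.algebraMap_mem a
  | add p q hp hq => rw [map_add]; exact B.add_mem hp hq
  | mul_X p i hp => rw [map_mul]; exact B.mul_mem hp (h i)

/-- The point of `ℂⁿ` underlying a character of the polynomial algebra. -/
def charPoint (χ : polyAlg E →ₐ[ℂ] ℂ) : Fin n → ℂ :=
  fun i => χ ⟨polyOn E (MvPolynomial.X i), polyOn_mem _⟩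

theorem character_polyOn (χ : polyAlg E →ₐ[ℂ] ℂ) (p : MvPolynomial (Fin n) ℂ) :
    χ ⟨polyOn E p, polyOn_mem p⟩ = MvPolynomial.eval (charPoint χ) p := by
  have : (χ.comp ((Subalgebra.inclusion (Subalgebra.le_topologicalClosure _)).comp
      (polyOn E).rangeRestrict)) = MvPolynomial.aeval (charPoint χ) := by
    ext i
    simp only [MvPolynomial.aeval_X]
    rfl
  have h := DFunLike.congr_fun this p
  rw [MvPolynomial.aeval_eq_eval] at h
  exact h

theorem mem_hullOf_of_peak (χ : polyAlg E →ₐ[ℂ] ℂ) {v : polyAlg E}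
    (hv : ∀ x, ‖v.1 x‖ ≤ 1) (hχ : ‖χ v‖ = 1) :
    charPoint χ ∈ hullOf (Subtype.val '' {z : E | ‖v.1 z‖ = 1}) := by
  have hcl : IsCompact {z : E | ‖v.1 z‖ = 1} :=
    (isClosed_eq (by fun_prop) continuous_const).isCompact
  have key : ∀ (p : MvPolynomial (Fin n) ℂ) (s : ℝ), 0 < s →
      (∀ z ∈ Subtype.val '' {z : E | ‖v.1 z‖ = 1}, ‖MvPolynomial.eval z p‖ < s) →
      ‖MvPolynomial.eval (charPoint χ) p‖ ≤ s := by
    intro p s hs hlt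
    rw [← character_polyOn]
    refine norm_character_le_of_peak isClosed_polyAlg χ hv hχ _ (fun x hx => ?_) hs
    rw [polyOn_apply]
    exact hlt x.1 ⟨x, hx, rfl⟩
  have hne : (Subtype.val '' {z : E | ‖v.1 z‖ = 1}).Nonempty := by
    by_contra hemp
    rw [Set.not_nonempty_iff_eq_empty] at hemp
    have := key 1 (1 / 2) (by norm_num) (by rw [hemp]; simp)
    norm_num at this
  intro p
  obtain ⟨z, hz, hmax⟩ := (hcl.image continuous_subtype_val).exists_isMaxOn hne
    (continuous_eval_norm p).continuousOn
  refine ⟨z, hz, le_of_forall_pos_lt_add fun ε hε => ?_⟩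
  refine (key p (‖MvPolynomial.eval z p‖ + ε / 2) (by positivity) fun w hw => ?_).trans_lt
    (by linarith)
  have : ‖MvPolynomial.eval w p‖ ≤ ‖MvPolynomial.eval z p‖ := hmax hw
  linarith

theorem charPoint_mem_hullOf (χ : polyAlg E →ₐ[ℂ] ℂ) :
    charPoint χ ∈ hullOf E := by
  refine hullOf_mono ?_ (mem_hullOf_of_peak χ (v := 1) (fun x => ?_) ?_)
  · rintro _ ⟨z, -, rfl⟩; exact z.2
  · simp
  · simp

theorem exists_character_of_mem_hullOf {x : Fin n → ℂ} (hx : x ∈ hullOf E) :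
    ∃ χ : polyAlg E →ₐ[ℂ] ℂ, charPoint χ = x := by
  let g : Fin n → polyAlg E := fun i =>
    ⟨polyOn E (MvPolynomial.X i - MvPolynomial.C (x i)), polyOn_mem _⟩
  have hI : Ideal.span (Set.range g) ≠ ⊤ := by
    intro htop
    have h1 : (1 : polyAlg E) ∈ Ideal.span (Set.range g) := by rw [htop]; trivial
    obtain ⟨c, hc⟩ := Ideal.mem_span_range_iff_exists_fun.1 h1
    set M : ℝ := ∑ i, ‖g i‖ + 1 with hM
    have hM0 : 0 < M := by positivity
    choose q hq using fun i => exists_poly_of_mem (c i).2 (inv_pos.2 hM0)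
    let P : MvPolynomial (Fin n) ℂ :=
      1 - ∑ i, q i * (MvPolynomial.X i - MvPolynomial.C (x i))
    obtain ⟨z, hz, hle⟩ := hx P
    have hPx : MvPolynomial.eval x P = 1 := by simp [P]
    have hPz : MvPolynomial.eval z P =
        ((∑ i, ((c i).1 - polyOn E (q i)) * (g i).1 : C(E, ℂ)) : C(E, ℂ)) ⟨z, hz⟩ := by
      have h2 := congrArg (fun b : polyAlg E => b.1 ⟨z, hz⟩) hc
      simp only [AddSubmonoidClass.coe_finsetSum, MulMemClass.coe_mul, ContinuousMap.sum_apply,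
        ContinuousMap.mul_apply, OneMemClass.coe_one, ContinuousMap.one_apply] at h2
      simp only [P, map_sub, map_one, map_sum, map_mul, ContinuousMap.sum_apply,
        ContinuousMap.mul_apply, ContinuousMap.sub_apply, sub_mul, Finset.sum_sub_distrib, h2]
      simp [g]
    have hlt : ‖∑ i, ((c i).1 - polyOn E (q i)) * (g i).1‖ < 1 := by
      calc ‖∑ i, ((c i).1 - polyOn E (q i)) * (g i).1‖
          ≤ ∑ i, M⁻¹ * ‖g i‖ := by
            refine norm_sum_le_of_le _ fun i _ => (norm_mul_le _ _).trans ?_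
            exact mul_le_mul_of_nonneg_right (hq i).le (norm_nonneg _)
        _ = M⁻¹ * (M - 1) := by rw [← Finset.mul_sum, hM]; ring
        _ < 1 := by rw [inv_mul_lt_iff₀ hM0]; linarith
    rw [hPx, hPz, norm_one] at hle
    exact absurd (hle.trans (ContinuousMap.norm_coe_le_norm _ _)) (not_le.2 hlt)
  obtain ⟨χ, hχ⟩ := exists_character_of_isProper isClosed_polyAlg _ hI
  refine ⟨χ, funext fun i => ?_⟩
  have h := hχ (g i) (Ideal.subset_span ⟨i, rfl⟩)
  rw [character_polyOn] at h
  simpa [sub_eq_zero] using h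

theorem polyAlg_eq_top (hh : hullOf E ⊆ E)
    (hnull : ∀ i, volume ((fun z : Fin n → ℂ => z i) '' E) = 0) : polyAlg E = ⊤ := by
  refine Subalgebra.eq_top_of_separates isClosed_polyAlg
    (Set.range fun i => polyOn E (MvPolynomial.X i)) ?_ ?_ ?_
  · rintro _ ⟨i, rfl⟩; exact polyOn_mem _
  · rintro _ ⟨i, rfl⟩
    refine star_mem_of_volume_range_eq_zero isClosed_polyAlg (polyOn_mem _) ?_ fun l hl => ?_
    · convert hnull i using 2
      ext w
      simp
    · by_contra hcon
      obtain ⟨χ, hχ⟩ := exists_character_of_notMem_funResolvent isClosed_polyAlg (polyOn_mem _) hcon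
      refine hl ⟨charPoint χ, hh (charPoint_mem_hullOf χ)⟩ ?_
      rw [polyOn_apply, MvPolynomial.eval_X]
      exact hχ
  · intro x y hxy
    by_contra! hcon
    refine hxy (Subtype.ext (funext fun i => ?_))
    simpa using hcon _ ⟨i, rfl⟩

/-- A character is carried by a level set of any real function in the algebra. -/
theorem mem_hullOf_of_real (χ : polyAlg E →ₐ[ℂ] ℂ) (u : polyAlg E)
    (hu : ∀ x, (u.1 x).im = 0) :
    charPoint χ ∈ hullOf (Subtype.val '' {z : E | u.1 z = χ u}) := by
  have hsm : ∀ (c : ℂ) (b : polyAlg E), χ (c • b) = c * χ b := fun c b => by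
    rw [Algebra.smul_def, map_mul, AlgHom.commutes]; rfl
  have him : (χ u).im = 0 := by
    by_contra hne
    obtain ⟨σ, hσ⟩ : ∃ σ : ℝ, σ * (χ u).im < 0 := by
      rcases lt_or_gt_of_ne hne with h | h
      · exact ⟨1, by simpa⟩
      · exact ⟨-1, by simpa⟩
    refine notMem_funResolvent_of_character (((σ * Complex.I : ℂ) • u).2) χ
      (mem_funResolvent_of_ray isClosed_polyAlg (((σ * Complex.I : ℂ) • u).2) fun t ht x hx => ?_)
    have hx2 : (σ * Complex.I : ℂ) * u.1 x = χ ((σ * Complex.I : ℂ) • u) + t := hx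
    rw [hsm] at hx2
    have h2 := congrArg Complex.re hx2
    simp only [Complex.mul_re, Complex.mul_im, Complex.add_re, Complex.ofReal_re,
      Complex.ofReal_im, Complex.I_re, Complex.I_im, hu] at h2
    linarith
  set s := χ u with hs
  set M : ℝ := (‖u‖ + ‖s‖) ^ 2 + 1 with hM
  have hM0 : 0 < M := by positivity
  have hsr : s = (s.re : ℂ) := by apply Complex.ext <;> simp [him]
  let v : polyAlg E := 1 - ((M⁻¹ : ℝ) : ℂ) • (u - algebraMap ℂ _ s) ^ 2
  have hvx : ∀ x, v.1 x = ((1 - M⁻¹ * ((u.1 x).re - s.re) ^ 2 : ℝ) : ℂ) := by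
    intro x
    have hur : u.1 x = ((u.1 x).re : ℂ) := by apply Complex.ext <;> simp [hu x]
    have : v.1 x = 1 - ((M⁻¹ : ℝ) : ℂ) * (u.1 x - s) ^ 2 := by
      simp [v, Algebra.algebraMap_eq_smul_one]
    rw [this, hur, hsr]
    push_cast
    simp
  have hb : ∀ x, M⁻¹ * ((u.1 x).re - s.re) ^ 2 < 1 := by
    intro x
    rw [inv_mul_lt_iff₀ hM0, mul_one, hM]
    have h1 : |(u.1 x).re - s.re| ≤ ‖u‖ + ‖s‖ :=
      (abs_sub _ _).trans (add_le_add ((Complex.abs_re_le_norm _).trans (u.1.norm_coe_le_norm x))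
        (Complex.abs_re_le_norm _))
    nlinarith [sq_abs ((u.1 x).re - s.re), abs_nonneg ((u.1 x).re - s.re)]
  have hnn : ∀ x, 0 ≤ M⁻¹ * ((u.1 x).re - s.re) ^ 2 := fun x => by positivity
  have hvn : ∀ x, ‖v.1 x‖ = 1 - M⁻¹ * ((u.1 x).re - s.re) ^ 2 := by
    intro x
    rw [hvx, Complex.norm_real, Real.norm_of_nonneg (by linarith [hb x])]
  refine hullOf_mono (Set.image_mono ?_) (mem_hullOf_of_peak χ (v := v) (fun x => ?_) ?_)
  · intro x hx
    have h1 : ‖v.1 x‖ = 1 := hx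
    rw [hvn] at h1
    have h2 : (u.1 x).re - s.re = 0 := by
      have : M⁻¹ * ((u.1 x).re - s.re) ^ 2 = 0 := by linarith
      simpa [hM0.ne'] using this
    change u.1 x = s
    apply Complex.ext
    · linarith
    · rw [hu x, him]
  · rw [hvn]; linarith [hnn x]
  · have : χ v = 1 := by simp [v, hsm, ← hs]
    simp [this]

end

/-- Minimal compact carriers of hull points in a closed set. -/
theorem exists_minimal_carrier {Y : Set (Fin n → ℂ)} (hY : IsClosed Y) (hE : IsCompact E)
    (hne : (hullOf E ∩ Y).Nonempty) :
    ∃ C ⊆ E, IsCompact C ∧ (hullOf C ∩ Y).Nonempty ∧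
      ∀ C' ⊆ C, IsCompact C' → (hullOf C' ∩ Y).Nonempty → C' = C := by
  obtain ⟨C, hCE, hmin⟩ := zorn_superset_nonempty
    {C : Set (Fin n → ℂ) | IsCompact C ∧ (hullOf C ∩ Y).Nonempty} (by
      intro c hc hchain hcne
      have hdir : DirectedOn (· ⊇ ·) c := fun a ha b hb => by
        rcases hchain.total ha hb with h | h
        · exact ⟨a, ha, subset_rfl, h⟩
        · exact ⟨b, hb, h, subset_rfl⟩
      have : Nonempty c := hcne.to_subtype
      have hd : Directed (· ⊇ ·) (fun i : c => (i : Set (Fin n → ℂ))) := hdir.directed_val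
      have hyne := IsCompact.nonempty_iInter_of_directed_nonempty_isCompact_isClosed
        (fun i : c => hullOf i.1 ∩ Y)
        (fun a b => by
          obtain ⟨d, hda, hdb⟩ := hd a b
          exact ⟨d, Set.inter_subset_inter_left _ (hullOf_mono hda),
            Set.inter_subset_inter_left _ (hullOf_mono hdb)⟩)
        (fun i => (hc i.2).2) (fun i => (isCompact_hullOf (hc i.2).1).inter_right hY)
        (fun i => (isClosed_hullOf (hc i.2).1).inter hY)
      obtain ⟨y, hy⟩ := hyne
      rw [Set.mem_iInter] at hy
      obtain ⟨i0⟩ := this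
      refine ⟨⋂₀ c, ⟨(hc i0.2).1.of_isClosed_subset (isClosed_sInter fun s hs =>
        (hc hs).1.isClosed) (Set.sInter_subset_of_mem i0.2), y, ?_, (hy i0).2⟩,
        fun s hs => Set.sInter_subset_of_mem hs⟩
      intro p
      have hcl : IsClosed {z | ‖MvPolynomial.eval y p‖ ≤ ‖MvPolynomial.eval z p‖} :=
        isClosed_le continuous_const (continuous_eval_norm p)
      have : Nonempty c := ⟨i0⟩
      obtain ⟨z, hz⟩ := IsCompact.nonempty_iInter_of_directed_nonempty_isCompact_isClosed
        (fun i : c => i.1 ∩ {z | ‖MvPolynomial.eval y p‖ ≤ ‖MvPolynomial.eval z p‖})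
        (fun a b => by
          obtain ⟨d, hda, hdb⟩ := hd a b
          exact ⟨d, Set.inter_subset_inter_left _ hda, Set.inter_subset_inter_left _ hdb⟩)
        (fun i => (hy i).1 p) (fun i => (hc i.2).1.inter_right hcl)
        (fun i => (hc i.2).1.isClosed.inter hcl)
      rw [Set.mem_iInter] at hz
      exact ⟨z, fun s hs => (hz ⟨s, hs⟩).1, (hz i0).2⟩) E ⟨hE, hne⟩
  exact ⟨C, hCE, hmin.1.1, hmin.1.2, fun C' h1 h2 h3 => h1.antisymm (hmin.2 ⟨h2, h3⟩ h1)⟩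

end Hull

end

section

open MeasureTheory Real Module

section Codim

theorem LinearMap.rank_quotient_range_comp {V : Type*} [AddCommGroup V] [Module ℂ V]
    (T S : V →ₗ[ℂ] V) (hT : Function.Injective T) :
    Module.rank ℂ (V ⧸ LinearMap.range (T ∘ₗ S)) =
      Module.rank ℂ (V ⧸ LinearMap.range T) + Module.rank ℂ (V ⧸ LinearMap.range S) := by
  set R := LinearMap.range (T ∘ₗ S)
  let φ : V →ₗ[ℂ] V ⧸ R := R.mkQ ∘ₗ T
  have hker : LinearMap.ker φ = LinearMap.range S := by
    ext x
    simp only [φ, R, LinearMap.mem_ker, LinearMap.comp_apply, Submodule.mkQ_apply,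
      Submodule.Quotient.mk_eq_zero, LinearMap.mem_range]
    exact ⟨fun ⟨y, hy⟩ => ⟨y, hT hy⟩, fun ⟨y, hy⟩ => ⟨y, by rw [hy]⟩⟩
  have hrange : LinearMap.range φ = (LinearMap.range T).map R.mkQ := LinearMap.range_comp _ _
  have h1 := Submodule.rank_quotient_add_rank (LinearMap.range φ)
  have h2 : Module.rank ℂ (LinearMap.range φ) = Module.rank ℂ (V ⧸ LinearMap.range S) := by
    rw [← hker]; exact φ.quotKerEquivRange.rank_eq.symm
  have h3 : Module.rank ℂ ((V ⧸ R) ⧸ LinearMap.range φ) = Module.rank ℂ (V ⧸ LinearMap.range T) := by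
    rw [hrange]
    exact (Submodule.quotientQuotientEquivQuotient R (LinearMap.range T)
      (LinearMap.range_comp_le_range _ _)).rank_eq
  rw [← h1, h2, h3]

variable {V : Type*} [NormedAddCommGroup V] [NormedSpace ℂ V]

theorem Submodule.exists_transverse (R : Submodule ℂ V) (hR : IsClosed (R : Set V)) {n : ℕ}
    (hn : ¬ Module.rank ℂ (V ⧸ R) ≤ n) (k : ℕ) (hk : k ≤ n + 1) :
    ∃ N : Submodule ℂ V, Module.rank ℂ N = k ∧ ∀ v ∈ N, ∀ r ∈ R, ‖v‖ ≤ 5 ^ k * ‖v - r‖ := by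
  induction k with
  | zero =>
    exact ⟨⊥, by simp, fun v hv r _ => by rw [(Submodule.mem_bot ℂ).1 hv]; simp⟩
  | succ k ih =>
    obtain ⟨N, hN, hNR⟩ := ih (by omega)
    have : FiniteDimensional ℂ N := by
      refine Module.finite_of_rank_eq_nat hN
    have hcl : IsClosed ((R ⊔ N : Submodule ℂ V) : Set V) :=
      Submodule.isClosed_sup_finiteDimensional _ _ hR
    have hne : ∃ x, x ∉ R ⊔ N := by
      by_contra! hall
      apply hn
      have hs : Function.Surjective (R.mkQ ∘ₗ N.subtype) := by
        intro q
        obtain ⟨x, rfl⟩ := R.mkQ_surjective q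
        obtain ⟨r, hr, v, hv, rfl⟩ := Submodule.mem_sup.1 (hall x)
        refine ⟨⟨v, hv⟩, ?_⟩
        simpa using hr
      refine (LinearMap.rank_le_of_surjective _ hs).trans ?_
      rw [hN]
      exact_mod_cast (by omega : k ≤ n)
    obtain ⟨x, hx, hd⟩ := riesz_lemma hcl hne (r := 1 / 2) (by norm_num)
    have hx0 : x ≠ 0 := fun h => hx (h ▸ Submodule.zero_mem _)
    refine ⟨N ⊔ Submodule.span ℂ {x}, ?_, ?_⟩
    · have hinf : N ⊓ Submodule.span ℂ {x} = ⊥ := by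
        rw [eq_bot_iff]
        rintro y ⟨hy, hy'⟩
        obtain ⟨c, rfl⟩ := Submodule.mem_span_singleton.1 hy'
        by_cases hc : c = 0
        · simp [hc]
        · refine absurd (Submodule.mem_sup_right ?_) hx
          simpa [smul_smul, inv_mul_cancel₀ hc] using N.smul_mem c⁻¹ hy
      have h1 := Submodule.rank_sup_add_rank_inf_eq N (Submodule.span ℂ {x})
      rw [hinf, rank_bot, add_zero, hN, rank_span_set
        (LinearIndepOn.singleton (v := id) hx0 : LinearIndepOn ℂ id {x})] at h1
      rw [h1]
      simp
    · intro w hw r hr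
      obtain ⟨v, hv, y, hy, rfl⟩ := Submodule.mem_sup.1 hw
      obtain ⟨c, rfl⟩ := Submodule.mem_span_singleton.1 hy
      have h1 : ‖c • x‖ ≤ 2 * ‖v + c • x - r‖ := by
        by_cases hc : c = 0
        · subst hc; simp
        have h2 := hd (c⁻¹ • (r - v)) (Submodule.smul_mem _ _ (Submodule.sub_mem _
          (Submodule.mem_sup_left hr) (Submodule.mem_sup_right hv)))
        have h3 : v + c • x - r = c • (x - c⁻¹ • (r - v)) := by
          rw [smul_sub, smul_smul, mul_inv_cancel₀ hc, one_smul]; abel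
        rw [h3, norm_smul, norm_smul]
        nlinarith [norm_nonneg c]
      have h2 := hNR v hv r hr
      have h3 : ‖v - r‖ ≤ ‖v + c • x - r‖ + ‖c • x‖ := by
        have : v - r = (v + c • x - r) - c • x := by abel
        rw [this]; exact norm_sub_le _ _
      have h5 : (1 : ℝ) ≤ 5 ^ k := one_le_pow₀ (by norm_num)
      have h6 : 0 ≤ ‖v + c • x - r‖ := norm_nonneg _
      calc ‖v + c • x‖ ≤ ‖v‖ + ‖c • x‖ := norm_add_le _ _
        _ ≤ 5 ^ k * (3 * ‖v + c • x - r‖) + 5 ^ k * (2 * ‖v + c • x - r‖) := by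
          refine add_le_add (h2.trans (by gcongr; linarith)) (h1.trans ?_)
          nlinarith
        _ = 5 ^ (k + 1) * ‖v + c • x - r‖ := by ring

theorem rank_quotient_range_le_of_near (T T' : V →L[ℂ] V)
    (hcl : IsClosed (LinearMap.range (T' : V →ₗ[ℂ] V) : Set V)) {n : ℕ}
    (hn : Module.rank ℂ (V ⧸ LinearMap.range (T : V →ₗ[ℂ] V)) ≤ n) {θ : ℝ}
    (hθ : 5 ^ (n + 1) * θ < 1) (hTT : ∀ x, ‖T x - T' x‖ ≤ θ * ‖T x‖) :
    Module.rank ℂ (V ⧸ LinearMap.range (T' : V →ₗ[ℂ] V)) ≤ n := by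
  by_contra hcon
  obtain ⟨N, hN, hNR⟩ := Submodule.exists_transverse _ hcl hcon (n + 1) le_rfl
  have hinj : Function.Injective ((LinearMap.range (T : V →ₗ[ℂ] V)).mkQ ∘ₗ N.subtype) := by
    rw [← LinearMap.ker_eq_bot, LinearMap.ker_eq_bot']
    rintro ⟨v, hv⟩ h0
    have : v ∈ LinearMap.range (T : V →ₗ[ℂ] V) := by simpa using h0
    obtain ⟨x, rfl⟩ := this
    have h1 := hNR _ hv (T' x) ⟨x, rfl⟩
    have h2 := hTT x
    have : ‖T x‖ = 0 := by
      refine le_antisymm ?_ (norm_nonneg _)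
      by_contra hpos
      have : ‖T x‖ ≤ 5 ^ (n + 1) * θ * ‖T x‖ := by
        rw [mul_assoc]
        exact h1.trans (mul_le_mul_of_nonneg_left h2 (by positivity))
      nlinarith
    ext
    simpa using this
  have := LinearMap.rank_le_of_injective _ hinj
  rw [hN] at this
  have h3 : ((n + 1 : ℕ) : Cardinal) ≤ (n : ℕ) := this.trans hn
  rw [Nat.cast_le] at h3
  omega

end Codim

section Path

theorem forall_step_of_uniform {P : ℝ → Prop} {δ : ℝ} (hδ : 0 < δ)
    (h : ∀ s ∈ Set.Icc (0 : ℝ) 1, ∀ t ∈ Set.Icc (0 : ℝ) 1, |s - t| ≤ δ → P s → P t) (h0 : P 0) :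
    P 1 := by
  obtain ⟨N, hN⟩ := exists_nat_gt δ⁻¹
  have hN0 : (0 : ℝ) < N := (inv_pos.2 hδ).trans hN
  have key : ∀ j : ℕ, j ≤ N → P (j / N) := by
    intro j
    induction j with
    | zero => simpa using h0
    | succ j ih =>
      intro hj
      have hj' : ((j : ℝ) + 1) ≤ N := by exact_mod_cast hj
      refine h (j / N) ⟨by positivity, ?_⟩ _ ⟨by positivity, ?_⟩ ?_ (ih (by omega))
      · rw [div_le_one hN0]; linarith
      · rw [div_le_one hN0]; push_cast; exact hj'
      · have : (j : ℝ) / N - ((j + 1 : ℕ) : ℝ) / N = - (N : ℝ)⁻¹ := by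
          push_cast; field_simp; ring
        rw [this, abs_neg, abs_of_pos (inv_pos.2 hN0)]
        exact (inv_lt_of_inv_lt₀ hδ hN).le
  simpa [hN0.ne'] using key N le_rfl

end Path

section FunAlg
variable {X : Type*} [TopologicalSpace X] [CompactSpace X] {B : Subalgebra ℂ C(X, ℂ)}

theorem mulLeft_bounded_below {a : B} (ha : ∀ x, a.1 x ≠ 0) :
    ∃ c : ℝ, 0 < c ∧ ∀ x : B, ‖x‖ ≤ c * ‖a * x‖ := by
  have hu : IsUnit a.1 := (ContinuousMap.isUnit_iff_forall_ne_zero _).2 ha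
  obtain ⟨u, hu⟩ := hu
  refine ⟨‖(↑u⁻¹ : C(X, ℂ))‖ + 1, by positivity, fun x => ?_⟩
  have : (x : C(X, ℂ)) = ↑u⁻¹ * (a * x : B).1 := by
    change x.1 = ↑u⁻¹ * (a.1 * x.1)
    rw [← hu, ← mul_assoc, Units.inv_mul, one_mul]
  calc ‖x‖ = ‖(x : C(X, ℂ))‖ := rfl
    _ = ‖(↑u⁻¹ : C(X, ℂ)) * (a * x : B).1‖ := by rw [← this]
    _ ≤ ‖(↑u⁻¹ : C(X, ℂ))‖ * ‖a * x‖ := norm_mul_le _ _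
    _ ≤ _ := by nlinarith [norm_nonneg (a * x)]

theorem mulLeft_injective {a : B} (ha : ∀ x, a.1 x ≠ 0) :
    Function.Injective (LinearMap.mulLeft ℂ a) := by
  obtain ⟨c, -, hc⟩ := mulLeft_bounded_below ha
  intro x y hxy
  have hxy' : a * x = a * y := hxy
  have h1 := hc (x - y)
  rw [mul_sub, sub_eq_zero.2 hxy', norm_zero, mul_zero] at h1
  exact sub_eq_zero.1 (norm_le_zero_iff.1 h1)

theorem isClosed_range_mulLeft (hB : IsClosed (B : Set C(X, ℂ))) {a : B} (ha : ∀ x, a.1 x ≠ 0) :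
    IsClosed (LinearMap.range (LinearMap.mulLeft ℂ a) : Set B) := by
  have : CompleteSpace B := hB.completeSpace_coe
  obtain ⟨c, hc0, hc⟩ := mulLeft_bounded_below ha
  have hal : AntilipschitzWith ⟨c, hc0.le⟩ (ContinuousLinearMap.mul ℂ B a) :=
    AddMonoidHomClass.antilipschitz_of_bound _ hc
  have h := hal.isClosed_range (ContinuousLinearMap.mul ℂ B a).uniformContinuous
  have he : (LinearMap.range (LinearMap.mulLeft ℂ a) : Set B) =
      Set.range (ContinuousLinearMap.mul ℂ B a) := rfl
  rw [he]
  exact h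

/-- Stability of the codimension of principal ideals under small relative perturbations. -/
theorem rank_quotient_range_mulLeft_le (hB : IsClosed (B : Set C(X, ℂ))) {a b : B}
    (ha : ∀ x, a.1 x ≠ 0) (hab : ∀ x, ‖b.1 x - a.1 x‖ ≤ 1 / 2 * ‖a.1 x‖) (n : ℕ) :
    Module.rank ℂ (B ⧸ LinearMap.range (LinearMap.mulLeft ℂ a)) ≤ n ↔
      Module.rank ℂ (B ⧸ LinearMap.range (LinearMap.mulLeft ℂ b)) ≤ n := by
  let F : ℝ → B := fun s => a + (s : ℂ) • (b - a)
  let P : ℝ → Prop := fun s => Module.rank ℂ (B ⧸ LinearMap.range (LinearMap.mulLeft ℂ (F s))) ≤ n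
  have hF : ∀ s ∈ Set.Icc (0 : ℝ) 1, ∀ x, 1 / 2 * ‖a.1 x‖ ≤ ‖(F s).1 x‖ := by
    intro s hs x
    have h1 : (F s).1 x = a.1 x + s * (b.1 x - a.1 x) := rfl
    have h2 : ‖(s : ℂ) * (b.1 x - a.1 x)‖ ≤ 1 / 2 * ‖a.1 x‖ := by
      rw [norm_mul, Complex.norm_real, Real.norm_of_nonneg hs.1]
      nlinarith [hab x, hs.2, norm_nonneg (b.1 x - a.1 x)]
    have h3 := norm_sub_norm_le (a.1 x) (-((s : ℂ) * (b.1 x - a.1 x)))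
    rw [sub_neg_eq_add, norm_neg, ← h1] at h3
    linarith
  have hF0 : ∀ s ∈ Set.Icc (0 : ℝ) 1, ∀ x, (F s).1 x ≠ 0 := fun s hs x =>
    norm_pos_iff.1 (lt_of_lt_of_le (by have := norm_pos_iff.2 (ha x); positivity) (hF s hs x))
  have hstep : ∀ s ∈ Set.Icc (0 : ℝ) 1, ∀ t ∈ Set.Icc (0 : ℝ) 1,
      |s - t| ≤ (2 * 5 ^ (n + 1))⁻¹ → P s → P t := by
    intro s hs t ht hst hPs
    refine rank_quotient_range_le_of_near (ContinuousLinearMap.mul ℂ B (F s))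
      (ContinuousLinearMap.mul ℂ B (F t)) (isClosed_range_mulLeft hB (hF0 t ht)) hPs
      (θ := (2 * 5 ^ (n + 1))⁻¹) (by field_simp; norm_num) fun x => ?_
    have hle : ∀ y, ‖(F s * x - F t * x : B).1 y‖ ≤ (2 * 5 ^ (n + 1))⁻¹ * ‖F s * x‖ := by
      intro y
      have e1 : (F s * x - F t * x : B).1 y = ((s - t : ℝ) : ℂ) * (b.1 y - a.1 y) * x.1 y := by
        change (a.1 y + s * (b.1 y - a.1 y)) * x.1 y - (a.1 y + t * (b.1 y - a.1 y)) * x.1 y = _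
        push_cast
        ring
      rw [e1, norm_mul, norm_mul, Complex.norm_real, Real.norm_eq_abs]
      calc |s - t| * ‖b.1 y - a.1 y‖ * ‖x.1 y‖
          ≤ (2 * 5 ^ (n + 1))⁻¹ * ‖(F s).1 y‖ * ‖x.1 y‖ := by
            gcongr
            exact (hab y).trans (hF s hs y)
        _ = (2 * 5 ^ (n + 1))⁻¹ * ‖(F s * x).1 y‖ := by
            change _ = (2 * 5 ^ (n + 1))⁻¹ * ‖(F s).1 y * x.1 y‖
            rw [norm_mul, mul_assoc]
        _ ≤ _ := by
            gcongr
            exact (F s * x).1.norm_coe_le_norm y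
    exact (ContinuousMap.norm_le _ (by positivity)).2 hle
  have hF1 : F 0 = a := by simp [F]
  have hF2 : F 1 = b := by simp [F]
  have hP0 : P 0 ↔ Module.rank ℂ (B ⧸ LinearMap.range (LinearMap.mulLeft ℂ a)) ≤ n := by
    simp only [P]; rw [hF1]
  have hP1 : P 1 ↔ Module.rank ℂ (B ⧸ LinearMap.range (LinearMap.mulLeft ℂ b)) ≤ n := by
    simp only [P]; rw [hF2]
  rw [← hP0, ← hP1]
  constructor
  · exact forall_step_of_uniform (by positivity) hstep
  · intro h1
    have := forall_step_of_uniform (P := fun s => P (1 - s)) (δ := (2 * 5 ^ (n + 1))⁻¹)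
      (by positivity) (fun s hs t ht hst hp => hstep (1 - s) ⟨by linarith [hs.2], by linarith [hs.1]⟩
        (1 - t) ⟨by linarith [ht.2], by linarith [ht.1]⟩ (by
          rw [abs_sub_comm] at hst
          rwa [show 1 - s - (1 - t) = t - s by ring]) hp) (by simpa using h1)
    simpa using this

/-- There is no element whose square is relatively close to an odd power of a generator of a
maximal ideal. -/
theorem false_of_sq_near_odd_pow (hB : IsClosed (B : Set C(X, ℂ))) {a b : B} {k : ℕ}
    (hb : ∀ x, b.1 x ≠ 0) (hb1 : ∀ c : B, ∃ (d : B) (t : ℂ), c = b * d + algebraMap ℂ B t)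
    (hb2 : ¬ IsUnit b)
    (hab : ∀ x, ‖a.1 x ^ 2 - b.1 x ^ (2 * k + 1)‖ ≤ 1 / 2 * ‖b.1 x ^ (2 * k + 1)‖) : False := by
  have hmul : ∀ x y : B, (∀ z, x.1 z ≠ 0) →
      Module.rank ℂ (B ⧸ LinearMap.range (LinearMap.mulLeft ℂ (x * y))) =
      Module.rank ℂ (B ⧸ LinearMap.range (LinearMap.mulLeft ℂ x)) +
      Module.rank ℂ (B ⧸ LinearMap.range (LinearMap.mulLeft ℂ y)) := by
    intro x y hx
    rw [LinearMap.mulLeft_mul]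
    exact LinearMap.rank_quotient_range_comp _ _ (mulLeft_injective hx)
  have hone : Module.rank ℂ (B ⧸ LinearMap.range (LinearMap.mulLeft ℂ b)) = 1 := by
    refine rank_eq_one (Submodule.Quotient.mk 1) ?_ ?_
    · intro h0
      obtain ⟨y, hy⟩ := (Submodule.Quotient.mk_eq_zero _).1 h0
      exact hb2 (IsUnit.of_mul_eq_one y hy)
    · intro w
      obtain ⟨c, rfl⟩ := Submodule.Quotient.mk_surjective _ w
      obtain ⟨d, t, rfl⟩ := hb1 c
      refine ⟨t, ?_⟩
      rw [← Submodule.Quotient.mk_smul, ← sub_eq_zero, ← Submodule.Quotient.mk_sub,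
        Submodule.Quotient.mk_eq_zero]
      refine ⟨-d, ?_⟩
      rw [LinearMap.mulLeft_apply, Algebra.algebraMap_eq_smul_one]
      ring
  have hpow : ∀ m : ℕ,
      Module.rank ℂ (B ⧸ LinearMap.range (LinearMap.mulLeft ℂ (b ^ m))) = m := by
    intro m
    induction m with
    | zero =>
      rw [pow_zero, LinearMap.mulLeft_one, LinearMap.range_id]
      simp
    | succ m ih =>
      rw [pow_succ', hmul _ _ hb, hone, ih]
      push_cast
      ring
  have ha : ∀ x, a.1 x ≠ 0 := by
    intro x hx
    have h1 := hab x
    have h2 : 0 < ‖b.1 x ^ (2 * k + 1)‖ := norm_pos_iff.2 (pow_ne_zero _ (hb x))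
    rw [hx] at h1
    simp only [ne_eq, OfNat.ofNat_ne_zero, not_false_eq_true, zero_pow, zero_sub, norm_neg] at h1
    linarith
  have hst := rank_quotient_range_mulLeft_le hB (a := b ^ (2 * k + 1)) (b := a * a)
    (fun x => pow_ne_zero _ (hb x)) (fun x => by
      have := hab x
      rw [pow_two] at this
      exact this)
  simp only [hpow, hmul a a ha, Nat.cast_le] at hst
  set c := Module.rank ℂ (B ⧸ LinearMap.range (LinearMap.mulLeft ℂ a))
  have h1 := (hst (2 * k + 1)).1 le_rfl
  obtain ⟨m, hm⟩ := Cardinal.lt_aleph0.1 ((le_self_add.trans h1).trans_lt (Cardinal.natCast_lt_aleph0 (n := 2 * k + 1)))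
  rw [hm] at hst
  have h2 : ∀ n : ℕ, 2 * k + 1 ≤ n ↔ m + m ≤ n := fun n => by
    rw [hst n]; exact_mod_cast Iff.rfl
  have := (h2 (2 * k + 1)).1 le_rfl
  have := (h2 (m + m)).2 le_rfl
  omega

end FunAlg

end

section

open MeasureTheory Real

theorem Complex.volume_eq_zero_of_horizontal_slices {s : Set ℂ} (hs : MeasurableSet s)
    (h : ∀ z ∈ s, ∀ w ∈ s, z.im = w.im → z = w) : volume s = 0 := by
  have hm := Complex.volume_preserving_equiv_real_prod.symm
  have ht : MeasurableSet (Complex.measurableEquivRealProd.symm ⁻¹' s) :=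
    Complex.measurableEquivRealProd.symm.measurable hs
  rw [← hm.measure_preimage hs.nullMeasurableSet, Measure.volume_eq_prod,
    Measure.prod_apply_symm ht, lintegral_eq_zero_iff' (by
      exact (measurable_measure_prodMk_right ht).aemeasurable)]
  refine Filter.Eventually.of_forall fun y => ?_
  refine Set.Subsingleton.measure_zero ?_ _
  intro a ha b hb
  have := h _ ha _ hb (by simp)
  simpa using congrArg Complex.re this

section Bump
variable {X : Type*} [TopologicalSpace X] [CompactSpace X] {B : Subalgebra ℂ C(X, ℂ)}
  {f : C(X, ℂ)}

theorem exists_bumpComp_mem (hB : IsClosed (B : Set C(X, ℂ))) (hf : f ∈ B) {δ t : ℝ}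
    (him : ∀ x y, -δ < (f x).re → -δ < (f y).re → (f x).im = (f y).im → f x = f y)
    (ht : 0 < t) (htδ : t < δ) (hres : (-t : ℂ) ∈ funResolvent B f) :
    ∃ r > 0, bumpComp f r ∈ B := by
  obtain ⟨r', hr', hball⟩ := Metric.isOpen_iff.1 (isOpen_funResolvent hB hf) _ hres
  have hr0 : 0 < min (r' / 2) (t / 2) := by positivity
  refine ⟨min (r' / 2) (t / 2), hr0, bumpComp_mem hB hr0 ?_ ?_⟩
  · refine Complex.volume_eq_zero_of_horizontal_slices ?_ ?_
    · exact ((isCompact_range f.continuous).isClosed.inter Metric.isClosed_closedBall).measurableSet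
    · have hre : ∀ z : ℂ, z ∈ Metric.closedBall (0 : ℂ) (min (r' / 2) (t / 2)) → -δ < z.re := by
        intro z hz
        rw [mem_closedBall_zero_iff] at hz
        have := (Complex.abs_re_le_norm z).trans (hz.trans (min_le_right _ _))
        linarith [(abs_le.1 this).1]
      rintro _ ⟨⟨x, rfl⟩, hx⟩ _ ⟨⟨y, rfl⟩, hy⟩ hxy
      exact him x y (hre _ hx) (hre _ hy) hxy
  · intro l hl hlf
    rw [mem_closedBall_zero_iff] at hl
    have hlr := (Complex.abs_re_le_norm l).trans (hl.trans (min_le_right _ _))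
    have hli := (Complex.abs_im_le_norm l).trans (hl.trans (min_le_left _ _))
    have hlr1 := (abs_le.1 hlr).1
    by_cases hray : ∀ s : ℝ, 0 ≤ s → ∀ x, f x ≠ l + s
    · exact mem_funResolvent_of_ray hB hf hray
    push Not at hray
    obtain ⟨s, hs, x, hx⟩ := hray
    have hs0 : 0 < s := by
      rcases hs.lt_or_eq with h | h
      · exact h
      · rw [← h] at hx; exact absurd (by simpa using hx) (hlf x)
    have hxr : (f x).re = l.re + s := by rw [hx]; simp
    have hxi : (f x).im = l.im := by rw [hx]; simp
    refine funResolvent_of_isPreconnected hB hf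
      (V := segment ℝ ((-t : ℝ) + (l.im : ℂ) * Complex.I) l)
      (convex_segment _ _).isPreconnected ?_ ⟨_, left_mem_segment _ _ _, hball ?_⟩
      (right_mem_segment _ _ _)
    · rintro y ⟨a, b, ha, hb, hab, hy⟩
      have hyr : (f y).re = a * (-t) + b * l.re := by rw [← hy]; simp
      have hyi : (f y).im = l.im := by
        rw [← hy]; simp; rw [← add_mul, hab, one_mul]
      have h2 := him y x (by rw [hyr]; nlinarith) (by rw [hxr]; linarith) (by rw [hyi, hxi])
      have h3 : (f y).re = (f x).re := by rw [h2]
      rw [hyr, hxr] at h3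
      nlinarith
    · rw [mem_ball_iff_norm]
      have : ((-t : ℝ) : ℂ) + (l.im : ℂ) * Complex.I - -(t : ℂ) = (l.im : ℂ) * Complex.I := by
        push_cast; ring
      rw [this, norm_mul, Complex.norm_I, mul_one, Complex.norm_real, Real.norm_eq_abs]
      linarith

end Bump

end

section

open MeasureTheory Real

section Peaking

/-- The squared Euclidean norm on `ℂ²`. -/
def nsq (v : Fin 2 → ℂ) : ℝ := Complex.normSq (v 0) + Complex.normSq (v 1)

/-- The functional `v ↦ ⟪v, w⟫` on `ℂ²`, with conjugation on the second slot. -/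
def ipCLM (w : Fin 2 → ℂ) : (Fin 2 → ℂ) →L[ℂ] ℂ :=
  (starRingEnd ℂ (w 0)) • ContinuousLinearMap.proj 0 +
    (starRingEnd ℂ (w 1)) • ContinuousLinearMap.proj 1

theorem ipCLM_apply (w v : Fin 2 → ℂ) :
    ipCLM w v = starRingEnd ℂ (w 0) * v 0 + starRingEnd ℂ (w 1) * v 1 := rfl

theorem ipCLM_self (w : Fin 2 → ℂ) : ipCLM w w = nsq w := by
  rw [ipCLM_apply, nsq]
  push_cast
  rw [Complex.normSq_eq_conj_mul_self, Complex.normSq_eq_conj_mul_self]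

theorem norm_ipCLM_le (w v : Fin 2 → ℂ) : ‖ipCLM w v‖ ≤ 2 * ‖w‖ * ‖v‖ := by
  have h : ∀ i, ‖starRingEnd ℂ (w i) * v i‖ ≤ ‖w‖ * ‖v‖ := fun i => by
    rw [norm_mul, RCLike.norm_conj]
    exact mul_le_mul (norm_le_pi_norm w i) (norm_le_pi_norm v i) (norm_nonneg _) (norm_nonneg _)
  rw [ipCLM_apply]
  linarith [norm_add_le (starRingEnd ℂ (w 0) * v 0) (starRingEnd ℂ (w 1) * v 1), h 0, h 1]

theorem nsq_nonneg (v : Fin 2 → ℂ) : 0 ≤ nsq v :=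
  add_nonneg (Complex.normSq_nonneg _) (Complex.normSq_nonneg _)

theorem sq_norm_le_nsq (v : Fin 2 → ℂ) : ‖v‖ ^ 2 ≤ nsq v := by
  have h : ‖v‖ ≤ √(nsq v) := by
    refine (pi_norm_le_iff_of_nonneg (sqrt_nonneg _)).2 fun i => ?_
    refine le_sqrt_of_sq_le ?_
    rw [← Complex.normSq_eq_norm_sq, nsq]
    fin_cases i
    · exact le_add_of_nonneg_right (Complex.normSq_nonneg _)
    · exact le_add_of_nonneg_left (Complex.normSq_nonneg _)
  calc ‖v‖ ^ 2 ≤ √(nsq v) ^ 2 := by gcongr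
    _ = nsq v := sq_sqrt (nsq_nonneg v)

theorem re_ipCLM_sub (q z : Fin 2 → ℂ) :
    (ipCLM q (z - q)).re = 1 / 2 * (nsq z - nsq q - nsq (z - q)) := by
  simp only [ipCLM_apply, nsq, Complex.normSq_apply, Pi.sub_apply, Complex.add_re, Complex.mul_re,
    Complex.sub_re, Complex.sub_im, Complex.conj_re, Complex.conj_im]
  ring

/-- `T` is a unit field to which the set `S` is tangent to first order. -/
structure IsTangentField (S : Set (Fin 2 → ℂ)) (T : (Fin 2 → ℂ) → Fin 2 → ℂ) (C : ℝ) : Prop where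
  norm_eq : ∀ q ∈ S, ‖T q‖ = 1
  approx : ∀ q ∈ S, ∀ z ∈ S, ∀ y ∈ S, ∃ κ : ℝ,
    ‖z - y - (κ : ℂ) • T q‖ ≤ C * (‖z - q‖ + ‖y - q‖) * ‖z - y‖

/-- A linear functional whose translate to `q` peaks at `q` on the part of `S` in the ball through
`q`, and is injective near `q` on horizontal slices. -/
structure IsPeaking (S : Set (Fin 2 → ℂ)) (T : (Fin 2 → ℂ) → Fin 2 → ℂ) (ρ c L : ℝ)
    (q : Fin 2 → ℂ) (l : (Fin 2 → ℂ) →L[ℂ] ℂ) : Prop where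
  map_T : l (T q) ≠ 0
  re_le : ∀ z ∈ S, (l (z - q)).re ≤ -(1 / 4) * ‖z - q‖ ^ 2 + 1 / 2 * (nsq z - nsq q)
  im_ge : ∀ z ∈ S, ∀ z' ∈ S, ‖z - q‖ ≤ ρ → ‖z' - q‖ ≤ ρ → c * ‖z - z'‖ ≤ |(l (z - z')).im|
  bound : ∀ v, ‖l v‖ ≤ L * ‖v‖

theorem IsTangentField.exists_isPeaking {S : Set (Fin 2 → ℂ)} {T : (Fin 2 → ℂ) → Fin 2 → ℂ}
    {C R : ℝ} (hT : IsTangentField S T C) (hC : 1 ≤ C) (hR : 1 ≤ R) (hSR : ∀ z ∈ S, ‖z‖ ≤ R) :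
    ∃ ρ > 0, ∃ c > 0, ∀ q ∈ S, ∃ l, IsPeaking S T ρ c (4 * R) q l := by
  obtain ⟨ε, hε, hεC⟩ : ∃ ε : ℝ, 0 < ε ∧ ε * (8 * C) = 1 :=
    ⟨1 / (8 * C), by positivity, by field_simp⟩
  have hε1 : ε ≤ 1 := by nlinarith
  refine ⟨ε / (20 * C * R), by positivity, ε / 2, by positivity, fun q hq => ?_⟩
  obtain ⟨σ, hσ, hσs⟩ : ∃ σ : ℝ, |σ| = 1 ∧ ∀ s : ℝ, 0 ≤ s →
      s ≤ |(ipCLM q (T q)).im + σ * s| := by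
    rcases le_total 0 (ipCLM q (T q)).im with h | h
    · refine ⟨1, by simp, fun s hs => ?_⟩
      rw [abs_of_nonneg (by linarith)]; linarith
    · refine ⟨-1, by simp, fun s hs => ?_⟩
      rw [abs_of_nonpos (by linarith)]; linarith
  let l : (Fin 2 → ℂ) →L[ℂ] ℂ := ipCLM q + (Complex.I * ((ε * σ : ℝ) : ℂ)) • ipCLM (T q)
  have hl : ∀ v, l v = ipCLM q v + Complex.I * ((ε * σ : ℝ) : ℂ) * ipCLM (T q) v := fun v => rfl
  have hTq := hT.norm_eq q hq
  have hεσ : |ε * σ| = ε := by rw [abs_mul, hσ, mul_one, abs_of_pos hε]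
  have hnT : 1 ≤ nsq (T q) := by have := sq_norm_le_nsq (T q); rwa [hTq, one_pow] at this
  have him : ε ≤ |(l (T q)).im| := by
    have : (l (T q)).im = (ipCLM q (T q)).im + σ * (ε * nsq (T q)) := by
      rw [hl, ipCLM_self]
      simp
      ring
    rw [this]
    refine le_trans ?_ (hσs _ (by positivity))
    nlinarith
  have hbound : ∀ v, ‖l v‖ ≤ 4 * R * ‖v‖ := by
    intro v
    have h1 := norm_ipCLM_le q v
    have h2 := norm_ipCLM_le (T q) v
    have h3 : ‖l v‖ ≤ ‖ipCLM q v‖ + ε * ‖ipCLM (T q) v‖ := by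
      rw [hl]
      refine (norm_add_le _ _).trans_eq ?_
      rw [norm_mul, norm_mul, Complex.norm_I, one_mul, Complex.norm_real, Real.norm_eq_abs, hεσ]
    rw [hTq] at h2
    have h4 : 2 * ‖q‖ * ‖v‖ ≤ 2 * R * ‖v‖ := by
      have := hSR q hq
      gcongr
    have h5 : ε * ‖ipCLM (T q) v‖ ≤ 1 * (2 * 1 * ‖v‖) := by gcongr
    nlinarith [norm_nonneg v]
  refine ⟨l, ?_, ?_, ?_, hbound⟩
  · intro h0
    rw [h0] at him
    simp at him
    linarith
  · intro z hz
    obtain ⟨κ, hκ⟩ := hT.approx q hq z hz q hq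
    rw [sub_self, norm_zero, add_zero] at hκ
    set e := z - q - (κ : ℂ) • T q with he
    have hze : ipCLM (T q) (z - q) = (κ * nsq (T q) : ℝ) + ipCLM (T q) e := by
      have : ipCLM (T q) e = ipCLM (T q) (z - q) - ipCLM (T q) ((κ : ℂ) • T q) := map_sub _ _ _
      rw [this, map_smul, ipCLM_self]
      push_cast
      rw [smul_eq_mul]
      ring
    have h1 : (l (z - q)).re = (ipCLM q (z - q)).re - ε * σ * (ipCLM (T q) e).im := by
      rw [hl, hze]
      simp
      ring
    have h2 : |ε * σ * (ipCLM (T q) e).im| ≤ ε * (2 * (C * ‖z - q‖ * ‖z - q‖)) := by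
      rw [abs_mul, hεσ]
      have h3 := (Complex.abs_im_le_norm _).trans (norm_ipCLM_le (T q) e)
      rw [hTq] at h3
      gcongr
      linarith
    rw [h1, re_ipCLM_sub]
    have h4 := sq_norm_le_nsq (z - q)
    have h5 := (abs_le.1 h2).1
    have h6 : ε * (2 * (C * ‖z - q‖ * ‖z - q‖)) = 1 / 4 * ‖z - q‖ ^ 2 := by
      linear_combination (1 / 4 * ‖z - q‖ ^ 2) * hεC
    rw [h6] at h5
    linarith
  · intro z hz z' hz' hzq hzq'
    obtain ⟨κ, hκ⟩ := hT.approx q hq z hz z' hz'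
    set e := z - z' - (κ : ℂ) • T q with he
    have hzz : z - z' = (κ : ℂ) • T q + e := by rw [he]; abel
    have h1 : (l (z - z')).im = κ * (l (T q)).im + (l e).im := by
      rw [hzz, map_add, map_smul, Complex.add_im, smul_eq_mul, Complex.im_ofReal_mul]
    have h2 : ‖z - z'‖ ≤ |κ| + ‖e‖ := by
      calc ‖z - z'‖ = ‖(κ : ℂ) • T q + e‖ := by rw [← hzz]
        _ ≤ _ := by
          refine (norm_add_le _ _).trans_eq ?_
          rw [norm_smul, hTq, mul_one, Complex.norm_real, Real.norm_eq_abs]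
    have h3 : |κ| * |(l (T q)).im| - ‖l e‖ ≤ |(l (z - z')).im| := by
      rw [h1, ← abs_mul]
      have := abs_sub_abs_le_abs_sub (κ * (l (T q)).im) (-(l e).im)
      rw [abs_neg, sub_neg_eq_add] at this
      linarith [Complex.abs_im_le_norm (l e)]
    have h4 : ‖e‖ * (10 * R) ≤ ε * ‖z - z'‖ := by
      have h5 : C * (‖z - q‖ + ‖z' - q‖) ≤ ε / (10 * R) := by
        calc C * (‖z - q‖ + ‖z' - q‖) ≤ C * (ε / (20 * C * R) + ε / (20 * C * R)) := by gcongr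
          _ = ε / (10 * R) := by field_simp; norm_num
      have h6 : ‖e‖ ≤ ε / (10 * R) * ‖z - z'‖ := hκ.trans (by gcongr)
      calc ‖e‖ * (10 * R) ≤ ε / (10 * R) * ‖z - z'‖ * (10 * R) := by gcongr
        _ = ε * ‖z - z'‖ := by field_simp
    have h7 := hbound e
    have h8 : |κ| * ε ≤ |κ| * |(l (T q)).im| := by gcongr
    nlinarith [norm_nonneg e, norm_nonneg (z - z')]

end Peaking

end

section

open MeasureTheory Real

section MinimalBad

theorem exists_poly_eq_clm (l : (Fin 2 → ℂ) →L[ℂ] ℂ) (q : Fin 2 → ℂ) :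
    ∃ p : MvPolynomial (Fin 2) ℂ, ∀ z, MvPolynomial.eval z p = l (z - q) := by
  refine ⟨∑ i, MvPolynomial.C (l (Pi.single i 1)) * (MvPolynomial.X i - MvPolynomial.C (q i)),
    fun z => ?_⟩
  conv_rhs => rw [← Finset.univ_sum_single (z - q)]
  rw [map_sum, map_sum]
  refine Finset.sum_congr rfl fun i _ => ?_
  have : (Pi.single i ((z - q) i) : Fin 2 → ℂ) = (z i - q i) • Pi.single i (1 : ℂ) := by
    rw [← Pi.single_smul, smul_eq_mul, mul_one]; rfl
  rw [this, map_smul]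
  simp
  ring

theorem hullOf_singleton {n : ℕ} (q : Fin n → ℂ) : hullOf {q} = {q} := by
  refine Set.Subset.antisymm (fun x hx => ?_) subset_hullOf
  rw [Set.mem_singleton_iff]
  funext i
  obtain ⟨z, rfl, hz⟩ := hx (MvPolynomial.X i - MvPolynomial.C (q i))
  simpa [sub_eq_zero] using hz

theorem hullOf_empty {n : ℕ} : hullOf (∅ : Set (Fin n → ℂ)) = ∅ := by
  ext x; simp [hullOf]

theorem nsq_le_of_mem_hullOf {E : Set (Fin 2 → ℂ)} {y : Fin 2 → ℂ} (hy : y ∈ hullOf E) {s : ℝ}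
    (hs : ∀ z ∈ E, nsq z ≤ s) : nsq y ≤ s := by
  obtain ⟨p, hp⟩ := exists_poly_eq_clm (ipCLM y) 0
  obtain ⟨z, hz, h⟩ := hy p
  rw [hp, hp, sub_zero, sub_zero, ipCLM_self, Complex.norm_real,
    Real.norm_of_nonneg (nsq_nonneg y), ipCLM_apply] at h
  have h2 := norm_add_le (starRingEnd ℂ (y 0) * z 0) (starRingEnd ℂ (y 1) * z 1)
  rw [norm_mul, norm_mul, RCLike.norm_conj, RCLike.norm_conj] at h2
  have h3 : nsq y = ‖y 0‖ ^ 2 + ‖y 1‖ ^ 2 := by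
    rw [nsq, Complex.normSq_eq_norm_sq, Complex.normSq_eq_norm_sq]
  have h4 : nsq z = ‖z 0‖ ^ 2 + ‖z 1‖ ^ 2 := by
    rw [nsq, Complex.normSq_eq_norm_sq, Complex.normSq_eq_norm_sq]
  have := hs z hz
  nlinarith [sq_nonneg (‖y 0‖ - ‖z 0‖), sq_nonneg (‖y 1‖ - ‖z 1‖)]

/-- A real function in the polynomial algebra of a minimal carrier is constant. -/
theorem eq_of_real_of_minimal {n : ℕ} {E Y : Set (Fin n → ℂ)} [CompactSpace E]
    (hY : (hullOf E ∩ Y).Nonempty)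
    (hmin : ∀ E' ⊆ E, IsCompact E' → (hullOf E' ∩ Y).Nonempty → E' = E)
    {u : C(E, ℂ)} (hu : u ∈ polyAlg E) (him : ∀ x, (u x).im = 0) (x y : E) : u x = u y := by
  obtain ⟨w, hw, hwY⟩ := hY
  obtain ⟨χ, rfl⟩ := exists_character_of_mem_hullOf hw
  have h1 := mem_hullOf_of_real χ ⟨u, hu⟩ him
  have hlev : IsCompact {z : E | u z = χ ⟨u, hu⟩} :=
    (isClosed_eq (by fun_prop) continuous_const).isCompact
  have h2 := hmin (Subtype.val '' {z : E | u z = χ ⟨u, hu⟩})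
    (by rintro _ ⟨z, -, rfl⟩; exact z.2) (hlev.image continuous_subtype_val) ⟨_, h1, hwY⟩
  have h3 : ∀ z : E, u z = χ ⟨u, hu⟩ := fun z => by
    obtain ⟨z', hz', h⟩ : z.1 ∈ Subtype.val '' {z : E | u z = χ ⟨u, hu⟩} := by rw [h2]; exact z.2
    rwa [← Subtype.ext h]
  rw [h3, h3]

variable {S : Set (Fin 2 → ℂ)} {T : (Fin 2 → ℂ) → Fin 2 → ℂ} {ρ c L : ℝ} {q : Fin 2 → ℂ}
  {l : (Fin 2 → ℂ) →L[ℂ] ℂ}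

theorem IsPeaking.re_le_of_max (hl : IsPeaking S T ρ c L q l) {E : Set (Fin 2 → ℂ)} (hES : E ⊆ S)
    (hmax : ∀ z ∈ E, nsq z ≤ nsq q) {z : Fin 2 → ℂ} (hz : z ∈ E) :
    (l (z - q)).re ≤ -(1 / 4) * ‖z - q‖ ^ 2 := by
  have := hl.re_le z (hES hz)
  linarith [hmax z hz]

theorem IsPeaking.ne_neg (hl : IsPeaking S T ρ c L q l) (hρ : 0 < ρ) (hc : 0 < c)
    {E : Set (Fin 2 → ℂ)} (hES : E ⊆ S) (hqE : q ∈ E) (hmax : ∀ z ∈ E, nsq z ≤ nsq q)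
    {t : ℝ} (ht : 0 < t) (htδ : t < ρ ^ 2 / 4) {z : Fin 2 → ℂ} (hz : z ∈ E) :
    l (z - q) ≠ -t := by
  intro h
  have h1 := hl.re_le_of_max hES hmax hz
  rw [h, Complex.neg_re, Complex.ofReal_re] at h1
  have h2 : ‖z - q‖ ≤ ρ := (abs_le_of_sq_le_sq' (by linarith) hρ.le).2
  have h3 := hl.im_ge z (hES hz) q (hES hqE) h2 (by simpa using hρ.le)
  rw [h, Complex.neg_im, Complex.ofReal_im, neg_zero, abs_zero] at h3
  have h4 : ‖z - q‖ ≤ 0 := by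
    by_contra! hcon
    have : 0 < c * ‖z - q‖ := by positivity
    linarith
  rw [norm_le_zero_iff.1 h4, map_zero] at h
  have : t = 0 := by simpa using h.symm
  linarith

theorem IsPeaking.exists_real (hl : IsPeaking S T ρ c L q l) (hρ : 0 < ρ) (hc : 0 < c)
    {E : Set (Fin 2 → ℂ)} [CompactSpace E]
    (hES : E ⊆ S) (hqE : q ∈ E) (hmax : ∀ z ∈ E, nsq z ≤ nsq q) {f : C(E, ℂ)}
    (hf : ∀ x, f x = l (x.1 - q)) {B : Subalgebra ℂ C(E, ℂ)} (hB : IsClosed (B : Set C(E, ℂ)))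
    (hfB : f ∈ B) {t : ℝ} (ht : 0 < t) (htδ : t < ρ ^ 2 / 4) (hres : (-t : ℂ) ∈ funResolvent B f) :
    ∃ u ∈ B, (∀ x, (u x).im = 0) ∧ ∀ x, u x = u ⟨q, hqE⟩ → x.1 = q := by
  have hclose : ∀ x : E, -(ρ ^ 2 / 4) < (f x).re → ‖x.1 - q‖ ≤ ρ := by
    intro x hx
    have h1 := hl.re_le_of_max hES hmax x.2
    rw [← hf] at h1
    exact abs_le_of_sq_le_sq' (by linarith) hρ.le |>.2
  obtain ⟨r, hr, hbump⟩ := exists_bumpComp_mem hB hfB (fun x y hx hy hxy => by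
    have h1 := hl.im_ge x.1 (hES x.2) y.1 (hES y.2) (hclose x hx) (hclose y hy)
    have h2 : x.1 - y.1 = (x.1 - q) - (y.1 - q) := by abel
    have h3 : (l (x.1 - y.1)).im = 0 := by
      rw [h2, map_sub, ← hf, ← hf, Complex.sub_im, hxy, sub_self]
    rw [h3, abs_zero] at h1
    have h4 : ‖x.1 - y.1‖ ≤ 0 := by
      by_contra hcon
      push Not at hcon
      have : 0 < c * ‖x.1 - y.1‖ := by positivity
      linarith
    have h5 : x = y := Subtype.ext (sub_eq_zero.1 (norm_le_zero_iff.1 h4))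
    rw [h5]) ht htδ hres
  refine ⟨_, hbump, fun x => Complex.ofReal_im _, fun x hx => ?_⟩
  have hfq : f ⟨q, hqE⟩ = 0 := by rw [hf, sub_self, map_zero]
  have h1 : max 0 (r ^ 2 - ‖f x‖ ^ 2) = max 0 (r ^ 2 - ‖f ⟨q, hqE⟩‖ ^ 2) :=
    Complex.ofReal_injective hx
  rw [hfq, norm_zero] at h1
  have h2 : f x = 0 := by
    have h3 : max 0 (r ^ 2 - (0 : ℝ) ^ 2) = r ^ 2 := by
      rw [max_eq_right] <;> nlinarith
    rw [h3] at h1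
    rcases le_total 0 (r ^ 2 - ‖f x‖ ^ 2) with h | h
    · rw [max_eq_right h] at h1
      have : ‖f x‖ ^ 2 = 0 := by linarith
      simpa using this
    · rw [max_eq_left h] at h1
      have : 0 < r ^ 2 := by positivity
      linarith
  have h4 := hl.re_le_of_max hES hmax x.2
  rw [← hf, h2, Complex.zero_re] at h4
  have h5 : ‖x.1 - q‖ ^ 2 = 0 := le_antisymm (by linarith) (sq_nonneg _)
  simpa [sub_eq_zero] using h5

theorem IsPeaking.notMem_funResolvent (hl : IsPeaking S T ρ c L q l) (hρ : 0 < ρ) (hc : 0 < c)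
    {E Y : Set (Fin 2 → ℂ)} [CompactSpace E]
    (hES : E ⊆ S) (hqE : q ∈ E) (hmax : ∀ z ∈ E, nsq z ≤ nsq q) (hY : (hullOf E ∩ Y).Nonempty)
    (hmin : ∀ E' ⊆ E, IsCompact E' → (hullOf E' ∩ Y).Nonempty → E' = E)
    (hne : E ≠ {q}) {f : C(E, ℂ)} (hf : ∀ x, f x = l (x.1 - q)) (hfB : f ∈ polyAlg E)
    {t : ℝ} (ht : 0 < t) (htδ : t < ρ ^ 2 / 4) : (-t : ℂ) ∉ funResolvent (polyAlg E) f := by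
  intro hres
  obtain ⟨u, hu, him, hsep⟩ := hl.exists_real hρ hc hES hqE hmax hf isClosed_polyAlg hfB ht htδ hres
  refine hne (Set.Subset.antisymm (fun x hx => ?_) (Set.singleton_subset_iff.2 hqE))
  exact hsep ⟨x, hx⟩ (eq_of_real_of_minimal hY hmin hu him _ _)

theorem continuous_nsq : Continuous nsq := by
  unfold nsq
  exact (Complex.continuous_normSq.comp (continuous_apply 0)).add
    (Complex.continuous_normSq.comp (continuous_apply 1))

theorem IsPeaking.dist_le {R : ℝ} (hl : IsPeaking S T ρ c (4 * R) q l) (hρ : 0 < ρ) (hc : 0 < c)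
    (hR : 1 ≤ R) (hSR : ∀ z ∈ S, ‖z‖ ≤ R) (hqS : q ∈ S) {y : Fin 2 → ℂ} (hyq : nsq y ≤ nsq q)
    (hly : l (y - q) = ((-(ρ ^ 2 / 8) : ℝ) : ℂ)) {z : Fin 2 → ℂ} (hz : z ∈ S) :
    ρ ^ 2 / 16 / (4 * R + (4 * R) ^ 2 / c) ≤ ‖y - z‖ := by
  have hden : 0 < 4 * R + (4 * R) ^ 2 / c := by positivity
  rw [div_le_iff₀ hden]
  by_contra! hcon
  set d := ‖y - z‖
  have hd : 0 ≤ d := norm_nonneg _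
  have hsplit : d * (4 * R + (4 * R) ^ 2 / c) = 4 * R * d + (4 * R) * (4 * R * d / c) := by
    field_simp
  rw [hsplit] at hcon
  have hpos : 0 ≤ (4 * R) * (4 * R * d / c) := by positivity
  have h1 : nsq z - nsq y ≤ 4 * R * d := by
    have h2 := re_ipCLM_sub z (y - z + z)
    rw [add_sub_cancel_right, sub_add_cancel] at h2
    have h3 := (abs_le.1 ((Complex.abs_re_le_norm _).trans (norm_ipCLM_le z (y - z)))).1
    have h4 : 2 * ‖z‖ * ‖y - z‖ ≤ 2 * R * d := by
      have := hSR z hz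
      gcongr
    have h5 := nsq_nonneg (y - z)
    linarith
  have h6 : l (z - q) = ((-(ρ ^ 2 / 8) : ℝ) : ℂ) + l (z - y) := by
    rw [← hly, ← map_add]
    congr 1
    abel
  have h7 : ‖l (z - y)‖ ≤ 4 * R * d := by
    have := hl.bound (z - y)
    rwa [norm_sub_rev] at this
  have hre : (l (z - q)).re = -(ρ ^ 2 / 8) + (l (z - y)).re := by
    rw [h6, Complex.add_re, Complex.ofReal_re]
  have him : (l (z - q)).im = (l (z - y)).im := by
    rw [h6, Complex.add_im, Complex.ofReal_im, zero_add]
  have h8 := abs_le.1 ((Complex.abs_re_le_norm _).trans h7)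
  have h9 := hl.re_le z hz
  have hzq : ‖z - q‖ ≤ ρ := by
    refine (abs_le_of_sq_le_sq' ?_ hρ.le).2
    nlinarith [h8.1]
  have h11 := hl.im_ge z hz q hqS hzq (by simpa using hρ.le)
  rw [him] at h11
  have h12 : ‖z - q‖ ≤ 4 * R * d / c := by
    rw [le_div_iff₀ hc]
    linarith [(Complex.abs_im_le_norm _).trans h7]
  have h13 := (abs_le.1 ((Complex.abs_re_le_norm _).trans (hl.bound (z - q)))).1
  have h14 : 4 * R * ‖z - q‖ ≤ 4 * R * (4 * R * d / c) := by gcongr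
  linarith [h8.2]

theorem exists_isMax_nsq {E : Set (Fin 2 → ℂ)} (hE : IsCompact E) (hne : E.Nonempty) :
    ∃ q ∈ E, ∀ z ∈ E, nsq z ≤ nsq q :=
  hE.exists_isMaxOn hne continuous_nsq.continuousOn

/-- If some compact subset of `S` is not polynomially convex, there is a minimal one, and the
peaking functional at its farthest point has a segment of removable spectrum. -/
theorem IsTangentField.exists_minimal_bad {C : ℝ} (hT : IsTangentField S T C) (hS : IsCompact S)
    (hbad : ∃ E ⊆ S, IsCompact E ∧ ¬ hullOf E ⊆ E) :
    ∃ E ⊆ S, ∃ _ : CompactSpace E, (∀ E' ⊆ E, IsCompact E' → E' ≠ E → hullOf E' ⊆ E') ∧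
      E.Nontrivial ∧
      ∃ q, ∃ hqE : q ∈ E, ∃ l : (Fin 2 → ℂ) →L[ℂ] ℂ, ∃ δ > 0, l (T q) ≠ 0 ∧
        (∀ z ∈ E, (l (z - q)).re ≤ -(1 / 4) * ‖z - q‖ ^ 2) ∧
        ∀ f ∈ polyAlg E, (∀ x : E, f x = l (x.1 - q)) → ∀ t : ℝ, 0 < t → t < δ →
          (∀ x, f x ≠ -t) ∧ (-t : ℂ) ∉ funResolvent (polyAlg E) f ∧
          ∀ B : Subalgebra ℂ C(E, ℂ), IsClosed (B : Set C(E, ℂ)) → f ∈ B →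
            (-t : ℂ) ∈ funResolvent B f →
            ∃ u ∈ B, (∀ x, (u x).im = 0) ∧ ∀ x, u x = u ⟨q, hqE⟩ → x.1 = q := by
  obtain ⟨R', hR'⟩ := hS.isBounded.exists_norm_le
  have hT' : IsTangentField S T (max C 1) := ⟨hT.norm_eq, fun q hq z hz z' hz' => by
    obtain ⟨κ, hκ⟩ := hT.approx q hq z hz z' hz'
    refine ⟨κ, hκ.trans ?_⟩
    gcongr
    exact le_max_left _ _⟩
  obtain ⟨ρ, hρ, c, hc, hpeak⟩ := hT'.exists_isPeaking (R := max R' 1) (le_max_right _ _)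
    (le_max_right _ _) (fun z hz => (hR' z hz).trans (le_max_left _ _))
  have hSR : ∀ z ∈ S, ‖z‖ ≤ max R' 1 := fun z hz => (hR' z hz).trans (le_max_left _ _)
  set R := max R' 1 with hRdef
  have hR : 1 ≤ R := le_max_right _ _
  have hd0 : 0 < ρ ^ 2 / 16 / (4 * R + (4 * R) ^ 2 / c) := by positivity
  set d0 := ρ ^ 2 / 16 / (4 * R + (4 * R) ^ 2 / c) with hd0def
  let Y : Set (Fin 2 → ℂ) := {y | ∀ z ∈ S, d0 ≤ ‖y - z‖}
  have hYcl : IsClosed Y := by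
    simp only [Y, Set.ofPred_forall]
    exact isClosed_iInter fun z => isClosed_iInter fun _ => isClosed_le continuous_const (by fun_prop)
  have hdeep : ∀ E ⊆ S, IsCompact E → ¬ hullOf E ⊆ E → (hullOf E ∩ Y).Nonempty := by
    intro E hES hE hbadE
    obtain ⟨x, hx, hxE⟩ := Set.not_subset.1 hbadE
    obtain ⟨D, hDE, hD, hne, hmin⟩ := exists_minimal_carrier (Y := {x}) isClosed_singleton hE
      ⟨x, hx, rfl⟩
    have hxD : x ∈ hullOf D := by
      obtain ⟨y, hy, rfl⟩ := hne; exact hy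
    have hDne : D.Nonempty := by
      rw [Set.nonempty_iff_ne_empty]
      rintro rfl
      rw [hullOf_empty] at hxD
      exact hxD
    obtain ⟨q, hq, hmax⟩ := exists_isMax_nsq hD hDne
    obtain ⟨l, hl⟩ := hpeak q (hES (hDE hq))
    have hDq : D ≠ {q} := by
      intro h
      rw [h, hullOf_singleton] at hxD
      rw [Set.mem_singleton_iff.1 hxD] at hxE
      exact hxE (hDE hq)
    have := isCompact_iff_compactSpace.1 hD
    obtain ⟨p, hp⟩ := exists_poly_eq_clm l q
    have hnot := hl.notMem_funResolvent hρ hc (hDE.trans hES) hq hmax hne hmin hDq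
      (f := polyOn D p) (fun x => by rw [polyOn_apply, hp]) (polyOn_mem p) (t := ρ ^ 2 / 8)
      (by positivity) (by nlinarith)
    obtain ⟨χ, hχ⟩ := exists_character_of_notMem_funResolvent isClosed_polyAlg (polyOn_mem p) hnot
    rw [character_polyOn, hp] at hχ
    have hy := charPoint_mem_hullOf χ
    refine ⟨charPoint χ, hullOf_mono hDE hy, fun z hz => ?_⟩
    exact hl.dist_le hρ hc hR hSR (hES (hDE hq)) (nsq_le_of_mem_hullOf hy hmax)
      (by rw [hχ]; push_cast; ring) hz
  obtain ⟨E₀, hE₀S, hE₀, hE₀bad⟩ := hbad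
  obtain ⟨E, hEE₀, hE, hne, hmin⟩ := exists_minimal_carrier hYcl hE₀ (hdeep E₀ hE₀S hE₀ hE₀bad)
  have hES := hEE₀.trans hE₀S
  have hYE : ∀ y ∈ Y, y ∉ E := fun y hy hyE => by
    have := hy y (hES hyE)
    rw [sub_self, norm_zero] at this
    linarith
  have hEne : E.Nonempty := by
    rw [Set.nonempty_iff_ne_empty]
    rintro rfl
    rw [hullOf_empty, Set.empty_inter] at hne
    exact Set.not_nonempty_empty hne
  obtain ⟨q, hq, hmax⟩ := exists_isMax_nsq hE hEne
  obtain ⟨l, hl⟩ := hpeak q (hES hq)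
  have hEq : E ≠ {q} := by
    intro h
    obtain ⟨y, hy, hyY⟩ := hne
    rw [h, hullOf_singleton, ← h] at hy
    exact hYE y hyY hy
  have hcs := isCompact_iff_compactSpace.1 hE
  refine ⟨E, hES, hcs, ?_, ?_, q, hq, l, ρ ^ 2 / 4, by positivity, hl.map_T,
    fun z hz => hl.re_le_of_max hES hmax hz, ?_⟩
  · intro E' hE' hE'c hE'ne
    by_contra hcon
    exact hE'ne (hmin E' hE' hE'c (hdeep E' (hE'.trans hES) hE'c hcon))
  · by_contra hcon
    rw [Set.not_nontrivial_iff] at hcon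
    exact hEq (hcon.eq_singleton_of_mem hq)
  · intro f hf hfl t ht htδ
    exact ⟨fun x => hfl x ▸ hl.ne_neg hρ hc hES hq hmax ht htδ x.2, hl.notMem_funResolvent hρ hc hES hq hmax hne hmin hEq hfl hf ht htδ,
      fun B hB hfB hres => hl.exists_real hρ hc hES hq hmax hfl hB hfB ht htδ hres⟩

end MinimalBad

end

section

open MeasureTheory Real

section HolFamily
variable {X : Type*} [TopologicalSpace X] [CompactSpace X]

theorem differentiableOn_of_eval {r : ℝ} {g : ℂ → C(X, ℂ)}
    (hg : ContinuousOn g (Metric.ball 0 r))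
    (hd : ∀ x, DifferentiableOn ℂ (fun l => g l x) (Metric.ball 0 r)) :
    DifferentiableOn ℂ g (Metric.ball 0 r) := by
  intro w hw
  rw [mem_ball_zero_iff] at hw
  obtain ⟨s, hws, hsr⟩ := exists_between hw
  have hs : 0 < s := (norm_nonneg w).trans_lt hws
  lift s to NNReal using hs.le
  have hsub : Metric.closedBall (0 : ℂ) s ⊆ Metric.ball 0 r := Metric.closedBall_subset_ball hsr
  have hci : CircleIntegrable g 0 s :=
    (hg.mono ((Metric.sphere_subset_closedBall).trans hsub)).circleIntegrable hs.le
  have hps := hasFPowerSeriesOn_cauchy_integral (R := s) hci (by exact_mod_cast hs)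
  have heq : ∀ v ∈ Metric.ball (0 : ℂ) s,
      (2 * π * Complex.I : ℂ)⁻¹ • ∮ z in C(0, s), (z - v)⁻¹ • g z = g v := by
    intro v hv
    ext x
    have hInt : CircleIntegrable (fun z => (z - v)⁻¹ • g z) 0 s := by
      refine ContinuousOn.circleIntegrable hs.le ?_
      refine ContinuousOn.smul (((continuous_id.sub continuous_const).continuousOn).inv₀ fun z hz => ?_)
        (hg.mono ((Metric.sphere_subset_closedBall).trans hsub))
      rintro h0
      rw [show z = v from sub_eq_zero.1 h0, mem_sphere_zero_iff_norm] at hz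
      rw [mem_ball_zero_iff] at hv
      linarith
    have hcomm : (∮ z in C(0, s), (z - v)⁻¹ • g z) x = ∮ z in C(0, s), (z - v)⁻¹ • g z x := by
      have h1 := (ContinuousMap.evalCLM ℂ x : C(X, ℂ) →L[ℂ] ℂ).intervalIntegral_comp_comm hInt.out
      exact h1.symm
    have h2 := (DifferentiableOn.diffContOnCl_ball (hd x) hsub).two_pi_i_inv_smul_circleIntegral_sub_inv_smul hv
    rw [ContinuousMap.smul_apply, hcomm, h2]
  have hmem : w ∈ Metric.ball (0 : ℂ) s := by rwa [mem_ball_zero_iff]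
  have hw' : w ∈ Metric.eball (0 : ℂ) (s : ENNReal) := by
    rw [Metric.eball_coe]; exact hmem
  have h3 := (hps.analyticAt_of_mem hw').differentiableAt
  refine (h3.congr_of_eventuallyEq ?_).differentiableWithinAt
  filter_upwards [Metric.isOpen_ball.mem_nhds hmem] with v hv
  exact (heq v hv).symm

open Classical in
/-- A holomorphic family in `C(X, ℂ)` that meets a closed subspace often enough stays in it. -/
theorem exists_mem_of_frequently {r : ℝ} (hr : 0 < r) {G : ℂ → X → ℂ}
    (hG : ContinuousOn (Function.uncurry G) (Metric.ball 0 r ×ˢ Set.univ))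
    (hd : ∀ x, DifferentiableOn ℂ (fun l => G l x) (Metric.ball 0 r))
    {A : Submodule ℂ C(X, ℂ)} (hA : IsClosed (A : Set C(X, ℂ)))
    (hfreq : ∃ᶠ l in nhdsWithin (0 : ℂ) {0}ᶜ, ∃ g ∈ A, ∀ x, g x = G l x) :
    ∀ l ∈ Metric.ball (0 : ℂ) r, ∃ g ∈ A, ∀ x, g x = G l x := by
  let Gc : C(Metric.ball (0 : ℂ) r × X, ℂ) := ⟨fun p => G p.1.1 p.2,
    hG.comp_continuous (f := fun p : Metric.ball (0 : ℂ) r × X => (p.1.1, p.2)) (by fun_prop)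
      fun p => ⟨p.1.2, trivial⟩⟩
  let g : ℂ → C(X, ℂ) := fun l => if h : l ∈ Metric.ball (0 : ℂ) r then Gc.curry ⟨l, h⟩ else 0
  have hgG : ∀ l ∈ Metric.ball (0 : ℂ) r, ∀ x, g l x = G l x := by
    intro l hl x
    simp only [g, dif_pos hl]
    rfl
  have hgc : ContinuousOn g (Metric.ball 0 r) := by
    rw [continuousOn_iff_continuous_domRestrict]
    have : (Metric.ball (0 : ℂ) r).domRestrict g = Gc.curry := by
      funext l
      simp only [Set.domRestrict_apply, g, dif_pos l.2]
    rw [this]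
    exact Gc.curry.continuous
  have hgd := differentiableOn_of_eval hgc fun x =>
    (hd x).congr fun l hl => hgG l hl x
  have hfreq' : ∃ᶠ l in nhdsWithin (0 : ℂ) {0}ᶜ, g l ∈ A := by
    refine (hfreq.and_eventually (mem_nhdsWithin_of_mem_nhds (Metric.ball_mem_nhds 0 hr))).mono ?_
    rintro l ⟨⟨g', hg', h⟩, hl⟩
    have : g l = g' := by ext x; rw [hgG l hl, h]
    rwa [this]
  intro l hl
  refine ⟨g l, ?_, hgG l hl⟩
  refine Submodule.mem_of_forall_dual_eq_zero A hA fun L hL => ?_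
  have han : AnalyticOnNhd ℂ (fun l => L (g l)) (Metric.ball 0 r) :=
    DifferentiableOn.analyticOnNhd (L.differentiable.comp_differentiableOn hgd) Metric.isOpen_ball
  exact han.eqOn_zero_of_preconnected_of_frequently_eq_zero (convex_ball _ _).isPreconnected
    (Metric.mem_ball_self hr) (hfreq'.mono fun l hl => hL _ hl) hl

end HolFamily

theorem continuousAt_dslope_diag {g : ℂ → ℂ} {U : Set ℂ} (hU : IsOpen U)
    (hg : DifferentiableOn ℂ g U) {a : ℂ} (ha : a ∈ U) :
    ContinuousAt (fun p : ℂ × ℂ => dslope g p.1 p.2) (a, a) := by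
  have han := hg.analyticAt (hU.mem_nhds ha)
  have hs := han.hasStrictDerivAt
  have hdc : ContinuousAt (deriv g) a := han.deriv.continuousAt
  rw [Metric.continuousAt_iff']
  intro ε hε
  have h1 := (hasStrictFDerivAt_iff_isLittleO.1 hs.hasStrictFDerivAt).bound (half_pos hε)
  have h2 : ∀ᶠ p : ℂ × ℂ in nhds (a, a), dist (deriv g p.1) (deriv g a) < ε :=
    (Metric.continuousAt_iff'.1 (hdc.comp (x := (a, a)) (f := Prod.fst) continuousAt_fst)) ε hε
  filter_upwards [h1, h2] with p hp hp2
  rw [dslope_same]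
  by_cases h : p.2 = p.1
  · rw [h, dslope_same]; exact hp2
  · rw [dslope_of_ne _ h, slope_def_field, dist_eq_norm]
    have hne : p.2 - p.1 ≠ 0 := sub_ne_zero.2 h
    have hpos : 0 < ‖p.2 - p.1‖ := norm_pos_iff.2 hne
    have h3 : (g p.2 - g p.1) / (p.2 - p.1) - deriv g a =
        -(g p.1 - g p.2 - (p.1 - p.2) * deriv g a) / (p.2 - p.1) := by
      field_simp
      ring
    rw [h3, norm_div, norm_neg, div_lt_iff₀ hpos]
    have h4 : ‖g p.1 - g p.2 - (p.1 - p.2) * deriv g a‖ ≤ ε / 2 * ‖p.2 - p.1‖ := by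
      rw [norm_sub_rev p.2]
      simpa using hp
    nlinarith

end

section

open MeasureTheory Real

/-- Along a level set of `h`, points are holomorphic functions of a transverse linear functional. -/
theorem exists_level_parametrization {h : (Fin 2 → ℂ) → ℂ} {q τ : Fin 2 → ℂ}
    (hh : ContDiffAt ℂ 1 h q) {l : (Fin 2 → ℂ) →L[ℂ] ℂ} (hlτ : l τ ≠ 0)
    (hτ : fderiv ℂ h q τ = 0) (hne : fderiv ℂ h q ≠ 0) :
    ∃ r > 0, ∃ γ : ℂ → Fin 2 → ℂ, ∃ s > 0, DifferentiableOn ℂ γ (Metric.ball 0 r) ∧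
      ∀ z, h z = h q → ‖z - q‖ < s → γ (l (z - q)) = z := by
  let F : (Fin 2 → ℂ) → ℂ × ℂ := fun z => (l (z - q), h z)
  have hF : ContDiffAt ℂ 1 F q :=
    (l.contDiff.contDiffAt.comp q (contDiffAt_id.sub contDiffAt_const)).prodMk hh
  let F' : (Fin 2 → ℂ) →L[ℂ] ℂ × ℂ := l.prod (fderiv ℂ h q)
  have hF' : HasFDerivAt F F' q := by
    refine HasFDerivAt.prodMk ?_ (hh.differentiableAt (by norm_num)).hasFDerivAt
    have h1 : HasFDerivAt (fun z => l z - l q) l q := l.hasFDerivAt.sub_const _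
    refine h1.congr_of_eventuallyEq (Filter.Eventually.of_forall fun z => map_sub l z q)
  obtain ⟨w, hw⟩ : ∃ w, fderiv ℂ h q w ≠ 0 := by
    by_contra! hcon
    exact hne (ContinuousLinearMap.ext hcon)
  have hsurj : Function.Surjective (F' : (Fin 2 → ℂ) →ₗ[ℂ] ℂ × ℂ) := by
    rintro ⟨a, b⟩
    refine ⟨(b / fderiv ℂ h q w) • w + ((a - b / fderiv ℂ h q w * l w) / l τ) • τ, ?_⟩
    refine Prod.ext ?_ ?_
    · change l _ = a
      rw [map_add, map_smul, map_smul, smul_eq_mul, smul_eq_mul, div_mul_cancel₀ _ hlτ]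
      ring
    · change fderiv ℂ h q _ = b
      rw [map_add, map_smul, map_smul, hτ, smul_zero, add_zero, smul_eq_mul, div_mul_cancel₀ _ hw]
  have hinj : Function.Injective (F' : (Fin 2 → ℂ) →ₗ[ℂ] ℂ × ℂ) :=
    (LinearMap.injective_iff_surjective_of_finrank_eq_finrank (by simp)).2 hsurj
  let e : (Fin 2 → ℂ) ≃L[ℂ] ℂ × ℂ :=
    (LinearEquiv.ofBijective (F' : (Fin 2 → ℂ) →ₗ[ℂ] ℂ × ℂ) ⟨hinj, hsurj⟩).toContinuousLinearEquiv
  have hFe : HasFDerivAt F (e : (Fin 2 → ℂ) →L[ℂ] ℂ × ℂ) q := hF'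
  have hFq : F q = (0, h q) := by simp [F]
  have hg := hF.to_localInverse hFe (by norm_num)
  have hleft := (hF.hasStrictFDerivAt' hFe (by norm_num)).eventually_left_inverse
  set g := hF.localInverse hFe (by norm_num) with hgdef
  rw [hFq] at hg
  have hγ : ContDiffAt ℂ 1 (fun a : ℂ => g (a, h q)) 0 :=
    hg.comp (0 : ℂ) (contDiffAt_id.prodMk contDiffAt_const)
  obtain ⟨u, hu, hud⟩ := hγ.contDiffOn (m := 1) le_rfl (by simp)
  obtain ⟨r, hr, hru⟩ := Metric.mem_nhds_iff.1 hu
  obtain ⟨s, hs, hsl⟩ := Metric.eventually_nhds_iff.1 hleft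
  refine ⟨r, hr, _, s, hs, (hud.differentiableOn (by norm_num)).mono hru, fun z hz hzs => ?_⟩
  have := hsl (y := z) (by rwa [dist_eq_norm])
  rw [← hz]
  exact this

/-- Approximation by polynomials on a part of `E` which is polynomially convex. -/
theorem exists_mem_polyAlg_near {n : ℕ} {E : Set (Fin n → ℂ)} [CompactSpace E]
    {F : Set E} (hnull : ∀ i, volume ((fun z : Fin n → ℂ => z i) '' (Subtype.val '' F)) = 0)
    (hF : IsClosed F)
    (hh : hullOf (Subtype.val '' F) ⊆ Subtype.val '' F) (φ : C(E, ℂ)) {ε : ℝ} (hε : 0 < ε) :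
    ∃ a ∈ polyAlg E, ∀ x ∈ F, ‖a x - φ x‖ < ε := by
  set F' : Set (Fin n → ℂ) := Subtype.val '' F
  have hF'E : F' ⊆ E := by rintro _ ⟨z, -, rfl⟩; exact z.2
  have : CompactSpace F' :=
    isCompact_iff_compactSpace.1 (hF.isCompact.image continuous_subtype_val)
  have htop : polyAlg F' = ⊤ :=
    polyAlg_eq_top hh hnull
  let ψ : C(F', ℂ) := ⟨fun x => φ ⟨x.1, hF'E x.2⟩, by fun_prop⟩
  obtain ⟨p, hp⟩ := exists_poly_of_mem (g := ψ) (by rw [htop]; trivial) hε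
  refine ⟨polyOn E p, polyOn_mem p, fun x hx => ?_⟩
  have h1 := ((ψ - polyOn F' p).norm_coe_le_norm ⟨x.1, x, hx, rfl⟩).trans_lt hp
  rw [norm_sub_rev]
  simpa [ψ] using h1

section Localize
variable {X : Type*} [TopologicalSpace X]

/-- The functions that land in `B` after multiplication by a power of `b`. -/
def Subalgebra.colon (B : Subalgebra ℂ C(X, ℂ)) {b : C(X, ℂ)} (hb : b ∈ B) :
    Subalgebra ℂ C(X, ℂ) where
  carrier := {g | ∃ k : ℕ, b ^ k * g ∈ B}
  mul_mem' := by
    rintro x y ⟨j, hj⟩ ⟨k, hk⟩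
    exact ⟨j + k, by rw [pow_add, mul_mul_mul_comm]; exact B.mul_mem hj hk⟩
  add_mem' := by
    rintro x y ⟨j, hj⟩ ⟨k, hk⟩
    refine ⟨j + k, ?_⟩
    have : b ^ (j + k) * (x + y) = b ^ k * (b ^ j * x) + b ^ j * (b ^ k * y) := by ring
    rw [this]
    exact B.add_mem (B.mul_mem (B.pow_mem hb _) hj) (B.mul_mem (B.pow_mem hb _) hk)
  algebraMap_mem' c := ⟨0, by rw [pow_zero, one_mul]; exact B.algebraMap_mem c⟩

theorem Subalgebra.le_colon (B : Subalgebra ℂ C(X, ℂ)) {b : C(X, ℂ)} (hb : b ∈ B) :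
    B ≤ B.colon hb := fun x hx => ⟨0, by rwa [pow_zero, one_mul]⟩

theorem Subalgebra.mem_colon_of_mul_eq_one (B : Subalgebra ℂ C(X, ℂ)) {b g : C(X, ℂ)} (hb : b ∈ B)
    (hg : b * g = 1) : g ∈ B.colon hb := ⟨1, by rw [pow_one, hg]; exact B.one_mem⟩

end Localize

end

section

open MeasureTheory Real

section Slope
variable {X : Type*} [TopologicalSpace X] [CompactSpace X] {B : Subalgebra ℂ C(X, ℂ)}

/-- If `g` is a holomorphic function of `f` where `f` is small and `f` takes values in the left
half plane, then `f - l` divides `g - γ l` in `B` for all small `l`. -/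
theorem exists_mem_mul_eq_sub (hB : IsClosed (B : Set C(X, ℂ))) {f g : C(X, ℂ)} (hf : f ∈ B)
    (hg : g ∈ B) (hre : ∀ x, (f x).re ≤ 0) {r : ℝ} (hr : 0 < r) {γ : ℂ → ℂ}
    (hγ : DifferentiableOn ℂ γ (Metric.ball 0 r)) (hgγ : ∀ x, ‖f x‖ < r → γ (f x) = g x) :
    ∀ l ∈ Metric.ball (0 : ℂ) r, ∃ d ∈ B, ∀ x, (f x - l) * d x = g x - γ l := by
  classical
  let G : ℂ → X → ℂ := fun l x => if f x = l then deriv γ l else (g x - γ l) / (f x - l)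
  have hGd : ∀ l x, ‖f x‖ < r → G l x = dslope γ l (f x) := by
    intro l x hx
    by_cases h : f x = l
    · simp only [G, if_pos h, h, dslope_same]
    · simp only [G, if_neg h]
      rw [dslope_of_ne _ h, slope_def_field, hgγ x hx]
  have hGd' : ∀ l x, ‖f x‖ < r → G l x = dslope γ (f x) l := by
    intro l x hx
    rw [hGd l x hx]
    by_cases h : f x = l
    · rw [h]
    · rw [dslope_of_ne _ h, dslope_of_ne _ (Ne.symm h), slope_comm]
  have hGc : ContinuousOn (Function.uncurry G) (Metric.ball 0 r ×ˢ Set.univ) := by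
    rintro ⟨l, x⟩ ⟨hl, -⟩
    refine ContinuousAt.continuousWithinAt ?_
    have hl' : l ∈ Metric.ball (0 : ℂ) r := hl
    by_cases h : f x = l
    · have hxr : ‖f x‖ < r := by rw [h]; exact mem_ball_zero_iff.1 hl'
      have h1 : ContinuousAt (fun p : ℂ × X => dslope γ p.1 (f p.2)) (l, x) := by
        have := continuousAt_dslope_diag Metric.isOpen_ball hγ hl'
        have h2 : ContinuousAt (fun p : ℂ × X => (p.1, f p.2)) (l, x) := by fun_prop
        refine ContinuousAt.comp (f := fun p : ℂ × X => (p.1, f p.2))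
          (g := fun p : ℂ × ℂ => dslope γ p.1 p.2) ?_ h2
        change ContinuousAt _ (l, f x)
        rw [h]
        exact this
      refine h1.congr ?_
      have hc : Continuous (fun p : ℂ × X => ‖f p.2‖) := by fun_prop
      filter_upwards [hc.continuousAt.eventually_lt continuousAt_const hxr] with p hp
      exact (hGd p.1 p.2 hp).symm
    · have hγc : ContinuousAt γ l :=
        (hγ.differentiableAt (Metric.isOpen_ball.mem_nhds hl')).continuousAt
      have h1 : ContinuousAt (fun p : ℂ × X => (g p.2 - γ p.1) / (f p.2 - p.1)) (l, x) := by
        refine ContinuousAt.div ?_ (by fun_prop) (sub_ne_zero.2 h)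
        refine ContinuousAt.sub (by fun_prop) ?_
        exact ContinuousAt.comp (f := fun p : ℂ × X => p.1) (g := γ) hγc continuousAt_fst
      refine h1.congr ?_
      have hc : Continuous (fun p : ℂ × X => f p.2 - p.1) := by fun_prop
      filter_upwards [hc.continuousAt.eventually_ne (sub_ne_zero.2 h)] with p hp
      simp only [Function.uncurry, G, if_neg (sub_ne_zero.1 hp)]
  have hGh : ∀ x, DifferentiableOn ℂ (fun l => G l x) (Metric.ball 0 r) := by
    intro x
    by_cases hx : ‖f x‖ < r
    · refine DifferentiableOn.congr ?_ fun l _ => hGd' l x hx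
      exact (Complex.differentiableOn_dslope (Metric.isOpen_ball.mem_nhds (mem_ball_zero_iff.2 hx))).2 hγ
    · have hne : ∀ l ∈ Metric.ball (0 : ℂ) r, f x ≠ l := by
        rintro l hl rfl
        exact hx (mem_ball_zero_iff.1 hl)
      refine DifferentiableOn.congr (f := fun l => (g x - γ l) / (f x - l)) ?_ fun l hl => by
        simp only [G, if_neg (hne l hl)]
      exact ((differentiableOn_const _).sub hγ).div ((differentiableOn_const _).sub differentiableOn_id)
        fun l hl => sub_ne_zero.2 (hne l hl)
  have hfreq : ∃ᶠ l in nhdsWithin (0 : ℂ) {0}ᶜ, ∃ d ∈ Subalgebra.toSubmodule B, ∀ x, d x = G l x := by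
    rw [Filter.frequently_iff]
    intro U hU
    obtain ⟨ε, hε, hεU⟩ := Metric.mem_nhdsWithin_iff.1 hU
    have hne0 : ((ε / 2 : ℝ) : ℂ) ≠ 0 := by exact_mod_cast (half_pos hε).ne'
    have hne : ∀ t : ℝ, 0 ≤ t → ∀ x, f x ≠ ((ε / 2 : ℝ) : ℂ) + t := by
      intro t ht x hx
      have := hre x
      rw [hx, Complex.add_re, Complex.ofReal_re, Complex.ofReal_re] at this
      linarith
    refine ⟨((ε / 2 : ℝ) : ℂ), hεU ⟨?_, hne0⟩, ?_⟩
    · rw [mem_ball_zero_iff, Complex.norm_real, Real.norm_eq_abs, abs_of_pos (half_pos hε)]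
      linarith
    · obtain ⟨k, hk, hk1⟩ := mem_funResolvent_of_ray hB hf hne
      have hne0 : ∀ x, f x ≠ ((ε / 2 : ℝ) : ℂ) := fun x => by simpa using hne 0 le_rfl x
      refine ⟨(g - algebraMap ℂ C(X, ℂ) (γ ((ε / 2 : ℝ) : ℂ))) * k,
        B.mul_mem (B.sub_mem hg (B.algebraMap_mem _)) hk, fun x => ?_⟩
      simp only [G, if_neg (hne0 x)]
      rw [eq_div_iff (sub_ne_zero.2 (hne0 x))]
      change (g x - γ _) * k x * _ = _
      rw [mul_assoc, mul_comm (k x), hk1 x, mul_one]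
  intro l hl
  obtain ⟨d, hd, hdG⟩ := exists_mem_of_frequently hr hGc hGh (A := Subalgebra.toSubmodule B) hB hfreq l hl
  refine ⟨d, hd, fun x => ?_⟩
  rw [hdG]
  by_cases h : f x = l
  · have := hgγ x (by rw [h]; exact mem_ball_zero_iff.1 hl)
    rw [← this, h, sub_self, sub_self, zero_mul]
  · simp only [G, if_neg h]
    rw [mul_div_cancel₀ _ (sub_ne_zero.2 h)]

end Slope

section Codim
variable {n : ℕ} {E : Set (Fin n → ℂ)} [CompactSpace E]

/-- If `b` divides the coordinates up to constants, it divides every element up to constants. -/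
theorem exists_eq_mul_add_algebraMap {b : polyAlg E} (hb : ∀ x, b.1 x ≠ 0)
    (hX : ∀ i, ∃ c : ℂ, ∃ d ∈ polyAlg E, ∀ x : E, b.1 x * d x = x.1 i - c) (c : polyAlg E) :
    ∃ (d : polyAlg E) (t : ℂ), c = b * d + algebraMap ℂ (polyAlg E) t := by
  let S : Subalgebra ℂ (polyAlg E) :=
    { carrier := {c | ∃ (d : polyAlg E) (t : ℂ), c = b * d + algebraMap ℂ (polyAlg E) t}
      mul_mem' := by
        rintro _ _ ⟨d, t, rfl⟩ ⟨d', t', rfl⟩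
        refine ⟨b * d * d' + d * algebraMap ℂ (polyAlg E) t' + d' * algebraMap ℂ (polyAlg E) t,
          t * t', ?_⟩
        rw [map_mul]
        ring
      add_mem' := by
        rintro _ _ ⟨d, t, rfl⟩ ⟨d', t', rfl⟩
        exact ⟨d + d', t + t', by rw [map_add]; ring⟩
      algebraMap_mem' := fun t => ⟨0, t, by rw [mul_zero, zero_add]⟩ }
  have hcl : IsClosed (S : Set (polyAlg E)) := by
    have h1 := isClosed_range_mulLeft isClosed_polyAlg hb
    have h2 := Submodule.isClosed_sup_finiteDimensional (𝕜 := ℂ)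
      (LinearMap.range (LinearMap.mulLeft ℂ b)) (Submodule.span ℂ {(1 : polyAlg E)}) h1
    convert h2 using 1
    ext x
    simp only [SetLike.mem_coe, Submodule.mem_sup, LinearMap.mem_range, LinearMap.mulLeft_apply,
      Submodule.mem_span_singleton]
    constructor
    · rintro ⟨d, t, rfl⟩
      exact ⟨_, ⟨d, rfl⟩, _, ⟨t, rfl⟩, by rw [Algebra.algebraMap_eq_smul_one]⟩
    · rintro ⟨_, ⟨d, rfl⟩, _, ⟨t, rfl⟩, rfl⟩
      exact ⟨d, t, by rw [Algebra.algebraMap_eq_smul_one]⟩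
  have hcl' : IsClosed ((S.map (polyAlg E).val : Subalgebra ℂ C(E, ℂ)) : Set C(E, ℂ)) := by
    exact (isClosed_polyAlg (E := E)).isClosedEmbedding_subtypeVal.isClosedMap _ hcl
  have hle : polyAlg E ≤ S.map (polyAlg E).val := by
    refine polyAlg_le hcl' fun i => ?_
    obtain ⟨c, d, hd, h⟩ := hX i
    refine ⟨⟨polyOn E (MvPolynomial.X i), polyOn_mem _⟩, ⟨⟨d, hd⟩, c, ?_⟩, rfl⟩
    apply Subtype.ext
    ext x
    have h1 : (polyOn E (MvPolynomial.X i)) x = x.1 i := by simp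
    have h2 : b.1 x * d x + c = x.1 i := by rw [h x]; ring
    exact h1.trans h2.symm
  obtain ⟨c', hc', h⟩ := hle c.2
  have : c' = c := Subtype.ext h
  rwa [← this]

end Codim

end

section

open MeasureTheory Real

section Flat
variable {S : Set (Fin 2 → ℂ)} {T : (Fin 2 → ℂ) → Fin 2 → ℂ}

/-- Compact subsets of a totally real slice of a level set of `h` are polynomially convex. -/
theorem IsTangentField.hullOf_subset {C : ℝ} (hT : IsTangentField S T C) (hS : IsCompact S)
    {h : (Fin 2 → ℂ) → ℂ} {c : ℂ} (hc : ∀ q ∈ S, h q = c)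
    (hh : ∀ q ∈ S, ContDiffAt ℂ 1 h q ∧ fderiv ℂ h q (T q) = 0 ∧ fderiv ℂ h q ≠ 0)
    (hnull : ∀ i, volume ((fun z : Fin 2 → ℂ => z i) '' S) = 0)
    (hsqrt : ∀ E ⊆ S, IsCompact E → ∀ g : C(E, ℂ), (∀ x, g x ≠ 0) → ∃ β : C(E, ℂ), β * β = g)
    {E : Set (Fin 2 → ℂ)} (hES : E ⊆ S) (hE : IsCompact E) : hullOf E ⊆ E := by
  by_contra hbadE
  obtain ⟨E, hES, _, hmin, hnt, q, hqE, l, δ, hδ, hlT, hre, hmain⟩ :=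
    hT.exists_minimal_bad hS ⟨E, hES, hE, hbadE⟩
  have hEc : IsCompact E := isCompact_iff_compactSpace.2 ‹_›
  have hnullE : ∀ i, volume ((fun z : Fin 2 → ℂ => z i) '' E) = 0 := fun i =>
    measure_mono_null (Set.image_mono hES) (hnull i)
  obtain ⟨hq1, hq2, hq3⟩ := hh q (hES hqE)
  obtain ⟨r, hr, γ, s, hs, hγd, hγ⟩ := exists_level_parametrization hq1 hlT hq2 hq3
  obtain ⟨p, hp⟩ := exists_poly_eq_clm l q
  have hf : ∀ x : E, polyOn E p x = l (x.1 - q) := fun x => by rw [polyOn_apply, hp]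
  have hfA := polyOn_mem (E := E) p
  have hfre : ∀ x : E, (polyOn E p x).re ≤ 0 := fun x => by
    rw [hf]
    nlinarith [hre x.1 x.2, sq_nonneg ‖x.1 - q‖]
  set r0 := min r (s ^ 2 / 4) with hr0
  have hr0p : 0 < r0 := by positivity
  have hsmall : ∀ x : E, ‖polyOn E p x‖ < r0 → γ (polyOn E p x) = x.1 := by
    intro x hx
    rw [hf] at hx ⊢
    refine hγ x.1 ((hc _ (hES x.2)).trans (hc _ (hES hqE)).symm) ?_
    have h1 := Complex.abs_re_le_norm (l (x.1 - q))
    have h2 := hre x.1 x.2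
    have h3 := neg_abs_le (l (x.1 - q)).re
    have h4 := hx.trans_le (min_le_right _ _)
    have h5 : ‖x.1 - q‖ ^ 2 < s ^ 2 := by linarith
    exact lt_of_pow_lt_pow_left₀ 2 hs.le h5
  obtain ⟨t, ht0, ht⟩ := exists_between (lt_min hr0p hδ)
  obtain ⟨hne, hnres, hreal⟩ := hmain _ hfA hf t ht0 (ht.trans_le (min_le_right _ _))
  have htb : (-t : ℂ) ∈ Metric.ball (0 : ℂ) r0 := by
    rw [mem_ball_zero_iff, norm_neg, Complex.norm_real, Real.norm_eq_abs, abs_of_pos ht0]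
    exact ht.trans_le (min_le_left _ _)
  have hbA : polyOn E p - algebraMap ℂ C(E, ℂ) (-t) ∈ polyAlg E :=
    (polyAlg E).sub_mem hfA ((polyAlg E).algebraMap_mem _)
  set b : C(E, ℂ) := polyOn E p - algebraMap ℂ C(E, ℂ) (-t) with hbdef
  have hbx : ∀ x, b x = polyOn E p x - (-t) := fun x => rfl
  have hb0 : ∀ x, b x ≠ 0 := fun x => by rw [hbx]; exact sub_ne_zero.2 (hne x)
  have hX : ∀ i, ∃ c : ℂ, ∃ d ∈ polyAlg E, ∀ x : E, b x * d x = x.1 i - c := by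
    intro i
    have hγi : DifferentiableOn ℂ (fun w => γ w i) (Metric.ball 0 r0) := fun w hw =>
      (differentiableWithinAt_pi.1
        ((hγd.mono (Metric.ball_subset_ball (min_le_left _ _))) w hw)) i
    obtain ⟨d, hd, h⟩ := exists_mem_mul_eq_sub isClosed_polyAlg hfA
      (polyOn_mem (E := E) (MvPolynomial.X i)) hfre hr0p hγi (fun x hx => by
        rw [hsmall x hx]; simp) (-t) htb
    refine ⟨γ (-t) i, d, hd, fun x => ?_⟩
    rw [hbx, h x]
    simp
  have hb1 := exists_eq_mul_add_algebraMap (b := ⟨b, hbA⟩) hb0 hX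
  have hb2 : ¬ IsUnit (⟨b, hbA⟩ : polyAlg E) := by
    intro hu
    obtain ⟨v, hv⟩ := hu.exists_right_inv
    refine hnres ⟨v.1, v.2, fun x => ?_⟩
    have := congrArg (fun w : polyAlg E => w.1 x) hv
    exact this
  have hbu : IsUnit b := (ContinuousMap.isUnit_iff_forall_ne_zero _).2 hb0
  obtain ⟨binv, hbinv⟩ := hbu.exists_right_inv
  have htop : ((polyAlg E).colon hbA).topologicalClosure = ⊤ := by
    set B := ((polyAlg E).colon hbA).topologicalClosure with hB
    have hcB : (polyAlg E).colon hbA ≤ B := Subalgebra.le_topologicalClosure _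
    have hAB : polyAlg E ≤ B := ((polyAlg E).le_colon hbA).trans hcB
    have hBc : IsClosed (B : Set C(E, ℂ)) := Subalgebra.isClosed_topologicalClosure _
    have hres : (-t : ℂ) ∈ funResolvent B (polyOn E p) :=
      ⟨binv, hcB ((polyAlg E).mem_colon_of_mul_eq_one hbA hbinv), fun x => by
        have := congrArg (fun w : C(E, ℂ) => w x) hbinv
        exact this⟩
    obtain ⟨u, huB, huim, hu⟩ := hreal B hBc (hAB hfA) hres
    have hstar : star u = u := by
      ext x
      exact Complex.conj_eq_iff_im.2 (huim x)
    refine Subalgebra.eq_top_of_dense_on_fibers hBc huB (by rwa [hstar]) fun w φ ε hε => ?_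
    obtain ⟨a, ha, hax⟩ := exists_mem_polyAlg_near (F := {x | u x = w})
      (fun i => measure_mono_null (Set.image_mono (by rintro _ ⟨x, -, rfl⟩; exact x.2)) (hnullE i))
      (isClosed_eq u.continuous continuous_const) (by
        have hF : IsClosed {x : E | u x = w} := isClosed_eq u.continuous continuous_const
        refine hmin _ (by rintro _ ⟨x, -, rfl⟩; exact x.2)
          (hF.isCompact.image continuous_subtype_val) fun heq => ?_
        obtain ⟨q', hq'E, hq'⟩ := hnt.exists_ne q
        have hall : ∀ x : E, u x = w := by
          intro x
          have hx : x.1 ∈ Subtype.val '' {x : E | u x = w} := by rw [heq]; exact x.2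
          obtain ⟨y, hy, hyx⟩ := hx
          rwa [← Subtype.ext hyx]
        exact hq' (hu ⟨q', hq'E⟩ ((hall _).trans (hall _).symm))) φ hε
    exact ⟨a, hAB ha, hax⟩
  obtain ⟨β, hβ⟩ := hsqrt E hES hEc b hb0
  obtain ⟨m, hm, hmb⟩ : ∃ m > 0, ∀ x, m ≤ ‖b x‖ := by
    have : Nonempty E := ⟨⟨q, hqE⟩⟩
    obtain ⟨x, -, hx⟩ := isCompact_univ.exists_isMinOn (Set.univ_nonempty (α := E))
      (continuous_norm.comp b.continuous).continuousOn
    exact ⟨‖b x‖, norm_pos_iff.2 (hb0 x), fun y => hx (Set.mem_univ y)⟩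
  have hcont : ContinuousAt (fun g : C(E, ℂ) => g * g) β := by fun_prop
  obtain ⟨η, hη, hηb⟩ := Metric.continuousAt_iff.1 hcont (m / 2) (half_pos hm)
  obtain ⟨g, hg, hgβ⟩ : ∃ g ∈ (polyAlg E).colon hbA, dist g β < η := by
    have hβm : β ∈ ((polyAlg E).colon hbA).topologicalClosure := by rw [htop]; trivial
    obtain ⟨g, hg, hd⟩ := Metric.mem_closure_iff.1 hβm η hη
    exact ⟨g, hg, by rwa [dist_comm]⟩
  obtain ⟨k, hk⟩ := hg
  refine false_of_sq_near_odd_pow isClosed_polyAlg (a := ⟨_, hk⟩) (b := ⟨b, hbA⟩) (k := k)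
    hb0 hb1 hb2 fun x => ?_
  have h1 : ‖g x * g x - b x‖ ≤ m / 2 := by
    have h2 := ContinuousMap.norm_coe_le_norm (g * g - β * β) x
    rw [← dist_eq_norm] at h2
    have h3 := h2.trans (hηb hgβ).le
    rwa [hβ] at h3
  change ‖(b x ^ k * g x) ^ 2 - b x ^ (2 * k + 1)‖ ≤ 1 / 2 * ‖b x ^ (2 * k + 1)‖
  have h3 : (b x ^ k * g x) ^ 2 - b x ^ (2 * k + 1) = b x ^ (2 * k) * (g x * g x - b x) := by ring
  rw [h3, norm_mul, pow_succ (b x) (2 * k), norm_mul]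
  have h4 := hmb x
  have h5 := norm_nonneg (b x ^ (2 * k))
  nlinarith [mul_le_mul_of_nonneg_left (show ‖g x * g x - b x‖ ≤ ‖b x‖ / 2 by linarith) h5]

end Flat

end

section

open MeasureTheory Real

section LocalMax

/-- Spectral radius formula modulo the ideal generated by `g`. -/
theorem exists_norm_pow_add_mul_lt {A : Type*} [NormedCommRing A] [NormedAlgebra ℂ A]
    [CompleteSpace A] (a g : A) {s : ℝ} (hs : 0 < s)
    (H : ∀ χ : A →ₐ[ℂ] ℂ, χ g = 0 → ‖χ a‖ < s) : ∃ n > 0, ∃ b, ‖a ^ n + g * b‖ < s ^ n := by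
  let I : Ideal A := (Ideal.span {g}).closure
  have hI : IsClosed (I : Set A) := isClosed_closure
  have hgI : g ∈ I := subset_closure (Ideal.subset_span rfl)
  have hspec : spectralRadius ℂ (Ideal.Quotient.mk I a) < ENNReal.ofReal s := by
    have hlt : ∀ k ∈ spectrum ℂ (Ideal.Quotient.mk I a), ‖k‖₊ < s.toNNReal := by
      intro k hk
      obtain ⟨χ, hχ⟩ := WeakDual.CharacterSpace.mem_spectrum_iff_exists.1 hk
      have h1 := H ((WeakDual.CharacterSpace.toAlgHom χ).comp (Ideal.Quotient.mkₐ ℂ I)) (by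
        change χ (Ideal.Quotient.mk I g) = 0
        rw [Ideal.Quotient.eq_zero_iff_mem.2 hgI, map_zero])
      change ‖χ (Ideal.Quotient.mk I a)‖ < s at h1
      rw [hχ] at h1
      rw [← NNReal.coe_lt_coe, Real.coe_toNNReal s hs.le]
      exact h1
    rcases (spectrum ℂ (Ideal.Quotient.mk I a)).eq_empty_or_nonempty with h | h
    · have : spectralRadius ℂ (Ideal.Quotient.mk I a) = 0 := by
        simp [spectralRadius, h]
      rw [this]
      exact ENNReal.ofReal_pos.2 hs
    · exact spectrum.spectralRadius_lt_of_forall_lt_of_nonempty h hlt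
  have hlim := spectrum.pow_norm_pow_one_div_tendsto_nhds_spectralRadius (Ideal.Quotient.mk I a)
  obtain ⟨n, hn, hn0⟩ := ((hlim.eventually_lt_const hspec).and (Filter.eventually_gt_atTop 0)).exists
  have h1 : ‖Ideal.Quotient.mk I (a ^ n)‖ < s ^ n := by
    have h2 := (ENNReal.ofReal_lt_ofReal_iff hs).1 hn
    have h3 := pow_lt_pow_left₀ h2 (by positivity) hn0.ne'
    rwa [← Real.rpow_natCast, ← Real.rpow_mul (norm_nonneg _), one_div,
      inv_mul_cancel₀ (by exact_mod_cast hn0.ne'), Real.rpow_one, ← map_pow] at h3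
  obtain ⟨c, hc, hcn⟩ := Ideal.Quotient.norm_mk_lt (Ideal.Quotient.mk I (a ^ n)) (sub_pos.2 h1)
  rw [Ideal.Quotient.eq] at hc
  obtain ⟨y, hy, hyd⟩ := Metric.mem_closure_iff.1 (show c - a ^ n ∈ closure _ from hc)
    (s ^ n - ‖c‖) (by linarith)
  obtain ⟨b, rfl⟩ := Ideal.mem_span_singleton'.1 hy
  refine ⟨n, hn0, b, ?_⟩
  have h4 : a ^ n + g * b = c - (c - a ^ n - b * g) := by ring
  rw [h4]
  rw [dist_eq_norm] at hyd
  have := norm_sub_le c (c - a ^ n - b * g)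
  linarith

/-- A uniform version of `exists_norm_pow_add_mul_lt` over a circle. -/
theorem exists_norm_pow_add_mul_lt_circle {A : Type*} [NormedCommRing A]
    [NormedAlgebra ℂ A] [CompleteSpace A] (a h : A) {s ρ : ℝ}
    (hs : 0 < s) (H : ∀ χ : A →ₐ[ℂ] ℂ, ‖χ h‖ = ρ → ‖χ a‖ < s) :
    ∃ n > 0, ∀ w ∈ Metric.sphere (0 : ℂ) ρ, ∃ b, ‖a ^ n + (h - algebraMap ℂ A w) * b‖ ≤ s ^ n := by
  have hpow : ∀ (w : ℂ) (n m : ℕ), (∃ b, ‖a ^ n + (h - algebraMap ℂ A w) * b‖ ≤ s ^ n) → 0 < m →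
      ∃ b, ‖a ^ (n * m) + (h - algebraMap ℂ A w) * b‖ ≤ s ^ (n * m) := by
    rintro w n m ⟨b, hb⟩ hm
    obtain ⟨d, hd⟩ := sub_dvd_pow_sub_pow (a ^ n + (h - algebraMap ℂ A w) * b) (a ^ n) m
    refine ⟨b * d, ?_⟩
    have : a ^ (n * m) + (h - algebraMap ℂ A w) * (b * d) =
        (a ^ n + (h - algebraMap ℂ A w) * b) ^ m := by
      rw [pow_mul, sub_eq_iff_eq_add.1 hd]
      ring
    rw [this, pow_mul]
    exact (norm_pow_le' _ hm).trans (pow_le_pow_left₀ (norm_nonneg _) hb m)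
  refine (isCompact_sphere (0 : ℂ) ρ).induction_on (p := fun S => ∃ n > 0, ∀ w ∈ S, ∃ b,
    ‖a ^ n + (h - algebraMap ℂ A w) * b‖ ≤ s ^ n) ⟨1, one_pos, by simp⟩ ?_ ?_ ?_
  · rintro S S' hSS ⟨n, hn, h⟩
    exact ⟨n, hn, fun w hw => h w (hSS hw)⟩
  · rintro S S' ⟨n, hn, h⟩ ⟨n', hn', h'⟩
    refine ⟨n * n', Nat.mul_pos hn hn', ?_⟩
    rintro w (hw | hw)
    · exact hpow w n n' (h w hw) hn'
    · rw [mul_comm]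
      exact hpow w n' n (h' w hw) hn
  · intro w hw
    obtain ⟨n, hn, b, hb⟩ := exists_norm_pow_add_mul_lt a (h - algebraMap ℂ A w) hs fun χ hχ => by
      refine H χ ?_
      rw [map_sub, sub_eq_zero, AlgHom.commutes] at hχ
      rw [hχ]
      exact mem_sphere_zero_iff_norm.1 hw
    have hcont : Continuous fun z : ℂ => ‖a ^ n + (h - algebraMap ℂ A z) * b‖ := by
      have : Continuous (algebraMap ℂ A) := continuous_algebraMap ℂ A
      fun_prop
    refine ⟨_, mem_nhdsWithin_of_mem_nhds (hcont.continuousAt.eventually_lt continuousAt_const hb),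
      n, hn, fun z hz => ⟨b, ?_⟩⟩
    exact le_of_lt hz

end LocalMax

end

section

open MeasureTheory Real

theorem le_of_forall_pow_le_mul {x y C : ℝ} (hy : 0 < y) (h : ∀ j : ℕ, 0 < j → x ^ j ≤ C * y ^ j) :
    x ≤ y := by
  by_contra! hxy
  have h1 : 1 < x / y := (one_lt_div hy).2 hxy
  obtain ⟨j, hj⟩ := pow_unbounded_of_one_lt (max C 1) h1
  have hj0 : 0 < j := by
    rcases Nat.eq_zero_or_pos j with rfl | hj0
    · have := le_max_right C 1
      rw [pow_zero] at hj
      linarith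
    · exact hj0
  have h2 := h j hj0
  rw [div_pow, lt_div_iff₀ (by positivity)] at hj
  have h3 := mul_le_mul_of_nonneg_right (le_max_left C 1) (pow_pos hy j).le
  linarith

section LocalMax
variable {X : Type*} [TopologicalSpace X] [CompactSpace X] {B : Subalgebra ℂ C(X, ℂ)}

theorem exists_extension_character (hB : IsClosed (B : Set C(X, ℂ))) (χ : B →ₐ[ℂ] ℂ) :
    ∃ M : C(X, ℂ) →L[ℂ] ℂ, ∀ b : B, M b.1 = χ b := by
  let f : (Subalgebra.toSubmodule B) →L[ℂ] ℂ :=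
    LinearMap.mkContinuous (χ.toLinearMap : (Subalgebra.toSubmodule B) →ₗ[ℂ] ℂ) 1
      (fun b => by rw [one_mul]; exact norm_character_le hB χ b)
  obtain ⟨M, hM, -⟩ := exists_extension_norm_eq (Subalgebra.toSubmodule B) f
  exact ⟨M, fun b => hM b⟩

/-- The maximum principle on the part of the spectrum lying over an annulus. -/
theorem norm_character_le_of_annulus (hB : IsClosed (B : Set C(X, ℂ))) {a h : B}
    (h1 : ∀ x, ‖h.1 x‖ = 1) {ρ₁ ρ₂ s : ℝ} (hρ₁ : 0 < ρ₁) (hρ₂ : ρ₂ < 1) (hs : 0 < s) {k : ℕ}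
    (H : ∀ χ : B →ₐ[ℂ] ℂ, ‖χ h‖ = ρ₁ ∨ ‖χ h‖ = ρ₂ → ‖χ a‖ < s * ‖χ h‖ ^ k)
    (χ₀ : B →ₐ[ℂ] ℂ) (hχ₁ : ρ₁ < ‖χ₀ h‖) (hχ₂ : ‖χ₀ h‖ < ρ₂) :
    ‖χ₀ a‖ ≤ s * ‖χ₀ h‖ ^ k := by
  have : CompleteSpace B := hB.completeSpace_coe
  obtain ⟨M, hM⟩ := exists_extension_character hB χ₀
  set z₀ := χ₀ h with hz₀
  have hρ₂0 : 0 < ρ₂ := (norm_nonneg _).trans_lt hχ₂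
  have hunit : ∀ z : ℂ, ‖z‖ < 1 → IsUnit (h.1 - algebraMap ℂ C(X, ℂ) z) := fun z hz => by
    refine (ContinuousMap.isUnit_iff_forall_ne_zero _).2 fun x hx => ?_
    have h2 : h.1 x = z := sub_eq_zero.1 hx
    rw [← h2, h1] at hz
    exact lt_irrefl _ hz
  let R : ℂ → C(X, ℂ) := fun z => Ring.inverse (h.1 - algebraMap ℂ C(X, ℂ) z)
  have hRd : DifferentiableOn ℂ R (Metric.ball 0 1) := by
    intro z hz
    have h2 : DifferentiableAt ℂ (fun z : ℂ => h.1 - algebraMap ℂ C(X, ℂ) z) z :=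
      (differentiableAt_const _).sub (Algebra.linearMap ℂ C(X, ℂ)).toContinuousLinearMap.differentiableAt
    have h3 : DifferentiableAt ℂ (Ring.inverse : C(X, ℂ) → C(X, ℂ))
        (h.1 - algebraMap ℂ C(X, ℂ) z) := by
      exact differentiableAt_inverse (hunit z (mem_ball_zero_iff.1 hz))
    exact (h3.comp z h2).differentiableWithinAt
  have hR : ∀ z : ℂ, ‖z‖ < 1 → (h.1 - algebraMap ℂ C(X, ℂ) z) * R z = 1 := fun z hz =>
    Ring.mul_inverse_cancel _ (hunit z hz)
  obtain ⟨CR, hCR⟩ : ∃ CR, ∀ z ∈ Metric.closedBall (0 : ℂ) ρ₂, ‖R z‖ ≤ CR :=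
    (isCompact_closedBall 0 ρ₂).exists_bound_of_continuousOn
      (hRd.continuousOn.mono (Metric.closedBall_subset_ball hρ₂))
  set e : C(X, ℂ) := h.1 - algebraMap ℂ C(X, ℂ) z₀ with he
  have hkill : ∀ z : ℂ, ‖z‖ < 1 → ∀ d : B,
      M (((h - algebraMap ℂ B z) * d : B).1 * e * R z) = 0 := by
    intro z hz d
    have h2 : ((h - algebraMap ℂ B z) * d : B).1 * e * R z =
        (d * (h - algebraMap ℂ B z₀) : B).1 := by
      change (h.1 - algebraMap ℂ C(X, ℂ) z) * d.1 * e * R z = d.1 * e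
      linear_combination (d.1 * e) * hR z hz
    rw [h2, hM, map_mul, map_sub, AlgHom.commutes, ← hz₀]
    simp
  obtain ⟨n₁, hn₁, hb₁⟩ := exists_norm_pow_add_mul_lt_circle a h (s := s * ρ₁ ^ k) (ρ := ρ₁)
    (by positivity) fun χ hχ => hχ ▸ H χ (Or.inl hχ)
  obtain ⟨n₂, hn₂, hb₂⟩ := exists_norm_pow_add_mul_lt_circle a h (s := s * ρ₂ ^ k) (ρ := ρ₂)
    (by positivity) fun χ hχ => hχ ▸ H χ (Or.inr hχ)
  set C := ‖M‖ * (‖e‖ * CR) with hC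
  have hbound : ∀ z ∈ Metric.closedBall (0 : ℂ) ρ₂, ∀ (t : ℝ) (n j : ℕ) (b : B), 0 < j →
      ‖a ^ n + (h - algebraMap ℂ B z) * b‖ ≤ t ^ n → ‖M ((a ^ (n * j) : B).1 * e * R z)‖ ≤
        C * t ^ (n * j) := by
    intro z hz t n j b hj hb
    have hz1 : ‖z‖ < 1 := (mem_closedBall_zero_iff.1 hz).trans_lt hρ₂
    obtain ⟨d, hd⟩ := sub_dvd_pow_sub_pow (a ^ n + (h - algebraMap ℂ B z) * b) (a ^ n) j
    set y := a ^ n + (h - algebraMap ℂ B z) * b with hy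
    have h2 : a ^ (n * j) = y ^ j - (h - algebraMap ℂ B z) * (b * d) := by
      rw [pow_mul, sub_eq_iff_eq_add.1 hd, hy]
      ring
    have h3 : (a ^ (n * j) : B).1 * e * R z =
        (y ^ j : B).1 * e * R z - ((h - algebraMap ℂ B z) * (b * d) : B).1 * e * R z := by
      rw [h2]
      change ((y ^ j : B).1 - ((h - algebraMap ℂ B z) * (b * d) : B).1) * e * R z = _
      ring
    rw [h3, map_sub, hkill z hz1, sub_zero, hC, mul_assoc ‖M‖]
    refine (M.le_opNorm _).trans (mul_le_mul_of_nonneg_left ?_ (norm_nonneg _))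
    have h4 : ‖(y ^ j : B).1‖ ≤ t ^ (n * j) := by
      refine (norm_pow_le' y hj).trans ?_
      rw [pow_mul]
      exact pow_le_pow_left₀ (norm_nonneg _) hb j
    calc ‖(y ^ j : B).1 * e * R z‖ ≤ ‖(y ^ j : B).1‖ * ‖e‖ * ‖R z‖ :=
          (norm_mul_le _ _).trans (mul_le_mul_of_nonneg_right (norm_mul_le _ _) (norm_nonneg _))
      _ ≤ t ^ (n * j) * ‖e‖ * CR := by
          gcongr
          · exact mul_nonneg ((norm_nonneg _).trans h4) (norm_nonneg _)
          · exact hCR z hz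
      _ = ‖e‖ * CR * t ^ (n * j) := by ring
  let U : Set ℂ := {z | ρ₁ < ‖z‖ ∧ ‖z‖ < ρ₂}
  have hUo : IsOpen U := (isOpen_lt continuous_const continuous_norm).inter
    (isOpen_lt continuous_norm continuous_const)
  have hUc : closure U ⊆ {z | ρ₁ ≤ ‖z‖ ∧ ‖z‖ ≤ ρ₂} :=
    closure_minimal (fun z hz => ⟨hz.1.le, hz.2.le⟩)
      ((isClosed_le continuous_const continuous_norm).inter
        (isClosed_le continuous_norm continuous_const))
  have hUb : Bornology.IsBounded U := Metric.isBounded_ball.subset fun z hz =>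
    mem_ball_zero_iff.2 hz.2
  have hpow : ∀ j : ℕ, 0 < j → (‖χ₀ a‖ ^ (n₁ * n₂)) ^ j ≤ C * ((s * ‖z₀‖ ^ k) ^ (n₁ * n₂)) ^ j := by
    intro j hj
    set m := n₁ * n₂ * j with hm
    let Φ : ℂ → ℂ := fun z => M ((a ^ m : B).1 * e * R z) / z ^ (k * m)
    have hΦ : DifferentiableOn ℂ Φ (closure U) := by
      refine DifferentiableOn.div ?_ (by fun_prop) fun z hz => ?_
      · refine M.differentiable.comp_differentiableOn ?_
        refine ((differentiableOn_const _).mul (hRd.mono fun z hz => ?_))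
        exact mem_ball_zero_iff.2 ((hUc hz).2.trans_lt hρ₂)
      · exact pow_ne_zero _ (norm_pos_iff.1 (hρ₁.trans_le (hUc hz).1))
    have hfr : ∀ z ∈ frontier U, ‖Φ z‖ ≤ C * s ^ m := by
      intro z hz
      rw [hUo.frontier_eq] at hz
      have hzc := hUc hz.1
      have hz0 : 0 < ‖z‖ := hρ₁.trans_le hzc.1
      have key : ‖M ((a ^ m : B).1 * e * R z)‖ ≤ C * (s * ‖z‖ ^ k) ^ m := by
        rcases hzc.1.eq_or_lt with h2 | h2
        · obtain ⟨b, hb⟩ := hb₁ z (mem_sphere_zero_iff_norm.2 h2.symm)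
          rw [h2] at hb
          have := hbound z (mem_closedBall_zero_iff.2 hzc.2) _ _ (n₂ * j) b (Nat.mul_pos hn₂ hj) hb
          rwa [← mul_assoc] at this
        · have h3 : ‖z‖ = ρ₂ := le_antisymm hzc.2 (not_lt.1 fun h3 => hz.2 ⟨h2, h3⟩)
          obtain ⟨b, hb⟩ := hb₂ z (mem_sphere_zero_iff_norm.2 h3)
          rw [← h3] at hb
          have := hbound z (mem_closedBall_zero_iff.2 hzc.2) _ _ (n₁ * j) b (Nat.mul_pos hn₁ hj) hb
          rwa [← mul_assoc, mul_comm n₂ n₁] at this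
      rw [norm_div, norm_pow, div_le_iff₀ (by positivity)]
      refine key.trans (le_of_eq ?_)
      rw [mul_pow, ← pow_mul, ← mul_assoc C]
    have h2 := Complex.norm_le_of_forall_mem_frontier_norm_le hUb hΦ.diffContOnCl hfr
      (subset_closure ⟨hχ₁, hχ₂⟩ : z₀ ∈ closure U)
    have h3 : Φ z₀ = χ₀ a ^ m / z₀ ^ (k * m) := by
      change M _ / _ = _
      rw [mul_assoc, hR z₀ (hχ₂.trans hρ₂), mul_one, hM, map_pow]
    have hz0 : 0 < ‖z₀‖ := hρ₁.trans hχ₁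
    rw [h3, norm_div, norm_pow, norm_pow, div_le_iff₀ (by positivity)] at h2
    rw [← pow_mul, ← hm, ← pow_mul, ← hm]
    refine h2.trans (le_of_eq ?_)
    rw [mul_pow, ← pow_mul, ← mul_assoc C]
  have hz0 : 0 < ‖z₀‖ := hρ₁.trans hχ₁
  have h5 := le_of_forall_pow_le_mul (by positivity) hpow
  exact le_of_pow_le_pow_left₀ (Nat.mul_pos hn₁ hn₂).ne' (by positivity) h5

end LocalMax

end

section

open MeasureTheory Real

section Circle
variable {X : Type*} [TopologicalSpace X] [CompactSpace X] [T2Space X] {B : Subalgebra ℂ C(X, ℂ)}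

/-- A character which is unimodular on `h` is a point evaluation if `B[1/h]` is dense. -/
theorem exists_eval_of_norm_eq_one (hB : IsClosed (B : Set C(X, ℂ))) {h : B}
    (h1 : ∀ x, ‖h.1 x‖ = 1) (hd : (B.colon h.2).topologicalClosure = ⊤) (χ : B →ₐ[ℂ] ℂ)
    (hχ : ‖χ h‖ = 1) : ∃ x, ∀ a : B, χ a = a.1 x := by
  let J : Ideal C(X, ℂ) := Ideal.span {g | ∃ a : B, χ a = 0 ∧ g = a.1}
  have hcop : ∀ (k : ℕ) (g : C(X, ℂ)), ‖h.1 ^ k * g‖ = ‖g‖ := by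
    intro k g
    refine le_antisymm ?_ ?_
    · refine (ContinuousMap.norm_le _ (norm_nonneg _)).2 fun x => ?_
      rw [ContinuousMap.mul_apply, norm_mul, ContinuousMap.pow_apply, norm_pow, h1, one_pow, one_mul]
      exact g.norm_coe_le_norm x
    · refine (ContinuousMap.norm_le _ (norm_nonneg _)).2 fun x => ?_
      have := (h.1 ^ k * g).norm_coe_le_norm x
      rwa [ContinuousMap.mul_apply, norm_mul, ContinuousMap.pow_apply, norm_pow, h1, one_pow,
        one_mul] at this
  have happ : ∀ g ∈ J, ∀ ε > 0, ∃ (k : ℕ) (b : B), χ b = 0 ∧ ‖h.1 ^ k * g - b.1‖ < ε := by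
    intro g hg
    induction hg using Submodule.span_induction with
    | mem g hg =>
      obtain ⟨a, ha, rfl⟩ := hg
      intro ε hε
      exact ⟨0, a, ha, by simpa using hε⟩
    | zero => exact fun ε hε => ⟨0, 0, map_zero χ, by simpa using hε⟩
    | add g g' _ _ ih ih' =>
      intro ε hε
      obtain ⟨k, b, hb, hkb⟩ := ih (ε / 2) (half_pos hε)
      obtain ⟨k', b', hb', hkb'⟩ := ih' (ε / 2) (half_pos hε)
      refine ⟨k + k', h ^ k' * b + h ^ k * b', ?_, ?_⟩
      · have e0 : χ (h ^ k' * b + h ^ k * b') = χ (h ^ k' * b) + χ (h ^ k * b') := χ.map_add' _ _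
        rw [e0, map_mul, map_mul, hb, hb', mul_zero, mul_zero, add_zero]
      have e1 : h.1 ^ (k + k') * (g + g') - (h ^ k' * b + h ^ k * b' : B).1 =
          h.1 ^ k' * (h.1 ^ k * g - b.1) + h.1 ^ k * (h.1 ^ k' * g' - b'.1) := by
        change _ - (h.1 ^ k' * b.1 + h.1 ^ k * b'.1) = _
        ring
      rw [e1]
      refine (norm_add_le _ _).trans_lt ?_
      rw [hcop, hcop]
      linarith
    | smul c g _ ih =>
      intro ε hε
      have hc : c ∈ (B.colon h.2).topologicalClosure := by rw [hd]; trivial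
      obtain ⟨c', ⟨j, hj⟩, hcc⟩ := Metric.mem_closure_iff.1 hc (ε / 2 / (‖g‖ + 1)) (by positivity)
      rw [dist_eq_norm] at hcc
      obtain ⟨k, b, hb, hkb⟩ := ih (ε / 2 / (‖h.1 ^ j * c'‖ + 1)) (by positivity)
      refine ⟨j + k, ⟨_, hj⟩ * b, by rw [map_mul, hb, mul_zero], ?_⟩
      have e1 : h.1 ^ (j + k) * (c • g) - (⟨h.1 ^ j * c', hj⟩ * b : B).1 =
          h.1 ^ (j + k) * ((c - c') * g) + h.1 ^ j * c' * (h.1 ^ k * g - b.1) := by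
        rw [smul_eq_mul]
        change _ - h.1 ^ j * c' * b.1 = _
        ring
      rw [e1]
      refine (norm_add_le _ _).trans_lt ?_
      rw [hcop]
      have e2 : ‖(c - c') * g‖ ≤ ε / 2 := by
        refine (norm_mul_le _ _).trans ?_
        rw [lt_div_iff₀ (by positivity)] at hcc
        nlinarith [norm_nonneg (c - c'), norm_nonneg g]
      have e3 : ‖h.1 ^ j * c' * (h.1 ^ k * g - b.1)‖ < ε / 2 := by
        refine (norm_mul_le _ _).trans_lt ?_
        rw [lt_div_iff₀ (by positivity)] at hkb
        rcases (norm_nonneg (h.1 ^ k * g - b.1)).eq_or_lt with h0 | h0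
        · rw [← h0, mul_zero]; positivity
        · nlinarith
      linarith
  have hJ : J ≠ ⊤ := by
    intro hJ
    obtain ⟨k, b, hb, hkb⟩ := happ 1 (by rw [hJ]; trivial) 1 one_pos
    have h2 := norm_character_le hB χ (h ^ k - b)
    rw [map_sub, hb, sub_zero, map_pow, norm_pow, hχ, one_pow] at h2
    rw [mul_one] at hkb
    have h3 : ‖h ^ k - b‖ = ‖h.1 ^ k - b.1‖ := rfl
    linarith
  obtain ⟨x, hx⟩ : ∃ x, ∀ g ∈ J, g x = 0 := by
    obtain ⟨I, hI, hJI⟩ := Ideal.exists_le_maximal J hJ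
    obtain ⟨x, hx⟩ := ContinuousMap.setOfIdeal_eq_compl_singleton (X := X) (𝕜 := ℂ) I
    have hx' : x ∉ ContinuousMap.setOfIdeal I := by rw [hx]; simp
    exact ⟨x, fun g hg => ContinuousMap.notMem_setOfIdeal.1 hx' (hJI hg)⟩
  refine ⟨x, fun a => ?_⟩
  have h2 := hx (a - algebraMap ℂ B (χ a)).1 (Ideal.subset_span ⟨_, by
    rw [map_sub, AlgHom.commutes]; exact sub_self _, rfl⟩)
  exact (sub_eq_zero.1 h2).symm

end Circle

end

section

open MeasureTheory Real

section Logarithm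

theorem exists_comp_mem_of_differentiable {X : Type*} [TopologicalSpace X] [CompactSpace X]
    {B : Subalgebra ℂ C(X, ℂ)} {f : C(X, ℂ)} (hB : IsClosed (B : Set C(X, ℂ))) (hf : f ∈ B)
    {g : ℂ → ℂ} (hg : Differentiable ℂ g) : ∃ b ∈ B, ∀ x, b x = g (f x) :=
  exists_mem_comp_of_differentiableOn hB hf (p := 0) (norm_nonneg f) (lt_add_one _)
    (fun x => by rw [sub_zero]; exact f.norm_coe_le_norm x) hg.differentiableOn

/-- In an algebra in which `p` has an approximate logarithm `a / p ^ k`, one can find a function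
whose modulus is controlled by `log ‖p‖`. -/
theorem exists_mem_closure_colon_norm_eq {Y : Type*} [TopologicalSpace Y] [CompactSpace Y]
    (C : Subalgebra ℂ C(Y, ℂ)) {p a : C(Y, ℂ)} (hp : p ∈ C) (ha : a ∈ C) (hp0 : ∀ y, p y ≠ 0)
    {k : ℕ} (hpa : ∀ y, ‖p y * Complex.exp (-(a y / p y ^ k)) - 1‖ ≤ 1 / 2) (κ m : ℝ) :
    ∃ v ∈ (C.colon hp).topologicalClosure, ∃ t : Y → ℝ,
      ∀ y, ‖v y‖ = exp (exp (t y) * cos (κ * (log ‖p y‖ - m))) := by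
  have hO : IsClosed ((C.colon hp).topologicalClosure : Set C(Y, ℂ)) :=
    Subalgebra.isClosed_topologicalClosure _
  have hle : C ≤ (C.colon hp).topologicalClosure :=
    (C.le_colon hp).trans (Subalgebra.le_topologicalClosure _)
  let q : C(Y, ℂ) := ⟨fun y => (p y)⁻¹, p.continuous.inv₀ hp0⟩
  have hq : q ∈ (C.colon hp).topologicalClosure := by
    refine Subalgebra.le_topologicalClosure _ (C.mem_colon_of_mul_eq_one hp ?_)
    ext y
    exact mul_inv_cancel₀ (hp0 y)
  let u : C(Y, ℂ) := a * q ^ k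
  have hu : u ∈ (C.colon hp).topologicalClosure := mul_mem (hle ha) (pow_mem hq k)
  have huy : ∀ y, u y = a y / p y ^ k := fun y => by
    rw [div_eq_mul_inv, ← inv_pow]; rfl
  obtain ⟨e, he, hey⟩ := exists_comp_mem_of_differentiable hO hu
    (g := fun w => Complex.exp (-w)) (by fun_prop)
  obtain ⟨l, hl, hly⟩ := exists_mem_comp_of_differentiableOn hO (mul_mem (hle hp) he) (p := 1)
    (r := 1 / 2) (R := 1) (by norm_num) (by norm_num) (fun y => by
      rw [ContinuousMap.mul_apply, hey, huy]; exact hpa y) (g := Complex.log)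
    (fun w hw => (Complex.differentiableAt_log
      (Complex.ball_one_subset_slitPlane hw)).differentiableWithinAt)
  have hexp : ∀ y, Complex.exp ((u + l) y) = p y := by
    intro y
    have h0 : (p * e) y ≠ 0 := by
      rw [ContinuousMap.mul_apply, hey]
      exact mul_ne_zero (hp0 y) (Complex.exp_ne_zero _)
    rw [ContinuousMap.add_apply, Complex.exp_add, hly, Complex.exp_log h0,
      ContinuousMap.mul_apply p, hey, mul_left_comm, ← Complex.exp_add, add_neg_cancel,
      Complex.exp_zero, mul_one]
  obtain ⟨v, hv, hvy⟩ := exists_comp_mem_of_differentiable hO (add_mem hu hl)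
    (g := fun w => Complex.exp (Complex.exp (-Complex.I * κ * (w - m)))) (by fun_prop)
  refine ⟨v, hv, fun y => κ * ((u + l) y).im, fun y => ?_⟩
  have hre : log ‖p y‖ = ((u + l) y).re := by
    rw [← hexp, Complex.norm_exp, log_exp]
  rw [hvy, Complex.norm_exp, Complex.exp_re, hre]
  beta_reduce
  generalize (u + l) y = w
  have e1 : (-Complex.I * κ * (w - m)).re = κ * w.im := by simp
  have e2 : (-Complex.I * κ * (w - m)).im = -(κ * (w.re - m)) := by simp
  rw [e1, e2, cos_neg]

variable {X : Type*} [TopologicalSpace X] [CompactSpace X] [T2Space X] {B : Subalgebra ℂ C(X, ℂ)}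

theorem exists_annulus_bound (hB : IsClosed (B : Set C(X, ℂ))) {h a : B}
    (h1 : ∀ x, ‖h.1 x‖ = 1) (hd : (B.colon h.2).topologicalClosure = ⊤) {k : ℕ}
    (ha : ∀ x, ‖h.1 x * Complex.exp (-(a.1 x / h.1 x ^ k)) - 1‖ ≤ 1 / 4) :
    ∃ r : ℝ, 0 < r ∧ r < 1 ∧ ∀ χ : B →ₐ[ℂ] ℂ, r ≤ ‖χ h‖ →
      ‖χ h * Complex.exp (-(χ a / χ h ^ k)) - 1‖ ≤ 1 / 2 := by
  have : CompleteSpace B := hB.completeSpace_coe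
  let Y := WeakDual.characterSpace ℂ B
  have hc : ∀ b : B, Continuous fun χ : Y => χ b := fun b =>
    (WeakDual.gelfandTransform ℂ B b).continuous
  let D : Y → ℝ := fun χ => ‖χ h * Complex.exp (-(χ a / χ h ^ k)) - 1‖
  let A : Set Y := {χ | 1 / 2 ≤ ‖χ h‖}
  have hA : IsClosed A := isClosed_le continuous_const (hc h).norm
  have hD : ContinuousOn D A := by
    have : ∀ χ ∈ A, χ h ^ k ≠ 0 := fun χ hχ => pow_ne_zero _ (by
      intro h0
      have : 1 / 2 ≤ ‖χ h‖ := hχ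
      rw [h0, norm_zero] at this; norm_num at this)
    have hch := (hc h).continuousOn (s := A)
    have hca := (hc a).continuousOn (s := A)
    exact ((hch.mul (Complex.continuous_exp.comp_continuousOn
      ((hca.div (hch.pow k) this).neg))).sub continuousOn_const).norm
  have hS : IsCompact (A ∩ D ⁻¹' Set.Ici (1 / 2)) :=
    (hD.preimage_isClosed_of_isClosed hA isClosed_Ici).isCompact
  have key : ∀ r : ℝ, 1 / 2 ≤ r → (∀ χ ∈ A ∩ D ⁻¹' Set.Ici (1 / 2), ‖χ h‖ < r) →
      ∀ χ : B →ₐ[ℂ] ℂ, r ≤ ‖χ h‖ → ‖χ h * Complex.exp (-(χ a / χ h ^ k)) - 1‖ ≤ 1 / 2 := by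
    intro r hr H χ hχ
    by_contra! hcon
    let χ' : Y := WeakDual.CharacterSpace.equivAlgHom.symm χ
    exact absurd hχ (not_le.2 (H χ' ⟨hr.trans hχ, hcon.le⟩))
  rcases (A ∩ D ⁻¹' Set.Ici (1 / 2)).eq_empty_or_nonempty with h0 | h0
  · refine ⟨1 / 2, by norm_num, by norm_num, key _ le_rfl fun χ hχ => ?_⟩
    rw [h0] at hχ
    exact hχ.elim
  · obtain ⟨χ₁, hχ₁, hmax⟩ := hS.exists_isMaxOn h0 (hc h).norm.continuousOn
    have hlt : ‖χ₁ h‖ < 1 := by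
      refine lt_of_le_of_ne ?_ fun h2 => ?_
      · refine (norm_character_le hB (WeakDual.CharacterSpace.toAlgHom χ₁) h).trans ?_
        exact (ContinuousMap.norm_le _ zero_le_one).2 fun x => (h1 x).le
      · obtain ⟨x, hx⟩ := exists_eval_of_norm_eq_one hB h1 hd
          (WeakDual.CharacterSpace.toAlgHom χ₁) h2
        have h3 : 1 / 2 ≤ D χ₁ := hχ₁.2
        have h4 : D χ₁ = ‖h.1 x * Complex.exp (-(a.1 x / h.1 x ^ k)) - 1‖ := by
          rw [← hx, ← hx]; rfl
        have := ha x
        linarith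
    have hge : 1 / 2 ≤ ‖χ₁ h‖ := hχ₁.1
    refine ⟨(‖χ₁ h‖ + 1) / 2, by linarith, by linarith, key _ (by linarith) fun χ hχ => ?_⟩
    have : ‖χ h‖ ≤ ‖χ₁ h‖ := hmax hχ
    linarith

/-- If a unimodular `h ∈ B` has a continuous logarithm and `B[1/h]` is dense, then `h` is
invertible in `B`. -/
theorem zero_mem_funResolvent_of_log (hB : IsClosed (B : Set C(X, ℂ))) {h : C(X, ℂ)} (hh : h ∈ B)
    (h1 : ∀ x, ‖h x‖ = 1) (hd : (B.colon hh).topologicalClosure = ⊤) (τ : C(X, ℂ))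
    (hτ : ∀ x, h x = Complex.exp (τ x)) : (0 : ℂ) ∈ funResolvent B h := by
  by_contra hcon
  have : CompleteSpace B := hB.completeSpace_coe
  have hchar : ∀ ζ : ℂ, ‖ζ‖ < 1 → ∃ χ : B →ₐ[ℂ] ℂ, χ ⟨h, hh⟩ = ζ := by
    intro ζ hζ
    refine exists_character_of_notMem_funResolvent hB hh fun hmem => hcon ?_
    refine funResolvent_of_isPreconnected hB hh (convex_ball (0 : ℂ) 1).isPreconnected
      (fun x hx => ?_) ⟨ζ, by simpa using hζ, hmem⟩ (by simp)
    rw [mem_ball_zero_iff, h1] at hx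
    exact lt_irrefl _ hx
  have hh0 : ∀ x, h x ≠ 0 := fun x => norm_ne_zero_iff.1 (by rw [h1]; exact one_ne_zero)
  have hτc : τ ∈ (B.colon hh).topologicalClosure := by rw [hd]; trivial
  obtain ⟨c, ⟨k, hk⟩, hc⟩ := Metric.mem_closure_iff.1 hτc (1 / 8) (by norm_num)
  rw [dist_eq_norm] at hc
  obtain ⟨r, hr0, hr1, hr⟩ := exists_annulus_bound hB (h := ⟨h, hh⟩) (a := ⟨_, hk⟩) h1 hd (k := k)
    (fun x => by
      have e1 : (h ^ k * c) x / h x ^ k = c x := by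
        rw [ContinuousMap.mul_apply, ContinuousMap.pow_apply]
        exact mul_div_cancel_left₀ _ (pow_ne_zero _ (hh0 x))
      change ‖h x * Complex.exp (-((h ^ k * c) x / h x ^ k)) - 1‖ ≤ 1 / 4
      have e2 := (τ - c).norm_coe_le_norm x
      rw [e1, hτ, ← Complex.exp_add, ← sub_eq_add_neg]
      refine (Complex.norm_exp_sub_one_le ?_).trans ?_ <;>
      · rw [ContinuousMap.sub_apply] at e2
        linarith)
  let Y := {χ : WeakDual.characterSpace ℂ B // r ≤ ‖χ ⟨h, hh⟩‖}
  have hYc : IsClosed {χ : WeakDual.characterSpace ℂ B | r ≤ ‖χ ⟨h, hh⟩‖} :=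
    isClosed_le continuous_const (WeakDual.gelfandTransform ℂ B ⟨h, hh⟩).continuous.norm
  have : CompactSpace Y := isCompact_iff_compactSpace.1 hYc.isCompact
  let ev : B →ₐ[ℂ] C(Y, ℂ) := (ContinuousMap.compRightAlgHom ℂ ℂ
    (⟨Subtype.val, continuous_subtype_val⟩ : C(Y, WeakDual.characterSpace ℂ B))).comp
    (WeakDual.gelfandTransform ℂ B)
  have hev : ∀ (b : B) (χ : Y), ev b χ = χ.1 b := fun b χ => rfl
  obtain ⟨ρ₁, hρ₁, hρ₁'⟩ := exists_between hr1
  obtain ⟨ρ₂, hρ₂, hρ₂'⟩ := exists_between hρ₁'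
  have hρ0 : 0 < ρ₁ := hr0.trans hρ₁
  have hlog : log ρ₁ < log ρ₂ := log_lt_log hρ0 hρ₂
  set m : ℝ := (log ρ₁ + log ρ₂) / 2 with hm
  set κ : ℝ := π / (log ρ₂ - log ρ₁) with hκ
  have hκ1 : κ * (log ρ₁ - m) = -(π / 2) := by
    rw [hκ, hm]; field_simp [sub_ne_zero.2 hlog.ne']; ring
  have hκ2 : κ * (log ρ₂ - m) = π / 2 := by
    rw [hκ, hm]; field_simp [sub_ne_zero.2 hlog.ne']; ring
  have hp : ev ⟨h, hh⟩ ∈ ev.range := ⟨_, rfl⟩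
  obtain ⟨v, hv, t, hvt⟩ := exists_mem_closure_colon_norm_eq ev.range hp
    (a := ev ⟨_, hk⟩) ⟨_, rfl⟩ (fun χ => norm_ne_zero_iff.1 (hr0.trans_le χ.2).ne') (k := k)
    (fun χ => hr (WeakDual.CharacterSpace.toAlgHom χ.1) χ.2) κ m
  have hm1 : ρ₁ < exp m := by
    rw [← log_lt_iff_lt_exp hρ0]; linarith
  have hm2 : exp m < ρ₂ := by
    rw [← lt_log_iff_exp_lt (hρ0.trans hρ₂)]; linarith
  obtain ⟨χ₀, hχ₀⟩ := hchar (exp m : ℝ) (by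
    rw [Complex.norm_real, norm_of_nonneg (exp_pos m).le]; linarith)
  have hχ₀n : ‖χ₀ ⟨h, hh⟩‖ = exp m := by
    rw [hχ₀, Complex.norm_real, norm_of_nonneg (exp_pos m).le]
  let toY : ∀ χ : B →ₐ[ℂ] ℂ, r ≤ ‖χ ⟨h, hh⟩‖ → Y := fun χ hχ =>
    ⟨WeakDual.CharacterSpace.equivAlgHom.symm χ, hχ⟩
  have hevY : ∀ χ hχ b, ev b (toY χ hχ) = χ b := fun χ hχ b => rfl
  have hχ₀r : r ≤ ‖χ₀ ⟨h, hh⟩‖ := by rw [hχ₀n]; linarith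
  have hv0 : 1 < ‖v (toY χ₀ hχ₀r)‖ := by
    rw [hvt, hevY, hχ₀n, log_exp, sub_self, mul_zero, cos_zero, mul_one]
    exact one_lt_exp_iff.2 (exp_pos _)
  have hv1 : ∀ χ hχ, ‖χ ⟨h, hh⟩‖ = ρ₁ ∨ ‖χ ⟨h, hh⟩‖ = ρ₂ → ‖v (toY χ hχ)‖ = 1 := by
    intro χ hχ h2
    rw [hvt, hevY]
    rcases h2 with h2 | h2
    · rw [h2, hκ1, cos_neg, cos_pi_div_two, mul_zero, exp_zero]
    · rw [h2, hκ2, cos_pi_div_two, mul_zero, exp_zero]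
  set ε := (‖v (toY χ₀ hχ₀r)‖ - 1) / 2 with hε
  have hε0 : 0 < ε := by rw [hε]; linarith
  obtain ⟨F, ⟨j, b, hb⟩, hF⟩ := Metric.mem_closure_iff.1 hv ε hε0
  rw [dist_eq_norm] at hF
  have hbF : ∀ χ hχ, χ b = χ ⟨h, hh⟩ ^ j * F (toY χ hχ) := by
    intro χ hχ
    have := congrArg (fun f : C(Y, ℂ) => f (toY χ hχ)) hb
    exact this
  have hFv : ∀ y, ‖v y - F y‖ < ε := fun y => ((v - F).norm_coe_le_norm y).trans_lt hF
  have hfin := norm_character_le_of_annulus hB (a := b) (h := ⟨h, hh⟩) h1 hρ0 hρ₂' (s := 1 + ε)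
    (by linarith) (k := j) (fun χ hχ => by
      have hχr : r ≤ ‖χ ⟨h, hh⟩‖ := by rcases hχ with h2 | h2 <;> rw [h2] <;> linarith
      have hpos : 0 < ‖χ ⟨h, hh⟩‖ := hr0.trans_le hχr
      rw [hbF χ hχr, norm_mul, norm_pow, mul_comm]
      refine mul_lt_mul_of_pos_right ?_ (pow_pos hpos _)
      have h3 := hv1 χ hχr hχ
      have h4 := hFv (toY χ hχr)
      have h5 := norm_sub_norm_le (F (toY χ hχr)) (v (toY χ hχr))
      rw [norm_sub_rev] at h5
      linarith) χ₀ (by rw [hχ₀n]; exact hm1) (by rw [hχ₀n]; exact hm2)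
  rw [hbF χ₀ hχ₀r, norm_mul, norm_pow, mul_comm] at hfin
  have hpos : 0 < ‖χ₀ ⟨h, hh⟩‖ := hr0.trans_le hχ₀r
  have h2 := le_of_mul_le_mul_right hfin (pow_pos hpos _)
  have h4 := hFv (toY χ₀ hχ₀r)
  have h5 := norm_sub_norm_le (v (toY χ₀ hχ₀r)) (F (toY χ₀ hχ₀r))
  linarith

end Logarithm

end

section

open MeasureTheory Real

/-- A compact set fibred by a polynomially approximable unimodular function with a continuous
logarithm is polynomially convex if all the fibres are. -/
theorem hullOf_subset_of_fibers {n : ℕ} {E : Set (Fin n → ℂ)} [CompactSpace E] {h : C(E, ℂ)}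
    (hh : h ∈ polyAlg E) (h1 : ∀ x, ‖h x‖ = 1) (τ : C(E, ℂ)) (hτ : ∀ x, h x = Complex.exp (τ x))
    (hnull : ∀ c i, volume ((fun z : Fin n → ℂ => z i) '' (Subtype.val '' {x | h x = c})) = 0)
    (hfib : ∀ c, hullOf (Subtype.val '' {x | h x = c}) ⊆ Subtype.val '' {x | h x = c}) :
    hullOf E ⊆ E := by
  have hcol : polyAlg E ≤ ((polyAlg E).colon hh).topologicalClosure :=
    ((polyAlg E).le_colon hh).trans (Subalgebra.le_topologicalClosure _)
  have hstar : h * star h = 1 := by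
    ext x
    change h x * (starRingEnd ℂ) (h x) = 1
    rw [Complex.mul_conj, Complex.normSq_eq_norm_sq, h1]
    norm_num
  have hd : ((polyAlg E).colon hh).topologicalClosure = ⊤ := by
    refine Subalgebra.eq_top_of_dense_on_fibers (Subalgebra.isClosed_topologicalClosure _)
      (hcol hh) (Subalgebra.le_topologicalClosure _
        ((polyAlg E).mem_colon_of_mul_eq_one hh hstar)) fun c φ ε hε => ?_
    obtain ⟨a, ha, hφ⟩ := exists_mem_polyAlg_near (hnull c)
      (isClosed_eq h.continuous continuous_const) (hfib c) φ hε
    exact ⟨a, hcol ha, hφ⟩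
  obtain ⟨g, hg, hhg⟩ := zero_mem_funResolvent_of_log isClosed_polyAlg hh h1 hd τ hτ
  have hgh : g * h = 1 := by
    ext x
    have := hhg x
    rw [sub_zero, mul_comm] at this
    exact this
  have hle : (polyAlg E).colon hh ≤ polyAlg E := by
    rintro f ⟨k, hk⟩
    have := mul_mem (pow_mem hg k) hk
    rwa [← mul_assoc, ← mul_pow, hgh, one_pow, one_mul] at this
  have htop : polyAlg E = ⊤ := by
    rw [eq_top_iff, ← hd]
    exact Subalgebra.topologicalClosure_minimal hle isClosed_polyAlg
  intro x hx
  obtain ⟨χ, rfl⟩ := exists_character_of_mem_hullOf hx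
  have h1' : ((polyAlg E).colon (1 : polyAlg E).2).topologicalClosure = ⊤ := by
    rw [eq_top_iff, ← htop]
    exact ((polyAlg E).le_colon _).trans (Subalgebra.le_topologicalClosure _)
  obtain ⟨y, hy⟩ := exists_eval_of_norm_eq_one isClosed_polyAlg (h := 1)
    (fun x => norm_one) h1' χ (by rw [map_one, norm_one])
  have : charPoint χ = y.1 := by
    funext i
    change χ _ = _
    rw [hy]
    simp
  rw [this]
  exact y.2

end

section

open MeasureTheory Real

section Cauchy

variable {V W : Type*} [NormedAddCommGroup V] [NormedSpace ℂ V] [NormedAddCommGroup W]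
  [NormedSpace ℂ W]

theorem norm_fderiv_le_of_forall_norm_le {f : V → W} {c : V} {R M : ℝ} (hR : 0 < R)
    (hf : DifferentiableOn ℂ f (Metric.ball c R)) (hM : ∀ z ∈ Metric.ball c R, ‖f z‖ ≤ M) :
    ‖fderiv ℂ f c‖ ≤ 2 * M / R := by
  refine Complex.norm_fderiv_le_div_of_mapsTo_ball hf (fun z hz => ?_) hR
  rw [mem_closedBall_iff_norm]
  refine (norm_sub_le _ _).trans ?_
  linarith [hM z hz, hM c (Metric.mem_ball_self hR)]

theorem norm_fderiv_sub_le_of_forall_norm_le {f : V → W} (hf : ContDiff ℂ 2 f) {c : V}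
    {δ M : ℝ} (hδ : 0 < δ) (hM : ∀ z ∈ Metric.ball c (4 * δ), ‖f z‖ ≤ M) {z w : V}
    (hz : z ∈ Metric.ball c δ) (hw : w ∈ Metric.ball c δ) :
    ‖fderiv ℂ f z - fderiv ℂ f w‖ ≤ 2 * M / δ ^ 2 * ‖z - w‖ := by
  have hd : Differentiable ℂ f := hf.differentiable (by norm_num)
  have hd' : Differentiable ℂ (fderiv ℂ f) :=
    (hf.fderiv_right (m := 1) (by norm_num)).differentiable (by norm_num)
  have h1 : ∀ x ∈ Metric.ball c (2 * δ), ‖fderiv ℂ f x‖ ≤ M / δ := by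
    intro x hx
    refine (norm_fderiv_le_of_forall_norm_le (R := 2 * δ) (M := M) (by positivity)
      hd.differentiableOn fun y hy => hM y ?_).trans_eq (by field_simp)
    rw [Metric.mem_ball] at hx hy ⊢
    linarith [dist_triangle y x c]
  have h2 : ∀ x ∈ Metric.ball c δ, ‖fderiv ℂ (fderiv ℂ f) x‖ ≤ 2 * M / δ ^ 2 := by
    intro x hx
    refine (norm_fderiv_le_of_forall_norm_le (R := δ) (M := M / δ) (by positivity)
      hd'.differentiableOn fun y hy => h1 y ?_).trans_eq (by field_simp)
    rw [Metric.mem_ball] at hx hy ⊢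
    linarith [dist_triangle y x c]
  have : NormedSpace ℝ V := NormedSpace.restrictScalars ℝ ℂ V
  exact Convex.norm_image_sub_le_of_norm_fderiv_le (𝕜 := ℂ) (fun x _ => hd' x) h2
    (convex_ball c δ) hw hz

end Cauchy

variable {n : ℕ} {Ω : Set (Fin n → ℂ)} {h : (Fin n → ℂ) → ℂ}

theorem RungeDomain.locallyLipschitzOn_fderiv (hΩ : RungeDomain n Ω) (hh : DifferentiableOn ℂ h Ω) :
    LocallyLipschitzOn Ω (fderiv ℂ h) := by
  intro c hc
  obtain ⟨R, hR, hRΩ⟩ := Metric.isOpen_iff.1 hΩ.1 c hc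
  set δ := R / 5 with hδR
  have hδ : 0 < δ := by positivity
  have hball : Metric.closedBall c (4 * δ) ⊆ Ω :=
    (Metric.closedBall_subset_ball (by linarith)).trans hRΩ
  obtain ⟨M, hM⟩ := (isCompact_closedBall c (4 * δ)).exists_bound_of_continuousOn
    (hh.continuousOn.mono hball)
  have hM0 : 0 ≤ M := (norm_nonneg _).trans (hM c (Metric.mem_closedBall_self (by positivity)))
  refine ⟨⟨2 * (M + 1) / δ ^ 2, by positivity⟩, Metric.ball c δ,
    mem_nhdsWithin_of_mem_nhds (Metric.ball_mem_nhds c hδ), ?_⟩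
  refine LipschitzOnWith.of_dist_le_mul fun z hz w hw => ?_
  rw [dist_eq_norm, dist_eq_norm]
  refine le_of_forall_pos_le_add fun ε hε => ?_
  have hη : 0 < min 1 (ε * δ / 4) := by positivity
  obtain ⟨p, hp⟩ := hΩ.2.2 h hh _ hball (isCompact_closedBall c (4 * δ)) _ hη
  have hpd : ContDiff ℂ 2 (fun z : Fin n → ℂ => MvPolynomial.eval z p) :=
    contDiffOn_univ.1 ((AnalyticOnNhd.eval_mvPolynomial p).contDiffOn uniqueDiffOn_univ)
  have h1 := norm_fderiv_sub_le_of_forall_norm_le hpd hδ (M := M + 1) (fun x hx => by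
    have hx' := Metric.ball_subset_closedBall hx
    have e1 := norm_sub_norm_le (MvPolynomial.eval x p) (h x)
    rw [norm_sub_rev] at e1
    linarith [hM x hx', hp x hx', min_le_left 1 (ε * δ / 4)]) hz hw
  have h2 : ∀ x ∈ Metric.ball c δ,
      ‖fderiv ℂ h x - fderiv ℂ (fun z : Fin n → ℂ => MvPolynomial.eval z p) x‖ ≤ ε / 2 := by
    intro x hx
    have hsub : Metric.ball x δ ⊆ Metric.closedBall c (4 * δ) := fun y hy => by
      rw [Metric.mem_ball] at hx hy
      rw [Metric.mem_closedBall]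
      linarith [dist_triangle y x c]
    have hxh : DifferentiableAt ℂ h x := hh.differentiableAt
      (hΩ.1.mem_nhds (hball (hsub (Metric.mem_ball_self hδ))))
    have hpd' : Differentiable ℂ (fun z : Fin n → ℂ => MvPolynomial.eval z p) :=
      hpd.differentiable (by norm_num)
    have e1 : fderiv ℂ (fun z => h z - MvPolynomial.eval z p) x = _ :=
      fderiv_fun_sub hxh (hpd' x)
    rw [← e1]
    refine (norm_fderiv_le_of_forall_norm_le hδ
      ((hh.mono (hsub.trans hball)).sub hpd'.differentiableOn)
      fun y hy => (hp y (hsub hy)).trans (min_le_right _ _)).trans_eq (by field_simp; norm_num)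
  have h3 := h2 z hz
  have h4 := h2 w hw
  rw [norm_sub_rev] at h4
  generalize fderiv ℂ (fun z : Fin n → ℂ => MvPolynomial.eval z p) z = a at *
  generalize fderiv ℂ (fun z : Fin n → ℂ => MvPolynomial.eval z p) w = b at *
  have h5 : fderiv ℂ h z - fderiv ℂ h w =
      (fderiv ℂ h z - a) + (a - b) + (b - fderiv ℂ h w) := by abel
  rw [h5]
  refine (norm_add₃_le).trans ?_
  change _ ≤ 2 * (M + 1) / δ ^ 2 * ‖z - w‖ + ε
  linarith

theorem RungeDomain.contDiffAt (hΩ : RungeDomain n Ω) (hh : DifferentiableOn ℂ h Ω)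
    {z : Fin n → ℂ} (hz : z ∈ Ω) : ContDiffAt ℂ 1 h z :=
  contDiffAt_one_iff.2 ⟨fderiv ℂ h, Ω, hΩ.1.mem_nhds hz,
    (hΩ.locallyLipschitzOn_fderiv hh).continuousOn,
    fun _ hx => (hh.differentiableAt (hΩ.1.mem_nhds hx)).hasFDerivAt⟩

end

section

open MeasureTheory Real

theorem norm_image_sub_sub_fderiv_le {W : Type*} [NormedAddCommGroup W] [NormedSpace ℝ W]
    {Q : Set (ℝ × ℝ)} (hQ : Convex ℝ Q) {f : ℝ × ℝ → W} (hf : ∀ x ∈ Q, DifferentiableAt ℝ f x)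
    {L : NNReal} (hL : LipschitzOnWith L (fderiv ℝ f) Q) {x z w : ℝ × ℝ} (hx : x ∈ Q) (hz : z ∈ Q)
    (hw : w ∈ Q) :
    ‖f z - f w - fderiv ℝ f x (z - w)‖ ≤ L * (‖z - x‖ + ‖w - x‖) * ‖z - w‖ := by
  set R := ‖z - x‖ + ‖w - x‖
  have hzR : z ∈ Q ∩ Metric.closedBall x R :=
    ⟨hz, by rw [mem_closedBall_iff_norm]; exact le_add_of_nonneg_right (norm_nonneg _)⟩
  have hwR : w ∈ Q ∩ Metric.closedBall x R :=
    ⟨hw, by rw [mem_closedBall_iff_norm]; exact le_add_of_nonneg_left (norm_nonneg _)⟩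
  refine Convex.norm_image_sub_le_of_norm_fderiv_le' (𝕜 := ℝ) (fun y hy => hf y hy.1)
    (fun y hy => ?_) (hQ.inter (convex_closedBall x R)) hwR hzR
  have h1 := hL.norm_sub_le hy.1 hx
  have h2 := mem_closedBall_iff_norm.1 hy.2
  exact h1.trans (mul_le_mul_of_nonneg_left h2 L.2)

theorem exists_kernel_vector {D : ℝ × ℝ →L[ℝ] ℂ} {w : ℂ} (hw : ‖w‖ = 1)
    (hD : ∀ v, ((starRingEnd ℂ) w * D v).re = 0) (hD0 : D ≠ 0) :
    ∃ v₀, v₀ ≠ 0 ∧ D v₀ = 0 ∧ ∀ v, ∃ κ : ℝ, ‖D‖ * ‖v - κ • v₀‖ ≤ 2 * ‖D v‖ := by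
  have hww : w * (starRingEnd ℂ) w = 1 := by
    rw [Complex.mul_conj, Complex.normSq_eq_norm_sq, hw]; norm_num
  set α := ((starRingEnd ℂ) w * D (1, 0)).im with hα
  set β := ((starRingEnd ℂ) w * D (0, 1)).im with hβ
  have h1 : ∀ v, (starRingEnd ℂ) w * D v = ((v.1 * α + v.2 * β : ℝ) : ℂ) * Complex.I := by
    intro v
    have e1 : v = v.1 • ((1, 0) : ℝ × ℝ) + v.2 • ((0, 1) : ℝ × ℝ) := by ext <;> simp
    have e2 : D v = v.1 * D (1, 0) + v.2 * D (0, 1) := by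
      conv_lhs => rw [e1, map_add, map_smul, map_smul]
      simp
    apply Complex.ext
    · rw [hD]; simp
    · rw [e2]
      simp [hα, hβ, Complex.mul_im, Complex.mul_re]
      ring
  have hDv : ∀ v, ‖D v‖ = |v.1 * α + v.2 * β| := by
    intro v
    have := congrArg norm (h1 v)
    rwa [norm_mul, norm_mul, Complex.norm_I, mul_one, Complex.norm_real, RCLike.norm_conj, hw,
      one_mul, Real.norm_eq_abs] at this
  have hab : α ≠ 0 ∨ β ≠ 0 := by
    by_contra! hcon
    refine hD0 (ContinuousLinearMap.ext fun v => ?_)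
    change D v = 0
    rw [← norm_eq_zero, hDv, hcon.1, hcon.2]
    simp
  have hs : 0 < α ^ 2 + β ^ 2 := by
    rcases hab with h | h <;> positivity
  have hDn : ‖D‖ ≤ |α| + |β| := by
    refine D.opNorm_le_bound (by positivity) fun v => ?_
    rw [hDv]
    refine (abs_add_le _ _).trans ?_
    rw [abs_mul, abs_mul]
    have e1 : |v.1| ≤ ‖v‖ := norm_fst_le v
    have e2 : |v.2| ≤ ‖v‖ := norm_snd_le v
    nlinarith [abs_nonneg α, abs_nonneg β]
  refine ⟨(-β, α), fun h0 => ?_, ?_, fun v => ⟨(-β * v.1 + α * v.2) / (α ^ 2 + β ^ 2), ?_⟩⟩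
  · rw [Prod.mk_eq_zero] at h0
    rcases hab with h | h
    · exact h h0.2
    · exact h (neg_eq_zero.1 h0.1)
  · rw [← norm_eq_zero, hDv, abs_eq_zero]
    ring
  · set μ := (v.1 * α + v.2 * β) / (α ^ 2 + β ^ 2) with hμ
    have e1 : v - ((-β * v.1 + α * v.2) / (α ^ 2 + β ^ 2)) • ((-β, α) : ℝ × ℝ) =
        (μ * α, μ * β) := by
      ext
      · simp [hμ]; field_simp; ring
      · simp [hμ]; field_simp; ring
    have e2 : ‖D v‖ = |μ| * (α ^ 2 + β ^ 2) := by
      rw [hDv, hμ, abs_div, abs_of_pos hs, div_mul_cancel₀ _ hs.ne']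
    rw [e1, e2, Prod.norm_mk, norm_eq_abs, norm_eq_abs, abs_mul, abs_mul,
      ← mul_max_of_nonneg _ _ (abs_nonneg _)]
    have e3 : (|α| + |β|) * max |α| |β| ≤ 2 * (α ^ 2 + β ^ 2) := by
      rw [← sq_abs α, ← sq_abs β]
      rcases max_cases |α| |β| with ⟨h, _⟩ | ⟨h, _⟩ <;> rw [h] <;>
        nlinarith [abs_nonneg α, abs_nonneg β, sq_nonneg (|α| - |β|)]
    calc ‖D‖ * (|μ| * max |α| |β|) ≤ (|α| + |β|) * (|μ| * max |α| |β|) :=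
          mul_le_mul_of_nonneg_right hDn (by positivity)
      _ = |μ| * ((|α| + |β|) * max |α| |β|) := by ring
      _ ≤ |μ| * (2 * (α ^ 2 + β ^ 2)) := mul_le_mul_of_nonneg_left e3 (abs_nonneg _)
      _ = _ := by ring

/-- An embedded disc `φ` over `Q` with a unimodular function `F` without critical points. -/
structure IsUnimodularDisc (Q : Set (ℝ × ℝ)) (φ : ℝ × ℝ → Fin 2 → ℂ) (F : ℝ × ℝ → ℂ) : Prop where
  isCompact : IsCompact Q
  convex : Convex ℝ Q
  injOn : Set.InjOn φ Q
  differentiableAt : ∀ x ∈ Q, DifferentiableAt ℝ φ x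
  lipschitz : ∃ L, LipschitzOnWith L (fderiv ℝ φ) Q
  injective_fderiv : ∀ x ∈ Q, Function.Injective (fderiv ℝ φ x)
  norm_eq_one : ∀ x ∈ Q, ‖F x‖ = 1
  differentiableAt' : ∀ x ∈ Q, DifferentiableAt ℝ F x
  lipschitz' : ∃ L, LipschitzOnWith L (fderiv ℝ F) Q
  fderiv_ne_zero : ∀ x ∈ Q, fderiv ℝ F x ≠ 0
  re_eq_zero : ∀ x ∈ Q, ∀ v, ((starRingEnd ℂ) (F x) * fderiv ℝ F x v).re = 0

namespace IsUnimodularDisc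

variable {Q : Set (ℝ × ℝ)} {φ : ℝ × ℝ → Fin 2 → ℂ} {F : ℝ × ℝ → ℂ}

theorem continuousOn (hd : IsUnimodularDisc Q φ F) : ContinuousOn φ Q := fun x hx =>
  (hd.differentiableAt x hx).continuousAt.continuousWithinAt

theorem continuousOn' (hd : IsUnimodularDisc Q φ F) : ContinuousOn F Q := fun x hx =>
  (hd.differentiableAt' x hx).continuousAt.continuousWithinAt

theorem exists_norm_fderiv_ge (hd : IsUnimodularDisc Q φ F) :
    ∃ m > 0, ∀ x ∈ Q, ∀ v, m * ‖v‖ ≤ ‖fderiv ℝ φ x v‖ := by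
  obtain ⟨L, hL⟩ := hd.lipschitz
  have hc : ContinuousOn (fun p : (ℝ × ℝ) × (ℝ × ℝ) => ‖fderiv ℝ φ p.1 p.2‖)
      (Q ×ˢ Metric.sphere 0 1) :=
    ((hL.continuousOn.comp continuousOn_fst fun p hp => hp.1).clm_apply continuousOn_snd).norm
  have hK := hd.isCompact.prod (isCompact_sphere (0 : ℝ × ℝ) 1)
  obtain ⟨m, hm, H⟩ : ∃ m > 0, ∀ p ∈ Q ×ˢ Metric.sphere (0 : ℝ × ℝ) 1,
      m ≤ ‖fderiv ℝ φ p.1 p.2‖ := by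
    refine hK.exists_forall_le' hc fun p hp => norm_pos_iff.2 fun h0 => ?_
    have := hd.injective_fderiv p.1 hp.1 (h0.trans (map_zero _).symm)
    have h2 := hp.2
    rw [this] at h2
    simp at h2
  refine ⟨m, hm, fun x hx v => ?_⟩
  rcases eq_or_ne v 0 with rfl | hv
  · simp
  have h1 := H (x, ‖v‖⁻¹ • v) ⟨hx, by
    rw [mem_sphere_zero_iff_norm, norm_smul, norm_inv, norm_norm, inv_mul_cancel₀]
    exact norm_ne_zero_iff.2 hv⟩
  change m ≤ ‖fderiv ℝ φ x (‖v‖⁻¹ • v)‖ at h1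
  rw [map_smul, norm_smul, norm_inv, norm_norm, inv_mul_eq_div, le_div_iff₀ (norm_pos_iff.2 hv)]
    at h1
  exact h1

theorem exists_norm_sub_ge (hd : IsUnimodularDisc Q φ F) :
    ∃ c > 0, ∀ z ∈ Q, ∀ w ∈ Q, c * ‖z - w‖ ≤ ‖φ z - φ w‖ := by
  obtain ⟨m, hm, hmv⟩ := hd.exists_norm_fderiv_ge
  obtain ⟨L, hL⟩ := hd.lipschitz
  set r := m / (2 * (L + 1)) with hr
  have hL0 : (0 : ℝ) ≤ L := L.2
  have hr0 : 0 < r := by positivity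
  have hK : IsCompact ((Q ×ˢ Q) ∩ {p : (ℝ × ℝ) × (ℝ × ℝ) | r ≤ ‖p.1 - p.2‖}) :=
    (hd.isCompact.prod hd.isCompact).inter_right (isClosed_le (by fun_prop) (by fun_prop))
  have hc : ContinuousOn (fun p : (ℝ × ℝ) × (ℝ × ℝ) => ‖φ p.1 - φ p.2‖)
      ((Q ×ˢ Q) ∩ {p : (ℝ × ℝ) × (ℝ × ℝ) | r ≤ ‖p.1 - p.2‖}) :=
    ((hd.continuousOn.comp continuousOn_fst fun p hp => hp.1.1).sub
      (hd.continuousOn.comp continuousOn_snd fun p hp => hp.1.2)).norm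
  obtain ⟨e, he, H⟩ := hK.exists_forall_le' hc (a := 0) (fun p hp => norm_pos_iff.2 fun h0 => by
    have h1 := hd.injOn hp.1.1 hp.1.2 (sub_eq_zero.1 h0)
    have h2 : r ≤ ‖p.1 - p.2‖ := hp.2
    rw [h1, sub_self, norm_zero] at h2
    linarith)
  obtain ⟨R, hR⟩ := hd.isCompact.isBounded.exists_norm_le
  have hR1 : 0 < 2 * |R| + 1 := by positivity
  refine ⟨min (m / 2) (e / (2 * |R| + 1)), by positivity, fun z hz w hw => ?_⟩
  rcases le_or_gt r ‖z - w‖ with h | h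
  · have h1 : e ≤ ‖φ z - φ w‖ := H (z, w) ⟨⟨hz, hw⟩, h⟩
    have h2 : ‖z - w‖ ≤ 2 * |R| + 1 := by
      have := norm_sub_le z w
      linarith [hR z hz, hR w hw, le_abs_self R]
    calc _ ≤ e / (2 * |R| + 1) * (2 * |R| + 1) :=
          mul_le_mul (min_le_right _ _) h2 (norm_nonneg _) (by positivity)
      _ = e := div_mul_cancel₀ _ hR1.ne'
      _ ≤ _ := h1
  · have h1 := norm_image_sub_sub_fderiv_le hd.convex hd.differentiableAt hL hw hz hw
    rw [sub_self, norm_zero, add_zero] at h1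
    have h2 := hmv w hw (z - w)
    have h3 := norm_sub_norm_le (fderiv ℝ φ w (z - w)) (φ z - φ w)
    rw [norm_sub_rev (fderiv ℝ φ w (z - w))] at h3
    have h4 : L * ‖z - w‖ ≤ m / 2 := by
      have : L * r ≤ m / 2 := by
        rw [hr, mul_div_assoc', div_le_div_iff₀ (by positivity) (by norm_num)]
        nlinarith
      nlinarith
    have h5 : L * ‖z - w‖ * ‖z - w‖ ≤ m / 2 * ‖z - w‖ :=
      mul_le_mul_of_nonneg_right h4 (norm_nonneg _)
    have h6 : min (m / 2) (e / (2 * |R| + 1)) * ‖z - w‖ ≤ m / 2 * ‖z - w‖ :=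
      mul_le_mul_of_nonneg_right (min_le_left _ _) (norm_nonneg _)
    linarith

theorem exists_norm_fderiv_ge' (hd : IsUnimodularDisc Q φ F) :
    ∃ m > 0, ∀ x ∈ Q, m ≤ ‖fderiv ℝ F x‖ := by
  obtain ⟨L, hL⟩ := hd.lipschitz'
  exact hd.isCompact.exists_forall_le' hL.continuousOn.norm fun x hx =>
    norm_pos_iff.2 (hd.fderiv_ne_zero x hx)

theorem exists_isTangentField (hd : IsUnimodularDisc Q φ F) :
    ∃ (T : (Fin 2 → ℂ) → Fin 2 → ℂ) (C : ℝ),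
      (∀ c, IsTangentField (φ '' {x ∈ Q | F x = c}) T C) ∧
      ∀ x ∈ Q, ∃ v, T (φ x) = fderiv ℝ φ x v ∧ fderiv ℝ F x v = 0 := by
  obtain ⟨m, hm, hmv⟩ := hd.exists_norm_fderiv_ge
  obtain ⟨m', hm', hmv'⟩ := hd.exists_norm_fderiv_ge'
  obtain ⟨e, he, hev⟩ := hd.exists_norm_sub_ge
  obtain ⟨L, hL⟩ := hd.lipschitz
  obtain ⟨L', hL'⟩ := hd.lipschitz'
  obtain ⟨M, hM⟩ := hd.isCompact.exists_bound_of_continuousOn hL.continuousOn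
  have hex : ∀ x : Q, _ := fun x => exists_kernel_vector (hd.norm_eq_one x.1 x.2)
    (hd.re_eq_zero x.1 x.2) (hd.fderiv_ne_zero x.1 x.2)
  choose v hv0 hv hκ using hex
  have hvn : ∀ x : Q, 0 < ‖fderiv ℝ φ x.1 (v x)‖ := fun x =>
    (mul_pos hm (norm_pos_iff.2 (hv0 x))).trans_le (hmv x.1 x.2 _)
  let t : Q → ℝ × ℝ := fun x => ‖fderiv ℝ φ x.1 (v x)‖⁻¹ • v x
  classical
  let T : (Fin 2 → ℂ) → Fin 2 → ℂ := fun q =>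
    if hq : q ∈ φ '' Q then fderiv ℝ φ hq.choose (t ⟨hq.choose, hq.choose_spec.1⟩) else 0
  have hT : ∀ x : Q, T (φ x.1) = fderiv ℝ φ x.1 (t x) := by
    intro x
    have hq : φ x.1 ∈ φ '' Q := ⟨x.1, x.2, rfl⟩
    have h1 : (⟨hq.choose, hq.choose_spec.1⟩ : Q) = x :=
      Subtype.ext (hd.injOn hq.choose_spec.1 x.2 hq.choose_spec.2)
    change (if hq : φ x.1 ∈ φ '' Q then
      fderiv ℝ φ hq.choose (t ⟨hq.choose, hq.choose_spec.1⟩) else 0) = _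
    rw [dif_pos hq]
    change fderiv ℝ φ (⟨hq.choose, hq.choose_spec.1⟩ : Q).1 (t ⟨hq.choose, hq.choose_spec.1⟩) = _
    rw [h1]
  refine ⟨T, (L + M * (2 * L' / m')) / e ^ 2, fun c => ⟨?_, ?_⟩, fun x hx =>
    ⟨t ⟨x, hx⟩, hT ⟨x, hx⟩, by
      rw [map_smul]
      exact (congrArg _ (hv ⟨x, hx⟩)).trans (smul_zero _)⟩⟩
  · rintro _ ⟨x, ⟨hx, -⟩, rfl⟩
    rw [hT ⟨x, hx⟩, map_smul, norm_smul, norm_inv, norm_norm]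
    exact inv_mul_cancel₀ (hvn ⟨x, hx⟩).ne'
  · rintro _ ⟨x, ⟨hx, -⟩, rfl⟩ _ ⟨z, ⟨hz, hzc⟩, rfl⟩ _ ⟨w, ⟨hw, hwc⟩, rfl⟩
    obtain ⟨κ, hκx⟩ := hκ ⟨x, hx⟩ (z - w)
    refine ⟨κ * ‖fderiv ℝ φ x (v ⟨x, hx⟩)‖, ?_⟩
    have h1 := norm_image_sub_sub_fderiv_le hd.convex hd.differentiableAt hL hx hz hw
    have h2 := norm_image_sub_sub_fderiv_le hd.convex hd.differentiableAt' hL' hx hz hw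
    rw [hzc, hwc, sub_self, zero_sub, norm_neg] at h2
    have hM0 : 0 ≤ M := (norm_nonneg _).trans (hM x hx)
    set S := ‖z - x‖ + ‖w - x‖
    have hS : 0 ≤ S := by positivity
    have h3 : ‖z - w - κ • v ⟨x, hx⟩‖ ≤ 2 * L' / m' * (S * ‖z - w‖) := by
      have h4 := mul_le_mul_of_nonneg_right (hmv' x hx) (norm_nonneg (z - w - κ • v ⟨x, hx⟩))
      rw [div_mul_eq_mul_div, le_div_iff₀ hm']
      dsimp only at hκx
      linarith
    have h5 : ‖fderiv ℝ φ x (z - w - κ • v ⟨x, hx⟩)‖ ≤ M * (2 * L' / m' * (S * ‖z - w‖)) :=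
      ((fderiv ℝ φ x).le_opNorm _).trans (mul_le_mul (hM x hx) h3 (norm_nonneg _) hM0)
    have h6 : φ z - φ w - ((κ * ‖fderiv ℝ φ x (v ⟨x, hx⟩)‖ : ℝ) : ℂ) • T (φ x) =
        (φ z - φ w - fderiv ℝ φ x (z - w)) + fderiv ℝ φ x (z - w - κ • v ⟨x, hx⟩) := by
      have h7 : fderiv ℝ φ x (z - w - κ • v ⟨x, hx⟩) =
        fderiv ℝ φ x (z - w) - fderiv ℝ φ x (κ • v ⟨x, hx⟩) := map_sub _ _ _
      rw [hT ⟨x, hx⟩, Complex.coe_smul, ← map_smul, smul_smul, mul_assoc,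
        mul_inv_cancel₀ (hvn ⟨x, hx⟩).ne', mul_one, h7]
      abel
    rw [h6]
    have h7 := hev z hz w hw
    have h8 : e * S ≤ ‖φ z - φ x‖ + ‖φ w - φ x‖ := by
      rw [mul_add]
      exact add_le_add (hev z hz x hx) (hev w hw x hx)
    have h9 : e ^ 2 * (S * ‖z - w‖) ≤ (‖φ z - φ x‖ + ‖φ w - φ x‖) * ‖φ z - φ w‖ := by
      calc e ^ 2 * (S * ‖z - w‖) = (e * S) * (e * ‖z - w‖) := by ring
        _ ≤ _ := mul_le_mul h8 h7 (by positivity) (by positivity)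
    calc _ ≤ L * S * ‖z - w‖ + M * (2 * L' / m' * (S * ‖z - w‖)) :=
          (norm_add_le _ _).trans (add_le_add h1 h5)
      _ = (L + M * (2 * L' / m')) / e ^ 2 * (e ^ 2 * (S * ‖z - w‖)) := by field_simp
      _ ≤ (L + M * (2 * L' / m')) / e ^ 2 * ((‖φ z - φ x‖ + ‖φ w - φ x‖) * ‖φ z - φ w‖) :=
          mul_le_mul_of_nonneg_left h9 (by positivity)
      _ = _ := by ring

end IsUnimodularDisc

end

section

open MeasureTheory Real

theorem volume_image_fiber_eq_zero {Z : Set (ℝ × ℝ)} {F f : ℝ × ℝ → ℂ} {c : ℂ}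
    (hc : ∀ x ∈ Z, F x = c) (hF : ∀ x ∈ Z, DifferentiableAt ℝ F x)
    (hF0 : ∀ x ∈ Z, fderiv ℝ F x ≠ 0) (hf : ∀ x ∈ Z, DifferentiableAt ℝ f x) :
    volume (f '' Z) = 0 := by
  have hex : ∀ x : Z, ∃ n, fderiv ℝ F x n ≠ 0 := fun x => by
    by_contra! h
    exact hF0 x.1 x.2 (ContinuousLinearMap.ext h)
  choose n hn using hex
  classical
  let A : ℝ × ℝ → ℂ := fun x => if hx : x ∈ Z then
    (fderiv ℝ F x (n ⟨x, hx⟩))⁻¹ * fderiv ℝ f x (n ⟨x, hx⟩) else 0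
  let D : ℝ × ℝ → (ℝ × ℝ →L[ℝ] ℂ) := fun x => fderiv ℝ f x - A x • fderiv ℝ F x
  have hD : ∀ x ∈ Z, HasFDerivWithinAt f (D x) Z x := by
    intro x hx
    have h1 : HasFDerivWithinAt (fun y => f y - A x * F y + A x * c) (D x) Z x := by
      have h2 := (hF x hx).hasFDerivAt.const_mul (A x)
      exact (((hf x hx).hasFDerivAt.sub h2).add_const _).hasFDerivWithinAt
    refine h1.congr (fun y hy => ?_) ?_
    · change f y = f y - A x * F y + A x * c
      rw [hc y hy]; ring
    · rw [hc x hx]; ring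
  have hDn : ∀ x (hx : x ∈ Z), D x (n ⟨x, hx⟩) = 0 := by
    intro x hx
    have h1 : A x = (fderiv ℝ F x (n ⟨x, hx⟩))⁻¹ * fderiv ℝ f x (n ⟨x, hx⟩) := dif_pos hx
    have h2 := hn ⟨x, hx⟩
    change fderiv ℝ f x (n ⟨x, hx⟩) - A x * fderiv ℝ F x (n ⟨x, hx⟩) = 0
    rw [h1, mul_right_comm, inv_mul_cancel₀ h2, one_mul, sub_self]
  let e := Complex.equivRealProdCLM
  have himg : f '' Z = (f ∘ e) '' (e ⁻¹' Z) := by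
    rw [Set.image_comp, Set.image_preimage_eq _ e.surjective]
  rw [himg]
  refine addHaar_image_eq_zero_of_det_fderivWithin_eq_zero volume
    (f' := fun x => (D (e x)).comp (e : ℂ →L[ℝ] ℝ × ℝ)) (fun x hx => ?_) (fun x hx => ?_)
  · exact (hD (e x) hx).comp x e.hasFDerivAt.hasFDerivWithinAt fun y hy => hy
  · have hx' : e x ∈ Z := hx
    rw [ContinuousLinearMap.det, LinearMap.det_eq_zero_iff_ker_ne_bot]
    intro hker
    have h1 : e.symm (n ⟨e x, hx'⟩) ∈
        LinearMap.ker ((D (e x)).comp (e : ℂ →L[ℝ] ℝ × ℝ) : ℂ →ₗ[ℝ] ℂ) := by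
      rw [LinearMap.mem_ker]
      change D (e x) (e (e.symm (n ⟨e x, hx'⟩))) = 0
      rw [e.apply_symm_apply]
      exact hDn _ hx'
    rw [hker, Submodule.mem_bot] at h1
    have h2 : n ⟨e x, hx'⟩ = 0 := by
      rw [← e.apply_symm_apply (n ⟨e x, hx'⟩), h1, map_zero]
    exact hn ⟨e x, hx'⟩ (by rw [h2, map_zero])

end

section

open MeasureTheory Real

namespace ContinuousMap

variable {X : Type*} [TopologicalSpace X]

theorem isSquare_of_mem_slitPlane {f : C(X, ℂ)} (hf : ∀ x, f x ∈ Complex.slitPlane) :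
    IsSquare f := by
  refine ⟨⟨fun x => Complex.exp (Complex.log (f x) / 2), ?_⟩, ?_⟩
  · exact Complex.continuous_exp.comp
      ((f.continuous.clog fun x => hf x).div_const 2)
  · ext x
    change f x = Complex.exp _ * Complex.exp _
    rw [← Complex.exp_add, add_halves, Complex.exp_log (Complex.slitPlane_ne_zero (hf x))]

theorem isSquare_const (a : ℂ) : IsSquare (const X a) := by
  obtain ⟨b, hb⟩ := IsAlgClosed.exists_eq_mul_self a
  exact ⟨const X b, by ext x; simpa using hb⟩

theorem isSquare_of_mul {f g : C(X, ℂ)} (hfg : IsSquare (f * g)) (hg : IsSquare g)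
    (hg0 : ∀ x, g x ≠ 0) : IsSquare f := by
  obtain ⟨a, ha⟩ := hfg
  obtain ⟨b, hb⟩ := hg
  have hb0 : ∀ x, b x ≠ 0 := fun x h0 => hg0 x (by rw [hb, mul_apply, h0, zero_mul])
  refine ⟨⟨fun x => a x * (b x)⁻¹, a.continuous.mul (b.continuous.inv₀ hb0)⟩, ?_⟩
  ext x
  have h1 := DFunLike.congr_fun ha x
  have h2 := DFunLike.congr_fun hb x
  rw [mul_apply, mul_apply] at h1
  rw [mul_apply] at h2
  have h3 := hb0 x
  change f x = a x * (b x)⁻¹ * (a x * (b x)⁻¹)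
  field_simp
  rw [sq, sq, ← h1, ← h2]

theorem isSquare_of_norm_sub_lt {f g : C(X, ℂ)} (h : ∀ x, ‖f x - g x‖ < ‖g x‖)
    (hg : IsSquare g) : IsSquare f := by
  have hg0 : ∀ x, g x ≠ 0 := fun x h0 => by
    have := h x
    rw [h0, norm_zero] at this
    exact (norm_nonneg _).not_gt this
  let u : C(X, ℂ) := ⟨fun x => f x * (g x)⁻¹, f.continuous.mul (g.continuous.inv₀ hg0)⟩
  have hu : IsSquare u := isSquare_of_mem_slitPlane fun x => by
    refine Complex.ball_one_subset_slitPlane (mem_ball_iff_norm.2 ?_)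
    change ‖f x * (g x)⁻¹ - 1‖ < 1
    rw [← mul_inv_cancel₀ (hg0 x), ← sub_mul, norm_mul, norm_inv, ← div_eq_mul_inv,
      div_lt_one (norm_pos_iff.2 (hg0 x))]
    exact h x
  have hfu : f = u * g := by
    ext x
    exact (inv_mul_cancel_right₀ (hg0 x) (f x)).symm
  rw [hfu]
  exact hu.mul hg

theorem isSquare_aeval {w : C(X, ℂ)}
    (hw : ∀ a, (∀ x, w x ≠ a) → IsSquare (w - const X a)) {p : Polynomial ℂ}
    (hp : ∀ x, p.eval (w x) ≠ 0) : IsSquare (Polynomial.aeval w p) := by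
  have hx : ∀ x, Polynomial.aeval w p x = p.eval (w x) := fun x => by
    rw [Polynomial.aeval_continuousMap_apply]
  have h2 : Polynomial.aeval w p =
      const X p.leadingCoeff * (p.roots.map fun a => w - const X a).prod := by
    ext x
    rw [hx, (IsAlgClosed.splits p).eval_eq_prod_roots, mul_apply]
    congr 1
    have := map_multiset_prod (ContinuousMap.evalAlgHom ℂ ℂ x) (p.roots.map fun a => w - const X a)
    exact (this.trans (by rw [Multiset.map_map]; rfl)).symm
  rw [h2]
  refine (isSquare_const _).mul (Multiset.prod_induction _ _ (fun a b => IsSquare.mul)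
    IsSquare.one fun g hg => ?_)
  obtain ⟨a, ha, rfl⟩ := Multiset.mem_map.1 hg
  exact hw a fun x hxa => hp x (hxa ▸ (Polynomial.isRoot_of_mem_roots ha))

/-- The algebra of rational functions of `w` without poles. -/
def rationalAlg (w : C(X, ℂ)) : Subalgebra ℂ C(X, ℂ) where
  carrier := {f | ∃ p q : Polynomial ℂ, (∀ x, q.eval (w x) ≠ 0) ∧
    ∀ x, f x * q.eval (w x) = p.eval (w x)}
  mul_mem' := by
    rintro f g ⟨p, q, h, h'⟩ ⟨p₁, q₁, h₁, h₁'⟩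
    refine ⟨p * p₁, q * q₁, fun x => ?_, fun x => ?_⟩
    · rw [Polynomial.eval_mul]; exact mul_ne_zero (h x) (h₁ x)
    · rw [Polynomial.eval_mul, Polynomial.eval_mul, ← h', ← h₁', mul_apply]; ring
  add_mem' := by
    rintro f g ⟨p, q, h, h'⟩ ⟨p₁, q₁, h₁, h₁'⟩
    refine ⟨p * q₁ + p₁ * q, q * q₁, fun x => ?_, fun x => ?_⟩
    · rw [Polynomial.eval_mul]; exact mul_ne_zero (h x) (h₁ x)
    · rw [Polynomial.eval_mul, Polynomial.eval_add, Polynomial.eval_mul, Polynomial.eval_mul,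
        ← h', ← h₁', add_apply]
      ring
  algebraMap_mem' := fun r => ⟨Polynomial.C r, 1, fun x => by simp, fun x => by simp⟩

theorem isSquare_of_volume_range_eq_zero [CompactSpace X] {w : C(X, ℂ)} (hinj : Function.Injective w)
    (hnull : volume (Set.range w) = 0)
    (hw : ∀ a, (∀ x, w x ≠ a) → IsSquare (w - const X a)) {g : C(X, ℂ)} (hg : ∀ x, g x ≠ 0) :
    IsSquare g := by
  let B := (rationalAlg w).topologicalClosure
  have hB : IsClosed (B : Set C(X, ℂ)) := (rationalAlg w).isClosed_topologicalClosure
  have hwB : w ∈ B := subset_closure ⟨Polynomial.X, 1, fun x => by simp, fun x => by simp⟩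
  have hres : ∀ l, (∀ x, w x ≠ l) → l ∈ funResolvent B w := by
    intro l hl
    have h0 : ∀ x, w x - l ≠ 0 := fun x => sub_ne_zero.2 (hl x)
    refine ⟨⟨fun x => (w x - l)⁻¹, (w.continuous.sub continuous_const).inv₀ h0⟩,
      subset_closure ⟨1, Polynomial.X - Polynomial.C l, fun x => by simpa using h0 x,
        fun x => ?_⟩, fun x => mul_inv_cancel₀ (h0 x)⟩
    simpa using inv_mul_cancel₀ (h0 x)
  have htop : B = ⊤ := Subalgebra.eq_top_of_separates hB {w} (by simpa using hwB)
    (by simpa using star_mem_of_volume_range_eq_zero hB hwB hnull hres)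
    fun x y hxy => ⟨w, rfl, hinj.ne hxy⟩
  rcases isEmpty_or_nonempty X with hX | hX
  · exact ⟨g, by ext x; exact (hX.false x).elim⟩
  obtain ⟨m, hm, hmg⟩ : ∃ m > 0, ∀ x, m ≤ ‖g x‖ := by
    obtain ⟨x₀, h⟩ := (g.continuous.norm).exists_forall_le_of_hasCompactSupport
      (HasCompactSupport.of_compactSpace _)
    exact ⟨_, norm_pos_iff.2 (hg x₀), h⟩
  have hgB : g ∈ closure (rationalAlg w : Set C(X, ℂ)) := by
    have : g ∈ B := htop ▸ Algebra.mem_top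
    exact this
  obtain ⟨f, hf, hfg⟩ := Metric.mem_closure_iff.1 hgB (m / 2) (by positivity)
  have hfg' : ∀ x, ‖g x - f x‖ < m / 2 := fun x => by
    rw [dist_eq_norm] at hfg
    exact ((g - f).norm_coe_le_norm x).trans_lt hfg
  refine isSquare_of_norm_sub_lt (g := f) (fun x => ?_) ?_
  · have h1 := norm_sub_norm_le (g x) (f x)
    linarith [hmg x, hfg' x]
  · obtain ⟨p, q, hq, hpq⟩ := hf
    have hx : ∀ (p : Polynomial ℂ) x, Polynomial.aeval w p x = p.eval (w x) := fun p x => by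
      rw [Polynomial.aeval_continuousMap_apply]
    have hf0 : ∀ x, f x ≠ 0 := fun x h0 => by
      have h1 := hfg' x
      rw [h0, sub_zero] at h1
      linarith [hmg x]
    have h1 : f * Polynomial.aeval w q = Polynomial.aeval w p := by
      ext x
      rw [mul_apply, hx, hx, hpq]
    refine isSquare_of_mul (g := Polynomial.aeval w q) ?_ (isSquare_aeval hw hq) fun x => ?_
    · rw [h1]
      exact isSquare_aeval hw fun x => by rw [← hpq]; exact mul_ne_zero (hf0 x) (hq x)
    · rw [hx]; exact hq x

end ContinuousMap

end

section

open MeasureTheory Real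

theorem fderiv_eq_zero_of_isLocalExtr {W : Type*} [NormedAddCommGroup W] [NormedSpace ℝ W]
    {F : W → ℂ} {τ : W → ℝ} {z : W} (hF : DifferentiableAt ℝ F z) (hτ : ContinuousAt τ z)
    (hFτ : ∀ᶠ x in nhds z, F x = Complex.exp (τ x * Complex.I))
    (hre : ∀ v, ((starRingEnd ℂ) (F z) * fderiv ℝ F z v).re = 0) (hext : IsLocalExtr τ z) :
    fderiv ℝ F z = 0 := by
  let G : W → ℝ := fun x => ((starRingEnd ℂ) (F z) * F x).im
  have hz := hFτ.self_of_nhds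
  have hG : ∀ᶠ x in nhds z, G x = sin (τ x - τ z) := by
    filter_upwards [hFτ] with x hx
    have h1 : (starRingEnd ℂ) (F z) * F x = Complex.exp ((τ x - τ z : ℝ) * Complex.I) := by
      rw [hx, hz, ← Complex.exp_conj, ← Complex.exp_add]
      congr 1
      simp
      ring
    change ((starRingEnd ℂ) (F z) * F x).im = _
    rw [h1, Complex.exp_ofReal_mul_I_im]
  have hGz : G z = 0 := by rw [hG.self_of_nhds, sub_self, sin_zero]
  have hnear : ∀ᶠ x in nhds z, |τ x - τ z| < π := by
    have := Metric.continuousAt_iff'.1 hτ π pi_pos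
    simpa [Real.dist_eq] using this
  have hGext : IsLocalExtr G z := by
    rcases hext with h | h
    · refine Or.inl ?_
      filter_upwards [hG, hnear, h] with x hx hx' hx''
      rw [hGz, hx]
      rw [abs_lt] at hx'
      exact sin_nonneg_of_nonneg_of_le_pi (by linarith) (by linarith)
    · refine Or.inr ?_
      filter_upwards [hG, hnear, h] with x hx hx' hx''
      rw [hGz, hx]
      rw [abs_lt] at hx'
      exact sin_nonpos_of_nonpos_of_neg_pi_le (by linarith) (by linarith)
  have hGd : HasFDerivAt G (Complex.imCLM.comp ((starRingEnd ℂ) (F z) • fderiv ℝ F z)) z :=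
    Complex.imCLM.hasFDerivAt.comp z (hF.hasFDerivAt.const_mul _)
  have h0 := hGext.hasFDerivAt_eq_zero hGd
  ext1 v
  have h1 : ((starRingEnd ℂ) (F z) * fderiv ℝ F z v).im = 0 := DFunLike.congr_fun h0 v
  have h2 : (starRingEnd ℂ) (F z) * fderiv ℝ F z v = 0 := Complex.ext (hre v) h1
  refine (mul_eq_zero.1 h2).resolve_left fun h3 => ?_
  rw [map_eq_zero, hz] at h3
  exact Complex.exp_ne_zero _ h3

open ContinuousMap in
theorem isSquare_sub_const {X : Type*} [TopologicalSpace X] [CompactSpace X] {Q : Set ℂ}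
    (hQ : Convex ℝ Q) (hQc : IsCompact Q) {w : C(X, ℂ)} (hwQ : ∀ x, w x ∈ Q) {τ : ℂ → ℝ}
    (hτ : ContinuousOn τ Q) {t : ℝ} (hτw : ∀ x, τ (w x) = t)
    (hloc : ∀ z ∈ interior Q, ¬ IsLocalExtr τ z) {a : ℂ} (ha : ∀ x, w x ≠ a) :
    IsSquare (w - const X a) := by
  let Z := Set.range w
  have hZ : IsCompact Z := isCompact_range w.continuous
  have hZQ : Z ⊆ Q := Set.range_subset_iff.2 hwQ
  have hτZ : ∀ z ∈ Z, τ z = t := by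
    rintro _ ⟨x, rfl⟩
    exact hτw x
  replace ha : a ∉ Z := by
    rintro ⟨x, hx⟩
    exact ha x hx
  let P : ℂ → Prop := fun a => IsSquare (w - const X a)
  have hnear : ∀ a ∉ Z, ∃ r > 0, ∀ b ∈ Metric.ball a r, b ∉ Z ∧ (P a ↔ P b) := by
    intro a ha
    obtain ⟨r, hr, hrZ⟩ := Metric.isOpen_iff.1 hZ.isClosed.isOpen_compl a ha
    refine ⟨r / 2, by positivity, fun b hb => ?_⟩
    rw [mem_ball_iff_norm] at hb
    refine ⟨hrZ (by rw [mem_ball_iff_norm]; linarith), ?_⟩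
    have h1 : ∀ z : X, r ≤ ‖w z - a‖ := fun z => by
      by_contra! h
      exact hrZ (mem_ball_iff_norm.2 h) ⟨z, rfl⟩
    have h2 : ∀ z : X, r / 2 < ‖w z - b‖ := fun z => by
      have h3 : ‖w z - a‖ ≤ ‖w z - b‖ + ‖b - a‖ := by
        rw [← sub_add_sub_cancel (w z) b a]; exact norm_add_le _ _
      linarith [h1 z]
    constructor
    · refine isSquare_of_norm_sub_lt fun z => ?_
      change ‖(w z - b) - (w z - a)‖ < ‖w z - a‖
      rw [sub_sub_sub_cancel_left, norm_sub_rev]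
      linarith [h1 z]
    · refine isSquare_of_norm_sub_lt fun z => ?_
      change ‖(w z - a) - (w z - b)‖ < ‖w z - b‖
      rw [sub_sub_sub_cancel_left]
      linarith [h2 z]
  have hout : ∀ a ∉ Q, P a := by
    intro a ha
    obtain ⟨f, u, hu, hu'⟩ := RCLike.geometric_hahn_banach_closed_point (𝕜 := ℂ) hQ
      hQc.isClosed ha
    have hf : ∀ z, f z = z * f 1 := fun z => by
      rw [← smul_eq_mul, ← map_smul, smul_eq_mul, mul_one]
    refine isSquare_of_mul (g := const X (-f 1)) ?_ (isSquare_const _) fun z h0 => ?_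
    · refine isSquare_of_mem_slitPlane fun z => Or.inl ?_
      change 0 < ((w z - a) * (-f 1)).re
      have e1 : (w z - a) * (-f 1) = f a - f (w z) := by rw [hf a, hf (w z)]; ring
      rw [e1, Complex.sub_re]
      have h1 := hu (w z) (hwQ z)
      change (f (w z)).re < u at h1
      change u < (f a).re at hu'
      linarith
    · have h1 : f 1 = 0 := neg_eq_zero.1 h0
      have h2 := hu (w z) (hwQ z)
      rw [hf, h1, mul_zero] at h2 hu'
      exact lt_asymm h2 hu'
  let V : Set ℂ := {a | a ∉ Z ∧ ¬ P a}
  have hVQ : V ⊆ Q := fun a ha => by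
    by_contra h
    exact ha.2 (hout a h)
  have hVo : IsOpen V := by
    refine Metric.isOpen_iff.2 fun a ha => ?_
    obtain ⟨r, hr, h⟩ := hnear a ha.1
    exact ⟨r, hr, fun b hb => ⟨(h b hb).1, fun hb' => ha.2 ((h b hb).2.2 hb')⟩⟩
  have hVc : closure V ⊆ V ∪ Z := by
    refine fun a ha => or_iff_not_imp_right.2 fun haZ => ⟨haZ, fun haP => ?_⟩
    obtain ⟨r, hr, h⟩ := hnear a haZ
    obtain ⟨b, hb, hbV⟩ := mem_closure_iff.1 ha _ Metric.isOpen_ball (Metric.mem_ball_self hr)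
    exact hbV.2 ((h b hb).2.1 haP)
  by_contra hcon
  have hVcQ : closure V ⊆ Q := hVc.trans (Set.union_subset hVQ hZQ)
  have hVcomp : IsCompact (closure V) := hQc.of_isClosed_subset isClosed_closure hVcQ
  have haV : a ∈ V := ⟨ha, hcon⟩
  have hInt : ∀ z ∈ V, z ∈ interior Q := fun z hz => interior_maximal hVQ hVo hz
  obtain ⟨p, hp, hpmax⟩ := hVcomp.exists_isMaxOn ⟨a, subset_closure haV⟩ (hτ.mono hVcQ)
  obtain ⟨q, hq, hqmin⟩ := hVcomp.exists_isMinOn ⟨a, subset_closure haV⟩ (hτ.mono hVcQ)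
  rcases hVc hp with hp' | hp'
  · exact hloc p (hInt p hp') (Or.inr (hpmax.isLocalMax
      (Filter.mem_of_superset (hVo.mem_nhds hp') subset_closure)))
  rcases hVc hq with hq' | hq'
  · exact hloc q (hInt q hq') (Or.inl (hqmin.isLocalMin
      (Filter.mem_of_superset (hVo.mem_nhds hq') subset_closure)))
  have hmax : ∀ z ∈ closure V, τ z ≤ t := fun z hz => hτZ p hp' ▸ hpmax hz
  have hmin : ∀ z ∈ closure V, t ≤ τ z := fun z hz => hτZ q hq' ▸ hqmin hz
  refine hloc a (hInt a haV) (Or.inr ?_)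
  filter_upwards [hVo.mem_nhds haV] with z hz
  exact (hmax z (subset_closure hz)).trans (hmin a (subset_closure haV))

/-- A nonvanishing function is a square if it is a square on every fibre of a continuous function
with discrete values. -/
theorem ContinuousMap.isSquare_of_fibers {X : Type*} [TopologicalSpace X] {k : X → ℤ}
    (hk : Continuous k) {g : C(X, ℂ)} (h : ∀ j, IsSquare (g.restrict {x | k x = j})) :
    IsSquare g := by
  choose b hb using h
  have hb' : ∀ x, g x = b (k x) ⟨x, rfl⟩ * b (k x) ⟨x, rfl⟩ := fun x =>
    DFunLike.congr_fun (hb (k x)) ⟨x, rfl⟩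
  refine ⟨⟨fun x => b (k x) ⟨x, rfl⟩, ?_⟩, ext hb'⟩
  refine continuous_iff_continuousAt.2 fun x => ?_
  have hopen : IsOpen {y | k y = k x} := (isOpen_discrete {k x}).preimage hk
  have h1 : ContinuousOn (fun y => b (k y) ⟨y, rfl⟩) {y | k y = k x} := by
    rw [continuousOn_iff_continuous_domRestrict]
    refine (b (k x)).continuous.congr fun y => ?_
    obtain ⟨y, hy⟩ := y
    change b (k x) ⟨y, hy⟩ = b (k y) ⟨y, rfl⟩
    have hy' : k y = k x := hy
    generalize k x = j at hy hy'
    subst hy'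
    rfl
  exact h1.continuousAt (hopen.mem_nhds rfl)

end

section

open MeasureTheory Real

namespace IsUnimodularDisc

variable {Q : Set (ℝ × ℝ)} {φ : ℝ × ℝ → Fin 2 → ℂ} {F : ℝ × ℝ → ℂ} {τ : ℝ × ℝ → ℝ}

theorem isSquare_of_const (hd : IsUnimodularDisc Q φ F) (hτ : ContinuousOn τ Q)
    (hFτ : ∀ x ∈ Q, F x = Complex.exp (τ x * Complex.I)) {X : Type*} [TopologicalSpace X]
    [CompactSpace X] {w : C(X, ℝ × ℝ)} (hinj : Function.Injective w) (hwQ : ∀ x, w x ∈ Q) {t : ℝ}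
    (ht : ∀ x, τ (w x) = t) {g : C(X, ℂ)} (hg : ∀ x, g x ≠ 0) : IsSquare g := by
  let e := Complex.equivRealProdCLM
  let w' : C(X, ℂ) := ⟨fun x => e.symm (w x), e.symm.continuous.comp w.continuous⟩
  have hew : ∀ x, e (w' x) = w x := fun x => e.apply_symm_apply _
  have hpre : e ⁻¹' Q = e.symm '' Q := (e.toEquiv.symm.image_eq_preimage_symm Q).symm
  have hQ' : IsCompact (e ⁻¹' Q) := by
    rw [hpre]
    exact hd.isCompact.image e.symm.continuous
  refine ContinuousMap.isSquare_of_volume_range_eq_zero (w := w') (e.symm.injective.comp hinj)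
    ?_ (fun a ha => ?_) hg
  · have h1 : Set.range w' = e.symm '' Set.range w := (Set.range_comp e.symm w)
    rw [h1]
    refine volume_image_fiber_eq_zero (F := F) (c := Complex.exp (t * Complex.I)) ?_ ?_ ?_ ?_
    · rintro _ ⟨x, rfl⟩
      rw [hFτ _ (hwQ x), ht]
    · rintro _ ⟨x, rfl⟩
      exact hd.differentiableAt' _ (hwQ x)
    · rintro _ ⟨x, rfl⟩
      exact hd.fderiv_ne_zero _ (hwQ x)
    · exact fun x _ => e.symm.differentiableAt
  · refine isSquare_sub_const (Q := e ⁻¹' Q) (τ := τ ∘ e) (t := t)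
      (hd.convex.linear_preimage (e : ℂ →ₗ[ℝ] ℝ × ℝ)) hQ' (fun x => ?_)
      (hτ.comp e.continuous.continuousOn fun x hx => hx) (fun x => ?_) (fun z hz hext => ?_) ha
    · rw [Set.mem_preimage, hew]
      exact hwQ x
    · rw [Function.comp_apply, hew, ht]
    · have hzQ : e z ∈ Q := interior_subset (s := e ⁻¹' Q) hz
      have hnhds : e ⁻¹' Q ∈ nhds z := mem_interior_iff_mem_nhds.1 hz
      have hFd : HasFDerivAt (F ∘ e) ((fderiv ℝ F (e z)).comp (e : ℂ →L[ℝ] ℝ × ℝ)) z :=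
        (hd.differentiableAt' _ hzQ).hasFDerivAt.comp z e.hasFDerivAt
      have h0 := fderiv_eq_zero_of_isLocalExtr (F := F ∘ e) (τ := τ ∘ e) hFd.differentiableAt
        ((hτ.comp e.continuous.continuousOn fun x hx => hx).continuousAt hnhds)
        (by filter_upwards [hnhds] with x hx using hFτ _ hx)
        (fun v => by
          rw [hFd.fderiv]
          exact hd.re_eq_zero _ hzQ _) hext
      rw [hFd.fderiv] at h0
      refine hd.fderiv_ne_zero _ hzQ (ContinuousLinearMap.ext fun v => ?_)
      have h1 : fderiv ℝ F (e z) (e (e.symm v)) = 0 := DFunLike.congr_fun h0 (e.symm v)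
      rwa [e.apply_symm_apply] at h1

theorem isSquare (hd : IsUnimodularDisc Q φ F) (hτ : ContinuousOn τ Q)
    (hFτ : ∀ x ∈ Q, F x = Complex.exp (τ x * Complex.I)) {X : Type*} [TopologicalSpace X]
    [CompactSpace X] {w : C(X, ℝ × ℝ)} (hinj : Function.Injective w) (hwQ : ∀ x, w x ∈ Q) {c : ℂ}
    (hc : ∀ x, F (w x) = c) {g : C(X, ℂ)} (hg : ∀ x, g x ≠ 0) : IsSquare g := by
  rcases isEmpty_or_nonempty X with hX | ⟨⟨x₀⟩⟩
  · exact ⟨g, by ext x; exact (hX.false x).elim⟩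
  have hex : ∀ x, ∃ k : ℤ, τ (w x) = τ (w x₀) + k * (2 * π) := by
    intro x
    have h1 := (hc x).trans (hc x₀).symm
    rw [hFτ _ (hwQ x), hFτ _ (hwQ x₀), Complex.exp_eq_exp_iff_exists_int] at h1
    obtain ⟨k, hk⟩ := h1
    refine ⟨k, ?_⟩
    have := congrArg Complex.im hk
    simpa using this
  choose k hk using hex
  have hτw : Continuous fun x => τ (w x) := hτ.comp_continuous w.continuous hwQ
  have hkc : Continuous k := by
    rw [Int.isClosedEmbedding_coe_real.isEmbedding.continuous_iff]
    refine ((hτw.sub (continuous_const (y := τ (w x₀)))).div_const (2 * π)).congr fun x => ?_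
    change (τ (w x) - τ (w x₀)) / (2 * π) = (k x : ℝ)
    rw [hk x, add_sub_cancel_left, mul_div_cancel_right₀ _ two_pi_pos.ne']
  refine ContinuousMap.isSquare_of_fibers hkc fun j => ?_
  have hcl : IsClosed {x | k x = j} := isClosed_singleton.preimage hkc
  have hcs : CompactSpace {x | k x = j} := isCompact_iff_compactSpace.1 hcl.isCompact
  refine hd.isSquare_of_const hτ hFτ (w := w.restrict {x | k x = j})
    (t := τ (w x₀) + j * (2 * π)) (fun x y h => Subtype.ext (hinj h)) (fun x => hwQ x.1)
    (fun x => ?_) fun x => hg x.1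
  have h1 := hk x.1
  rw [x.2] at h1
  exact h1

theorem exists_mul_self_eq (hd : IsUnimodularDisc Q φ F) (hτ : ContinuousOn τ Q)
    (hFτ : ∀ x ∈ Q, F x = Complex.exp (τ x * Complex.I)) {c : ℂ} {E : Set (Fin 2 → ℂ)}
    (hE : E ⊆ φ '' {x ∈ Q | F x = c}) (hEc : IsCompact E) (g : C(E, ℂ)) (hg : ∀ x, g x ≠ 0) :
    ∃ β : C(E, ℂ), β * β = g := by
  have hQc := hd.isCompact
  have hcs : CompactSpace E := isCompact_iff_compactSpace.1 hEc
  have hcsQ : CompactSpace Q := isCompact_iff_compactSpace.1 hQc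
  have hφ : Continuous fun x : Q => φ x := continuousOn_iff_continuous_domRestrict.1 hd.continuousOn
  have hemb : Topology.IsClosedEmbedding fun x : Q => φ x :=
    hφ.isClosedEmbedding fun x y h => Subtype.ext (hd.injOn x.2 y.2 h)
  have hex : ∀ z : E, ∃ x : Q, φ x = z.1 ∧ F x = c := fun z => by
    obtain ⟨x, ⟨hx, hxc⟩, hxz⟩ := hE z.2
    exact ⟨⟨x, hx⟩, hxz, hxc⟩
  choose ψ hψ hψc using hex
  have hψcont : Continuous ψ := by
    rw [hemb.isEmbedding.continuous_iff]
    exact continuous_subtype_val.congr fun z => (hψ z).symm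
  obtain ⟨β, hβ⟩ := hd.isSquare hτ hFτ (w := ⟨fun z => (ψ z).1, continuous_subtype_val.comp hψcont⟩)
    (fun z z' h => Subtype.ext (by
      rw [← hψ z, ← hψ z']
      exact congrArg φ h)) (fun z => (ψ z).2) hψc hg
  exact ⟨β, hβ.symm⟩

end IsUnimodularDisc

end

section

open MeasureTheory Real

theorem exists_continuousOn_eq_exp_of_norm_eq_one {F : ℝ × ℝ → ℂ}
    (hF : ContinuousOn F (Metric.closedBall 0 1))
    (hF1 : ∀ x ∈ Metric.closedBall (0 : ℝ × ℝ) 1, ‖F x‖ = 1) :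
    ∃ τ : ℝ × ℝ → ℝ, ContinuousOn τ (Metric.closedBall 0 1) ∧
      ∀ x ∈ Metric.closedBall (0 : ℝ × ℝ) 1, F x = Complex.exp (τ x * Complex.I) := by
  let r : ℝ × ℝ → ℝ × ℝ := fun x => (max 1 ‖x‖)⁻¹ • x
  have hm : ∀ x : ℝ × ℝ, 0 < max 1 ‖x‖ := fun x => lt_max_of_lt_left one_pos
  have hrc : Continuous r :=
    ((continuous_const.max continuous_norm).inv₀ fun x => (hm x).ne').smul continuous_id
  have hr : ∀ x, r x ∈ Metric.closedBall (0 : ℝ × ℝ) 1 := fun x => by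
    rw [mem_closedBall_zero_iff, norm_smul, norm_inv, norm_of_nonneg (hm x).le, inv_mul_eq_div,
      div_le_one (hm x)]
    exact le_max_right _ _
  have hrQ : ∀ x ∈ Metric.closedBall (0 : ℝ × ℝ) 1, r x = x := fun x hx => by
    rw [mem_closedBall_zero_iff] at hx
    change (max 1 ‖x‖)⁻¹ • x = x
    rw [max_eq_left hx, inv_one, one_smul]
  have hctr : ContractibleSpace (Set.univ : Set (ℝ × ℝ)) :=
    convex_univ.contractibleSpace Set.univ_nonempty
  have hsc : IsSimplyConnected (Set.univ : Set (ℝ × ℝ)) := SimplyConnectedSpace.ofContractible _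
  obtain ⟨f, hf, hfF⟩ := Complex.exists_continuousOn_eqOn_exp_comp (X := ℝ × ℝ) (U := Set.univ)
    hsc isOpen_univ (g := F ∘ r)
    (hF.comp hrc.continuousOn fun x _ => hr x) (by
      rintro ⟨x, -, hx⟩
      have h1 := hF1 _ (hr x)
      change F (r x) = 0 at hx
      rw [hx, norm_zero] at h1
      exact one_ne_zero h1.symm)
  refine ⟨fun x => (f x).im, (Complex.continuous_im.comp_continuousOn hf).mono
    (Set.subset_univ _), fun x hx => ?_⟩
  have h1 : Complex.exp (f x) = F (r x) := hfF (Set.mem_univ x)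
  rw [hrQ x hx] at h1
  have h2 : (f x).re = 0 := by
    have := hF1 x hx
    rw [← h1, Complex.norm_exp, exp_eq_one_iff] at this
    exact this
  rw [← h1]
  congr 1
  apply Complex.ext <;> simp [h2]

theorem IsUnimodularDisc.hullOf_subset {Q : Set (ℝ × ℝ)} {φ : ℝ × ℝ → Fin 2 → ℂ}
    {h : (Fin 2 → ℂ) → ℂ} (hd : IsUnimodularDisc Q φ (h ∘ φ)) {τ : ℝ × ℝ → ℝ}
    (hτ : ContinuousOn τ Q) (hFτ : ∀ x ∈ Q, h (φ x) = Complex.exp (τ x * Complex.I))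
    (hh : ∀ x ∈ Q, ContDiffAt ℂ 1 h (φ x) ∧ fderiv ℂ h (φ x) ≠ 0)
    (hpoly : ∀ ε > 0, ∃ p, ∀ x ∈ Q, ‖h (φ x) - MvPolynomial.eval (φ x) p‖ ≤ ε) :
    hullOf (φ '' Q) ⊆ φ '' Q := by
  obtain ⟨T, C, hT, hTv⟩ := hd.exists_isTangentField
  have hKc : IsCompact (φ '' Q) := hd.isCompact.image_of_continuousOn hd.continuousOn
  have hcs : CompactSpace (φ '' Q) := isCompact_iff_compactSpace.1 hKc
  have hcsQ : CompactSpace Q := isCompact_iff_compactSpace.1 hd.isCompact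
  have hemb : Topology.IsClosedEmbedding fun x : Q => φ x :=
    (continuousOn_iff_continuous_domRestrict.1 hd.continuousOn).isClosedEmbedding
      fun x y h => Subtype.ext (hd.injOn x.2 y.2 h)
  have hex : ∀ z : φ '' Q, ∃ x : Q, φ x = z.1 := fun z => by
    obtain ⟨x, hx, hxz⟩ := z.2
    exact ⟨⟨x, hx⟩, hxz⟩
  choose ψ hψ using hex
  have hψc : Continuous ψ := by
    rw [hemb.isEmbedding.continuous_iff]
    exact continuous_subtype_val.congr fun z => (hψ z).symm
  have hhc : Continuous fun z : φ '' Q => h z := by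
    refine ((continuousOn_iff_continuous_domRestrict.1 hd.continuousOn').comp hψc).congr fun z => ?_
    exact congrArg h (hψ z)
  let h' : C(φ '' Q, ℂ) := ⟨fun z => h z, hhc⟩
  let τ' : C(φ '' Q, ℂ) := ⟨fun z => τ (ψ z) * Complex.I,
    (Complex.continuous_ofReal.comp (hτ.comp_continuous (continuous_subtype_val.comp hψc)
      fun z => (ψ z).2)).mul continuous_const⟩
  have hfib : ∀ c, (Subtype.val '' {x : φ '' Q | h' x = c}) = φ '' {x ∈ Q | (h ∘ φ) x = c} := by
    intro c
    ext z
    constructor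
    · rintro ⟨⟨_, x, hx, rfl⟩, hz, rfl⟩
      exact ⟨x, ⟨hx, hz⟩, rfl⟩
    · rintro ⟨x, ⟨hx, hxc⟩, rfl⟩
      exact ⟨⟨φ x, x, hx, rfl⟩, hxc, rfl⟩
  have hnull : ∀ c i, volume ((fun z : Fin 2 → ℂ => z i) '' (φ '' {x ∈ Q | (h ∘ φ) x = c})) = 0 := by
    intro c i
    rw [← Set.image_comp]
    refine volume_image_fiber_eq_zero (F := h ∘ φ) (c := c) (fun x hx => hx.2)
      (fun x hx => hd.differentiableAt' x hx.1) (fun x hx => hd.fderiv_ne_zero x hx.1) fun x hx => ?_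
    exact differentiableAt_pi.1 (hd.differentiableAt x hx.1) i
  refine hullOf_subset_of_fibers (h := h') ?_ ?_ τ' ?_ (fun c i => ?_) fun c => ?_
  · refine mem_polyAlg_of_forall_exists fun ε hε => ?_
    obtain ⟨p, hp⟩ := hpoly ε hε
    refine ⟨p, fun z => ?_⟩
    rw [← hψ z]
    have h1 := hp (ψ z).1 (ψ z).2
    rw [hψ z] at h1 ⊢
    exact h1
  · intro z
    have h1 := hd.norm_eq_one (ψ z).1 (ψ z).2
    rw [Function.comp_apply, hψ z] at h1
    exact h1
  · intro z
    have h1 := hFτ (ψ z).1 (ψ z).2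
    rw [hψ z] at h1
    exact h1
  · rw [hfib]
    exact hnull c i
  · rw [hfib]
    have hSc : IsCompact (φ '' {x ∈ Q | (h ∘ φ) x = c}) := by
      have h1 : IsClosed (Q ∩ (h ∘ φ) ⁻¹' {c}) :=
        hd.continuousOn'.preimage_isClosed_of_isClosed hd.isCompact.isClosed isClosed_singleton
      exact (hd.isCompact.of_isClosed_subset h1 Set.inter_subset_left).image_of_continuousOn
        (hd.continuousOn.mono Set.inter_subset_left)
    refine (hT c).hullOf_subset hSc (h := h) (c := c) ?_ ?_ (hnull c) (fun E hE hEc g hg =>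
      hd.exists_mul_self_eq hτ hFτ hE hEc g hg) le_rfl hSc
    · rintro _ ⟨x, hx, rfl⟩
      exact hx.2
    · rintro _ ⟨x, ⟨hx, -⟩, rfl⟩
      obtain ⟨hh1, hh2⟩ := hh x hx
      refine ⟨hh1, ?_, hh2⟩
      obtain ⟨v, hv, hv'⟩ := hTv x hx
      have h1 := ((hh1.differentiableAt one_ne_zero).hasFDerivAt.restrictScalars ℝ).comp x
        (hd.differentiableAt x hx).hasFDerivAt
      rw [h1.fderiv] at hv'
      rw [hv]
      exact hv'

end

section

open MeasureTheory Real

theorem fderiv_comp_ne_zero {l : (Fin 2 → ℂ) →L[ℂ] ℂ} (hl : l ≠ 0)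
    {D : ℝ × ℝ →L[ℝ] Fin 2 → ℂ} (hinj : Function.Injective D)
    (hreal : ∀ v w, D v = Complex.I • D w → D v = 0) : ∃ v, l (D v) ≠ 0 := by
  by_contra! hcon
  have hlz : ∀ z : Fin 2 → ℂ, l z = z 0 * l (Pi.single 0 1) + z 1 * l (Pi.single 1 1) := by
    intro z
    have h1 : z = z 0 • Pi.single 0 1 + z 1 • Pi.single 1 1 := by
      ext i
      fin_cases i <;> simp
    conv_lhs => rw [h1, map_add, map_smul, map_smul]
    rfl
  set a := D (1, 0) with ha
  set b := D (0, 1) with hb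
  have ha0 : a ≠ 0 := fun h0 => by
    have := hinj (h0.trans (map_zero D).symm)
    simp at this
  have h1 := hcon (1, 0)
  have h2 := hcon (0, 1)
  rw [← ha, hlz] at h1
  rw [← hb, hlz] at h2
  set l₀ := l (Pi.single 0 1)
  set l₁ := l (Pi.single 1 1)
  have hdet : a 0 * b 1 = a 1 * b 0 := by
    by_cases h0 : l₀ = 0
    · have h3 : l₁ ≠ 0 := fun h3 => hl (ContinuousLinearMap.ext fun z => by
        rw [hlz]
        change z 0 * l₀ + z 1 * l₁ = 0
        rw [h0, h3]; ring)
      refine mul_right_cancel₀ h3 ?_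
      linear_combination a 0 * h2 - b 0 * h1
    · refine mul_right_cancel₀ h0 ?_
      linear_combination b 1 * h1 - a 1 * h2
  obtain ⟨c, hc⟩ : ∃ c : ℂ, b = c • a := by
    by_cases h0 : a 0 = 0
    · have h3 : a 1 ≠ 0 := fun h3 => ha0 (by ext i; fin_cases i; exacts [h0, h3])
      refine ⟨b 1 / a 1, ?_⟩
      ext i
      fin_cases i
      · change b 0 = b 1 / a 1 * a 0
        field_simp
        linear_combination -hdet
      · change b 1 = b 1 / a 1 * a 1
        field_simp
    · refine ⟨b 0 / a 0, ?_⟩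
      ext i
      fin_cases i
      · change b 0 = b 0 / a 0 * a 0
        field_simp
      · change b 1 = b 0 / a 0 * a 1
        field_simp
        linear_combination hdet
  have h3 : D (-c.re, 1) = Complex.I • D (c.im, 0) := by
    have e1 : ((-c.re, 1) : ℝ × ℝ) = (0, 1) - c.re • (1, 0) := by ext <;> simp
    have e2 : ((c.im, 0) : ℝ × ℝ) = c.im • (1, 0) := by ext <;> simp
    rw [e1, e2, map_sub, map_smul, map_smul, ← ha, ← hb, hc, ← Complex.coe_smul c.re,
      ← Complex.coe_smul c.im, smul_smul, ← sub_smul]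
    congr 1
    apply Complex.ext <;> simp
  have h4 := hinj ((hreal _ _ h3).trans (map_zero D).symm)
  simp at h4

theorem re_conj_mul_fderiv_eq_zero {F : ℝ × ℝ → ℂ}
    (hF1 : ∀ x ∈ Metric.closedBall (0 : ℝ × ℝ) 1, ‖F x‖ = 1)
    (hF : ∀ x ∈ Metric.closedBall (0 : ℝ × ℝ) 1, DifferentiableAt ℝ F x)
    (hF' : ContinuousOn (fderiv ℝ F) (Metric.closedBall 0 1)) {x : ℝ × ℝ}
    (hx : x ∈ Metric.closedBall (0 : ℝ × ℝ) 1) (v : ℝ × ℝ) :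
    ((starRingEnd ℂ) (F x) * fderiv ℝ F x v).re = 0 := by
  have hFc : ContinuousOn F (Metric.closedBall 0 1) := fun y hy =>
    (hF y hy).continuousAt.continuousWithinAt
  have hc : ContinuousOn (fun y => ((starRingEnd ℂ) (F y) * fderiv ℝ F y v).re)
      (Metric.closedBall 0 1) :=
    Complex.continuous_re.comp_continuousOn
      ((Complex.continuous_conj.comp_continuousOn hFc).mul (hF'.clm_apply continuousOn_const))
  have hcl := hc.preimage_isClosed_of_isClosed Metric.isClosed_closedBall
    (isClosed_singleton (x := (0 : ℝ)))
  have hsub : Metric.ball (0 : ℝ × ℝ) 1 ⊆ Metric.closedBall 0 1 ∩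
      (fun y => ((starRingEnd ℂ) (F y) * fderiv ℝ F y v).re) ⁻¹' {0} := by
    intro y hy
    have hy' := Metric.ball_subset_closedBall hy
    refine ⟨hy', ?_⟩
    have h1 := (hF y hy').hasFDerivAt.norm_sq
    have h2 : (fun z => ‖F z‖ ^ 2) =ᶠ[nhds y] fun _ => (1 : ℝ) := by
      filter_upwards [Metric.isOpen_ball.mem_nhds hy] with z hz
      rw [hF1 z (Metric.ball_subset_closedBall hz), one_pow]
    have h3 := h1.unique ((hasFDerivAt_const (1 : ℝ) y).congr_of_eventuallyEq h2)
    have h4 := DFunLike.congr_fun h3 v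
    simp [Complex.inner] at h4
    change ((starRingEnd ℂ) (F y) * fderiv ℝ F y v).re = 0
    rw [Complex.mul_re, Complex.conj_re, Complex.conj_im]
    linear_combination h4 / 2
  have h1 := hcl.closure_subset_iff.2 hsub
  rw [closure_ball _ one_ne_zero] at h1
  exact (h1 hx).2

theorem hullOf_subset_of_disc {Ω : Set (Fin 2 → ℂ)} (hΩ : RungeDomain 2 Ω)
    {h : (Fin 2 → ℂ) → ℂ} (hhol : DifferentiableOn ℂ h Ω) {K : Set (Fin 2 → ℂ)}
    (hK : TotallyRealDisc 2 K) (hKΩ : K ⊆ Ω) (hK1 : ∀ z ∈ K, ‖h z‖ = 1)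
    (hK0 : ∀ z ∈ K, fderiv ℂ h z ≠ 0) : hullOf K ⊆ K ∧ IsCompact K := by
  obtain ⟨U, φ, hU, hQU, hφ, hφi, hφ', hreal, rfl⟩ := hK
  set Q := Metric.closedBall (0 : ℝ × ℝ) 1
  have hQ : Convex ℝ Q := convex_closedBall _ _
  have hQc : IsCompact Q := isCompact_closedBall _ _
  have hφd : ∀ x ∈ Q, DifferentiableAt ℝ φ x := fun x hx =>
    (hφ.differentiableOn (by norm_num)).differentiableAt (hU.mem_nhds (hQU hx))
  obtain ⟨L₀, hL₀⟩ := (hφ.mono hQU).exists_lipschitzOnWith (by norm_num) hQ hQc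
  obtain ⟨L, hL⟩ := ((hφ.fderiv_of_isOpen hU (m := 1) (by norm_num)).mono
    hQU).exists_lipschitzOnWith (by norm_num) hQ hQc
  have hKc : IsCompact (φ '' Q) := hQc.image_of_continuousOn hL₀.continuousOn
  obtain ⟨L₁, hL₁⟩ := ((hΩ.locallyLipschitzOn_fderiv hhol).mono
    hKΩ).exists_lipschitzOnWith_of_compact hKc
  have hmem : ∀ x ∈ Q, φ x ∈ φ '' Q := fun x hx => Set.mem_image_of_mem φ hx
  have hhd : ∀ x ∈ Q, DifferentiableAt ℂ h (φ x) := fun x hx =>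
    hhol.differentiableAt (hΩ.1.mem_nhds (hKΩ (hmem x hx)))
  have hFd : ∀ x ∈ Q, HasFDerivAt (h ∘ φ)
      (((fderiv ℂ h (φ x)).restrictScalars ℝ).comp (fderiv ℝ φ x)) x := fun x hx =>
    ((hhd x hx).hasFDerivAt.restrictScalars ℝ).comp x (hφd x hx).hasFDerivAt
  obtain ⟨A, hA⟩ := hQc.exists_bound_of_continuousOn hL.continuousOn
  obtain ⟨B, hB⟩ := hKc.exists_bound_of_continuousOn hL₁.continuousOn
  have hLF : LipschitzOnWith (L₁ * L₀ * A + B * L).toNNReal (fderiv ℝ (h ∘ φ)) Q := by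
    refine LipschitzOnWith.of_dist_le' fun x hx y hy => ?_
    rw [dist_eq_norm, dist_eq_norm, (hFd x hx).fderiv, (hFd y hy).fderiv]
    have h1 : ‖fderiv ℂ h (φ x) - fderiv ℂ h (φ y)‖ ≤ L₁ * (L₀ * ‖x - y‖) :=
      (hL₁.norm_sub_le (hmem x hx) (hmem y hy)).trans
        (mul_le_mul_of_nonneg_left (hL₀.norm_sub_le hx hy) L₁.2)
    have h2 := hL.norm_sub_le hx hy
    have e : ((fderiv ℂ h (φ x)).restrictScalars ℝ).comp (fderiv ℝ φ x) -
        ((fderiv ℂ h (φ y)).restrictScalars ℝ).comp (fderiv ℝ φ y) =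
        ((fderiv ℂ h (φ x) - fderiv ℂ h (φ y)).restrictScalars ℝ).comp (fderiv ℝ φ x) +
        ((fderiv ℂ h (φ y)).restrictScalars ℝ).comp (fderiv ℝ φ x - fderiv ℝ φ y) := by
      refine ContinuousLinearMap.ext fun v => ?_
      change fderiv ℂ h (φ x) (fderiv ℝ φ x v) - fderiv ℂ h (φ y) (fderiv ℝ φ y v) =
        (fderiv ℂ h (φ x) (fderiv ℝ φ x v) - fderiv ℂ h (φ y) (fderiv ℝ φ x v)) +
        fderiv ℂ h (φ y) (fderiv ℝ φ x v - fderiv ℝ φ y v)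
      rw [map_sub]
      ring
    have hB0 : 0 ≤ B := (norm_nonneg _).trans (hB _ (hmem y hy))
    rw [e]
    calc _ ≤ ‖fderiv ℂ h (φ x) - fderiv ℂ h (φ y)‖ * ‖fderiv ℝ φ x‖ +
          ‖fderiv ℂ h (φ y)‖ * ‖fderiv ℝ φ x - fderiv ℝ φ y‖ := by
            refine (norm_add_le _ _).trans (add_le_add ?_ ?_)
            · refine (ContinuousLinearMap.opNorm_comp_le _ _).trans_eq ?_
              rw [ContinuousLinearMap.norm_restrictScalars]
            · refine (ContinuousLinearMap.opNorm_comp_le _ _).trans_eq ?_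
              rw [ContinuousLinearMap.norm_restrictScalars]
      _ ≤ L₁ * (L₀ * ‖x - y‖) * A + B * (L * ‖x - y‖) := by
            refine add_le_add (mul_le_mul h1 (hA x hx) (norm_nonneg _) (by positivity))
              (mul_le_mul (hB _ (hmem y hy)) h2 (norm_nonneg _) hB0)
      _ = _ := by ring
  have hd : IsUnimodularDisc Q φ (h ∘ φ) :=
    { isCompact := hQc
      convex := hQ
      injOn := hφi.mono hQU
      differentiableAt := hφd
      lipschitz := ⟨L, hL⟩
      injective_fderiv := fun x hx => hφ' x (hQU hx)
      norm_eq_one := fun x hx => hK1 _ (hmem x hx)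
      differentiableAt' := fun x hx => (hFd x hx).differentiableAt
      lipschitz' := ⟨_, hLF⟩
      fderiv_ne_zero := fun x hx h0 => by
        obtain ⟨v, hv⟩ := fderiv_comp_ne_zero (hK0 _ (hmem x hx)) (hφ' x (hQU hx))
          (hreal x (hQU hx))
        rw [(hFd x hx).fderiv] at h0
        exact hv (DFunLike.congr_fun h0 v)
      re_eq_zero := fun x hx v => re_conj_mul_fderiv_eq_zero (fun x hx => hK1 _ (hmem x hx))
        (fun x hx => (hFd x hx).differentiableAt) hLF.continuousOn hx v }
  obtain ⟨τ, hτ, hFτ⟩ := exists_continuousOn_eq_exp_of_norm_eq_one hd.continuousOn' hd.norm_eq_one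
  refine ⟨hd.hullOf_subset hτ hFτ (fun x hx =>
    ⟨hΩ.contDiffAt hhol (hKΩ (hmem x hx)), hK0 _ (hmem x hx)⟩) fun ε hε => ?_, hKc⟩
  obtain ⟨p, hp⟩ := hΩ.2.2 h hhol _ hKΩ hKc ε hε
  exact ⟨p, fun x hx => hp _ (hmem x hx)⟩

end

/-- Let `Ω ⊆ ℂ²` be a Runge domain, `h` holomorphic on `Ω`,
`M := {z ∈ Ω : |h z| = 1}`, `G := Ω ∖ {z ∈ Ω : |h z| = 1, dh z = 0}`,
`M* := {z ∈ G : |h z| = 1}` the regular part, and `M_sing := M ∖ M*`. A totally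
real `C²`-smooth disc `K ⊆ M*` is polynomially convex iff `K̂ ∩ M_sing = ∅`. -/
theorem totallyRealDisc_in_regular_part_polyConvex_iff
    (Ω : Set (Fin 2 → ℂ)) (hΩ : RungeDomain 2 Ω)
    (h : (Fin 2 → ℂ) → ℂ) (hhol : DifferentiableOn ℂ h Ω)
    (M G Mstar Msing : Set (Fin 2 → ℂ))
    (hM : M = {z ∈ Ω | ‖h z‖ = 1})
    (hG : G = Ω \ {z ∈ Ω | ‖h z‖ = 1 ∧ fderiv ℂ h z = 0})
    (hMstar : Mstar = {z ∈ G | ‖h z‖ = 1})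
    (hMsing : Msing = M \ Mstar)
    (K : Set (Fin 2 → ℂ)) (hK : TotallyRealDisc 2 K) (hKM : K ⊆ Mstar) :
    PolyConvex 2 K ↔ polyHull 2 K ∩ Msing = ∅ := by
  subst hM hG hMstar hMsing
  have hconv : PolyConvex 2 K := by
    obtain ⟨h1, h2⟩ := hullOf_subset_of_disc hΩ hhol hK (fun z hz => (hKM hz).1.1)
      (fun z hz => (hKM hz).2) fun z hz h0 => (hKM hz).1.2 ⟨(hKM hz).1.1, (hKM hz).2, h0⟩
    rw [PolyConvex, polyHull_eq_hullOf h2]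
    exact h1.antisymm subset_hullOf
  refine iff_of_true hconv (Set.eq_empty_of_forall_notMem fun z hz => hz.2.2 (hKM ?_))
  have h1 : polyHull 2 K = K := hconv
  exact h1 ▸ hz.1
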